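/- Let g be a classical Lie superalgebra and M an object of F = F(g, g_0̄). Then the complexity of M satisfies c_F(M) ≤ dim_ℂ g_1̄. In particular, every M in F admits a projective resolution in F whose rate of growth is at most dim_ℂ g_1̄. -/

import Mathlib

/-!
# Framework: Lie superalgebras over ℂ and their supermodules

A ℤ/2-graded vector space is encoded by a carrier together with a pair of complementary
subspaces (`part 0`, `part 1`).  A Lie superalgebra is such a space with a bilinear
bracket which preserves the grading and satisfies the graded antisymmetry and graded
Jacobi identities (stated on homogeneous elements, with the sign `(-1)^{|x||y|}`).
A `g`-supermodule is a graded vector space with an action of `g` satisfying the graded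
module axiom; morphisms are arbitrary (not necessarily grading-preserving) supermodule
homomorphisms, encoded by the sign-twisted intertwining condition
`f(x·m) = x·(σ^{|x|} f (σ^{|x|} m))`, which for homogeneous `f` is exactly
`f(x·m) = (-1)^{|f||x|} x·f(m)`.
`F = F(g, g₀̄)` is the category of finite-dimensional supermodules which are completely
reducible over `g₀̄`, and `C(g, g₀̄)` that of all supermodules which are finitely
semisimple (sums of finite-dimensional simple `g₀̄`-submodules) over `g₀̄`.
-/

noncomputable section

open LinearMap Submodule Module

/-- The sign `(-1)^{ij}` attached to a pair of parities `i j : ℤ/2`. -/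
def ssgn (i j : ZMod 2) : ℂ := if i = 1 ∧ j = 1 then -1 else 1

/-- A ℤ/2-graded (super) complex vector space. -/
structure SuperVS : Type 1 where
  carrier : Type
  [addCommGroup : AddCommGroup carrier]
  [module : Module ℂ carrier]
  part : ZMod 2 → Submodule ℂ carrier
  isCompl : IsCompl (part 0) (part 1)

attribute [instance] SuperVS.addCommGroup SuperVS.module

namespace SuperVS

variable (W : SuperVS)

/-- The projection onto the even part along the odd part. -/
def projEven : W.carrier →ₗ[ℂ] W.carrier :=
  (W.part 0).subtype ∘ₗ (W.part 0).linearProjOfIsCompl (W.part 1) W.isCompl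

/-- The projection onto the odd part along the even part. -/
def projOdd : W.carrier →ₗ[ℂ] W.carrier :=
  (W.part 1).subtype ∘ₗ (W.part 1).linearProjOfIsCompl (W.part 0) W.isCompl.symm

/-- The projection onto the part of parity `p`. -/
def proj (p : ZMod 2) : W.carrier →ₗ[ℂ] W.carrier :=
  if p = 0 then W.projEven else W.projOdd

/-- The parity involution `σ` (identity on the even part, `-1` on the odd part). -/
def pty : W.carrier →ₗ[ℂ] W.carrier := W.projEven - W.projOdd

/-- `σ^i` for a parity `i : ℤ/2`. -/
def ptyPow (i : ZMod 2) : W.carrier →ₗ[ℂ] W.carrier :=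
  if i = 0 then LinearMap.id else W.pty

/-- A subspace is graded if it is the (internal direct) sum of its graded pieces;
equivalently, it is stable under the parity involution. -/
def IsGraded (U : Submodule ℂ W.carrier) : Prop :=
  ∀ m ∈ U, W.pty m ∈ U

end SuperVS

/-- A Lie superalgebra over `ℂ`: a super vector space with a grading-preserving bilinear
bracket satisfying the graded antisymmetry and graded Jacobi identities. -/
structure LieSuperAlgebra extends SuperVS where
  bracket : carrier →ₗ[ℂ] carrier →ₗ[ℂ] carrier
  bracket_grading : ∀ (i j : ZMod 2), ∀ x ∈ part i, ∀ y ∈ part j,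
    bracket x y ∈ part (i + j)
  bracket_skew : ∀ (i j : ZMod 2), ∀ x ∈ part i, ∀ y ∈ part j,
    bracket x y = -(ssgn i j) • bracket y x
  bracket_jacobi : ∀ (i j k : ZMod 2), ∀ x ∈ part i, ∀ y ∈ part j, ∀ z ∈ part k,
    bracket x (bracket y z) = bracket (bracket x y) z + ssgn i j • bracket y (bracket x z)

namespace LieSuperAlgebra

variable (g : LieSuperAlgebra)

/-- A `g`-supermodule: a super vector space with a `g`-action satisfying the graded
module axiom `[x,y]·m = x·(y·m) - (-1)^{|x||y|} y·(x·m)` and preserving the grading. -/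
structure SuperModule extends SuperVS where
  act : g.carrier →ₗ[ℂ] carrier →ₗ[ℂ] carrier
  act_grading : ∀ (i j : ZMod 2), ∀ x ∈ g.part i, ∀ m ∈ part j,
    act x m ∈ part (i + j)
  act_bracket : ∀ (i j : ZMod 2), ∀ x ∈ g.part i, ∀ y ∈ g.part j, ∀ m : carrier,
    act (g.bracket x y) m = act x (act y m) - ssgn i j • act y (act x m)

namespace SuperModule

variable {g}
variable (M N : g.SuperModule)

/-- A subspace stable under the action of the even part `g₀̄`. -/
def IsEvenStable (U : Submodule ℂ M.carrier) : Prop :=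
  ∀ x ∈ g.part 0, ∀ m ∈ U, M.act x m ∈ U

/-- A subspace stable under the action of all of `g` (together with gradedness this is a
sub-supermodule). -/
def IsStable (U : Submodule ℂ M.carrier) : Prop :=
  ∀ x : g.carrier, ∀ m ∈ U, M.act x m ∈ U

/-- A sub-supermodule: a graded `g`-stable subspace. -/
def IsSubSuper (U : Submodule ℂ M.carrier) : Prop :=
  M.toSuperVS.IsGraded U ∧ M.IsStable U

/-- `M` is completely reducible (semisimple) as a module over the even part `g₀̄`:
every `g₀̄`-stable subspace has a `g₀̄`-stable complement. -/
def IsCompletelyReducibleEven : Prop :=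
  ∀ U : Submodule ℂ M.carrier, M.IsEvenStable U →
    ∃ U' : Submodule ℂ M.carrier, M.IsEvenStable U' ∧ IsCompl U U'

/-- Membership in the category `F = F(g, g₀̄)`: finite-dimensional and completely
reducible over `g₀̄`. -/
def MemF : Prop :=
  FiniteDimensional ℂ M.carrier ∧ M.IsCompletelyReducibleEven

/-- Membership in the category `C(g, g₀̄)`: finitely semisimple over `g₀̄`, i.e. the sum
of the finite-dimensional simple `g₀̄`-submodules is everything. -/
def MemC : Prop :=
  sSup {U : Submodule ℂ M.carrier |
      M.IsEvenStable U ∧ FiniteDimensional ℂ U ∧ U ≠ ⊥ ∧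
      ∀ U' ≤ U, M.IsEvenStable U' → U' = ⊥ ∨ U' = U} = ⊤

end SuperModule

/-- A homomorphism of `g`-supermodules (not necessarily grading-preserving): a linear
map satisfying `f(x·m) = x·(σ^{|x|} (f (σ^{|x|} m)))` for `x` homogeneous of parity
`|x|`; for `f` homogeneous this is the usual sign rule `f(x·m) = (-1)^{|f||x|} x·f(m)`. -/
structure SuperHom (M N : g.SuperModule) where
  toLinearMap : M.carrier →ₗ[ℂ] N.carrier
  compat : ∀ (i : ZMod 2), ∀ x ∈ g.part i, ∀ m : M.carrier,
    toLinearMap (M.act x m)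
      = N.act x (N.toSuperVS.ptyPow i (toLinearMap (M.toSuperVS.ptyPow i m)))

/-- Two supermodules are isomorphic in the category of `g`-supermodules. -/
def SuperIso (M N : g.SuperModule) : Prop :=
  ∃ f : g.SuperHom M N, Function.Bijective f.toLinearMap

/-- `P` is a projective object of `F(g, g₀̄)`. -/
def IsProjectiveInF (P : g.SuperModule) : Prop :=
  P.MemF ∧
  ∀ (M N : g.SuperModule), M.MemF → N.MemF →
    ∀ (p : g.SuperHom M N), Function.Surjective p.toLinearMap →
    ∀ (f : g.SuperHom P N),
      ∃ h : g.SuperHom P M, p.toLinearMap ∘ₗ h.toLinearMap = f.toLinearMap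

/-- `I` is an injective object of `F(g, g₀̄)`. -/
def IsInjectiveInF (I : g.SuperModule) : Prop :=
  I.MemF ∧
  ∀ (M N : g.SuperModule), M.MemF → N.MemF →
    ∀ (ι : g.SuperHom M N), Function.Injective ι.toLinearMap →
    ∀ (f : g.SuperHom M I),
      ∃ h : g.SuperHom N I, h.toLinearMap ∘ₗ ι.toLinearMap = f.toLinearMap

/-- A simple supermodule: nonzero, with no proper nonzero sub-supermodule. -/
def IsSimple (S : g.SuperModule) : Prop :=
  (⊥ : Submodule ℂ S.carrier) ≠ ⊤ ∧
  ∀ U : Submodule ℂ S.carrier, S.IsSubSuper U → U = ⊥ ∨ U = ⊤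

/-- `g` is a *classical* Lie superalgebra.  (In the paper this means that `g` is finite
dimensional and that there is a connected reductive algebraic group `G₀̄` with
`Lie(G₀̄) = g₀̄` whose action on `g₁̄` differentiates to the adjoint action; we encode
the resulting representation-theoretic content: `g` is finite dimensional, `g₀̄` is
reductive in the sense that its adjoint action on itself is completely reducible, and
`g₁̄` is a semisimple `g₀̄`-module.) -/
structure IsClassical : Prop where
  finiteDimensional : FiniteDimensional ℂ g.carrier
  even_reducible : ∀ U : Submodule ℂ g.carrier,
    U ≤ g.part 0 → (∀ x ∈ g.part 0, ∀ y ∈ U, g.bracket x y ∈ U) →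
    ∃ U', U' ≤ g.part 0 ∧ (∀ x ∈ g.part 0, ∀ y ∈ U', g.bracket x y ∈ U') ∧
      U ⊓ U' = ⊥ ∧ U ⊔ U' = g.part 0
  odd_reducible : ∀ U : Submodule ℂ g.carrier,
    U ≤ g.part 1 → (∀ x ∈ g.part 0, ∀ y ∈ U, g.bracket x y ∈ U) →
    ∃ U', U' ≤ g.part 1 ∧ (∀ x ∈ g.part 0, ∀ y ∈ U', g.bracket x y ∈ U') ∧
      U ⊓ U' = ⊥ ∧ U ⊔ U' = g.part 1

/-- A Type I (consistent ℤ-)grading `g = g₋₁ ⊕ g₀ ⊕ g₁` with `g₀̄ = g₀` and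
`g₁̄ = g₋₁ ⊕ g₁`.  The conditions `[g₁,g₁] = [g₋₁,g₋₁] = 0` and
`[g₀,g₊₁] ⊆ g₊₁`, `[g₀,g₋₁] ⊆ g₋₁` express compatibility of the ℤ-grading with the
bracket (the remaining compatibilities are automatic). -/
structure TypeIStructure where
  neg : Submodule ℂ g.carrier
  pos : Submodule ℂ g.carrier
  inf_eq_bot : neg ⊓ pos = ⊥
  sup_eq_odd : neg ⊔ pos = g.part 1
  even_neg : ∀ x ∈ g.part 0, ∀ y ∈ neg, g.bracket x y ∈ neg
  even_pos : ∀ x ∈ g.part 0, ∀ y ∈ pos, g.bracket x y ∈ pos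
  neg_neg : ∀ x ∈ neg, ∀ y ∈ neg, g.bracket x y = 0
  pos_pos : ∀ x ∈ pos, ∀ y ∈ pos, g.bracket x y = 0

/-- The support (rank) variety of `M` over an odd abelian (sub)algebra `W ⊆ g₁̄`:
`{x ∈ W | M is not projective as a U(⟨x⟩)-module} ∪ {0}`.  For `x` with `[x,x] = 0` the
module `M` is projective over `U(⟨x⟩) ≅ ℂ[x]/(x²)` precisely when `Ker x = Im x` on `M`. -/
def suppVariety (W : Submodule ℂ g.carrier) (M : g.SuperModule) : Set g.carrier :=
  {x | x ∈ W ∧ LinearMap.ker (M.act x) ≠ LinearMap.range (M.act x)} ∪ {0}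

end LieSuperAlgebra

/-!
# Projective resolutions, rate of growth, and complexity in `F(g, g₀̄)`
-/

namespace LieSuperAlgebra

variable (g : LieSuperAlgebra)

/-- A projective resolution `⋯ → P₁ → P₀ → M → 0` of `M` in the category `F(g, g₀̄)`. -/
structure ProjResF (M : g.SuperModule) where
  P : ℕ → g.SuperModule
  d : ∀ n : ℕ, g.SuperHom (P (n + 1)) (P n)
  aug : g.SuperHom (P 0) M
  projective : ∀ n, g.IsProjectiveInF (P n)
  aug_surjective : Function.Surjective aug.toLinearMap
  exact_at_zero : LinearMap.range (d 0).toLinearMap = LinearMap.ker aug.toLinearMap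
  exact : ∀ n, LinearMap.range (d (n + 1)).toLinearMap = LinearMap.ker (d n).toLinearMap

/-- A minimal projective resolution: one whose terms have the smallest possible
dimensions (a minimal resolution is a direct summand of any projective resolution). -/
def ProjResF.IsMinimal {M : g.SuperModule} (R : g.ProjResF M) : Prop :=
  ∀ R' : g.ProjResF M, ∀ n : ℕ,
    Module.finrank ℂ (R.P n).carrier ≤ Module.finrank ℂ (R'.P n).carrier

end LieSuperAlgebra

/-- `f` grows at rate at most `c`: there is `C > 0` with `f t ≤ C · t^{c-1}` for all
`t ≥ 1`. -/
def HasGrowthRateLE (f : ℕ → ℕ) (c : ℕ) : Prop :=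
  ∃ C : ℝ, 0 < C ∧ ∀ t : ℕ, 1 ≤ t → (f t : ℝ) ≤ C * (t : ℝ) ^ ((c : ℝ) - 1)

/-- The rate of growth `r(V_•)` of a sequence of dimensions: the smallest nonnegative
integer `c` such that `dim V_t ≤ C t^{c-1}` for some constant `C > 0`, or `⊤` if no such
integer exists. -/
def growthRate (f : ℕ → ℕ) : ℕ∞ :=
  sInf {c : ℕ∞ | ∃ c' : ℕ, c = (c' : ℕ∞) ∧ HasGrowthRateLE f c'}

/-- The sequence of dimensions of the terms of a projective resolution. -/
def LieSuperAlgebra.ProjResF.dims {g : LieSuperAlgebra} {M : g.SuperModule}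
    (R : g.ProjResF M) : ℕ → ℕ :=
  fun n => Module.finrank ℂ (R.P n).carrier

/-! ### Complete reducibility for reductive Lie algebras -/

namespace ReductiveLie

open LieModule

variable {L : Type*} [LieRing L] [LieAlgebra ℂ L]

/-- In a Lie algebra all of whose ideals are complemented, the derived ideal is perfect and
together with the center it is everything. -/
lemma center_sup_derived_eq_top (hL : ∀ I : LieIdeal ℂ L, ∃ J : LieIdeal ℂ L, IsCompl I J) :
    LieAlgebra.center ℂ L ⊔ ⁅(⊤ : LieIdeal ℂ L), (⊤ : LieIdeal ℂ L)⁆ = ⊤ := by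
  obtain ⟨C, hC⟩ := hL ⁅(⊤ : LieIdeal ℂ L), (⊤ : LieIdeal ℂ L)⁆
  refine eq_top_iff.2 (hC.sup_eq_top.ge.trans (sup_le le_sup_right (le_sup_of_le_left ?_)))
  intro c hc
  rw [LieModule.mem_maxTrivSubmodule]
  intro x
  have h : ⁅x, c⁆ ∈ ⁅(⊤ : LieIdeal ℂ L), (⊤ : LieIdeal ℂ L)⁆ ⊓ C :=
    ⟨LieSubmodule.lie_mem_lie (LieSubmodule.mem_top x) (LieSubmodule.mem_top c),
      C.lie_mem hc⟩
  rwa [hC.inf_eq_bot, LieSubmodule.mem_bot] at h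

lemma derived_perfect (hL : ∀ I : LieIdeal ℂ L, ∃ J : LieIdeal ℂ L, IsCompl I J) :
    ⁅⁅(⊤ : LieIdeal ℂ L), (⊤ : LieIdeal ℂ L)⁆, ⁅(⊤ : LieIdeal ℂ L), (⊤ : LieIdeal ℂ L)⁆⁆
      = ⁅(⊤ : LieIdeal ℂ L), (⊤ : LieIdeal ℂ L)⁆ := by
  set D := ⁅(⊤ : LieIdeal ℂ L), (⊤ : LieIdeal ℂ L)⁆ with hD
  have hZ : ∀ I : LieIdeal ℂ L, ⁅I, LieAlgebra.center ℂ L⁆ = ⊥ := by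
    intro I
    rw [LieSubmodule.lie_eq_bot_iff]
    intro x _ z hz
    exact (LieModule.mem_maxTrivSubmodule ℂ L L z).1 hz x
  have h1 : ⁅(⊤ : LieIdeal ℂ L), D⁆ = D := by
    conv_rhs => rw [hD]
    conv_rhs => rw [← center_sup_derived_eq_top hL, LieSubmodule.lie_sup, hZ, bot_sup_eq,
      center_sup_derived_eq_top hL]
  conv_rhs => rw [← h1, ← center_sup_derived_eq_top hL, LieSubmodule.sup_lie,
    LieSubmodule.lie_comm (LieAlgebra.center ℂ L), hZ, bot_sup_eq]

variable {X : Type*} [AddCommGroup X] [Module ℂ X] [LieRingModule L X] [LieModule ℂ L X]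

/-- A module with vanishing trace form on which the center acts trivially is trivial. -/
lemma lie_eq_zero_of_traceForm_eq_zero [FiniteDimensional ℂ L] [FiniteDimensional ℂ X]
    (hL : ∀ I : LieIdeal ℂ L, ∃ J : LieIdeal ℂ L, IsCompl I J)
    (hz : ∀ z ∈ LieAlgebra.center ℂ L, ∀ m : X, ⁅z, m⁆ = 0)
    (h : traceForm ℂ L X = 0) (x : L) (m : X) : ⁅x, m⁆ = 0 := by
  set D := ⁅(⊤ : LieIdeal ℂ L), (⊤ : LieIdeal ℂ L)⁆ with hD
  have hnil : LieModule.IsNilpotent D X :=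
    LieModule.isNilpotent_derivedSeries_of_traceForm_eq_zero h
  have hmono : ⁅D, (⊤ : LieSubmodule ℂ L X)⁆ ≤ ⁅D, ⁅D, (⊤ : LieSubmodule ℂ L X)⁆⁆ := by
    conv_lhs => rw [hD, ← derived_perfect hL, ← hD]
    rw [LieSubmodule.lieIdeal_oper_eq_span, LieSubmodule.lieSpan_le]
    rintro _ ⟨⟨y, hy⟩, ⟨m, -⟩, rfl⟩
    change ⁅y, m⁆ ∈ _
    rw [← LieSubmodule.mem_toSubmodule, LieSubmodule.lieIdeal_oper_eq_linear_span'] at hy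
    induction hy using Submodule.span_induction with
    | mem y hy =>
      obtain ⟨a, ha, b, hb, rfl⟩ := hy
      rw [lie_lie]
      exact sub_mem
        (LieSubmodule.lie_mem_lie ha (LieSubmodule.lie_mem_lie hb (LieSubmodule.mem_top m)))
        (LieSubmodule.lie_mem_lie hb (LieSubmodule.lie_mem_lie ha (LieSubmodule.mem_top m)))
    | zero => rw [zero_lie]; exact zero_mem _
    | add a b _ _ ha hb => rw [add_lie]; exact add_mem ha hb
    | smul c a _ ha => rw [smul_lie]; exact SMulMemClass.smul_mem c ha
  have hD0 : ⁅D, (⊤ : LieSubmodule ℂ L X)⁆ = ⊥ := by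
    obtain ⟨k, hk⟩ := (LieModule.isNilpotent_iff ℂ D X).1 hnil
    have hle : ∀ k, ((⁅D, (⊤ : LieSubmodule ℂ L X)⁆ : LieSubmodule ℂ L X) : Submodule ℂ X) ≤
        (LieModule.lowerCentralSeries ℂ D X k : Submodule ℂ X) := by
      intro k
      induction k with
      | zero => simp
      | succ k ih =>
        refine le_trans hmono ?_
        rw [LieSubmodule.lieIdeal_oper_eq_linear_span', Submodule.span_le]
        rintro _ ⟨y, hy, m, hm, rfl⟩
        rw [LieModule.lowerCentralSeries_succ]
        exact LieSubmodule.lie_mem_lie (x := (⟨y, hy⟩ : D)) (LieSubmodule.mem_top _) (ih hm)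
    rw [eq_bot_iff]
    intro m hm
    have := hle k hm
    rw [hk] at this
    simpa using this
  have hx : x ∈ LieAlgebra.center ℂ L ⊔ D := by
    rw [center_sup_derived_eq_top hL]; exact LieSubmodule.mem_top x
  obtain ⟨z, hz', y, hy, rfl⟩ := (LieSubmodule.mem_sup _ _ _).1 hx
  rw [add_lie, hz z hz', zero_add]
  have : ⁅y, m⁆ ∈ ⁅D, (⊤ : LieSubmodule ℂ L X)⁆ :=
    LieSubmodule.lie_mem_lie hy (LieSubmodule.mem_top m)
  simpa [hD0] using this

/-- If every operator commuting with `L` and of the form `∑ x ∘ y` is traceless, as happens when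
central operators are nilpotent, then the trace form vanishes. -/
lemma traceForm_eq_zero_of_casimir [FiniteDimensional ℂ L] [FiniteDimensional ℂ X]
    (hL : ∀ I : LieIdeal ℂ L, ∃ J : LieIdeal ℂ L, IsCompl I J)
    (hT : ∀ T : Module.End ℂ X, (∀ (x : L) (m : X), T ⁅x, m⁆ = ⁅x, T m⁆) →
      (∀ m : X, T m ∈ Submodule.span ℂ {n : X | ∃ (x : L) (m : X), ⁅x, m⁆ = n}) →
      IsNilpotent T) :
    traceForm ℂ L X = 0 := by
  classical
  set B := traceForm ℂ L X with hB
  let J : LieIdeal ℂ L :=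
    { LinearMap.ker B with
      lie_mem := by
        intro x y hy
        have hy' : B y = 0 := hy
        change B ⁅x, y⁆ = 0
        ext w
        rw [← lie_skew, hB, map_neg, LinearMap.neg_apply, LieModule.traceForm_apply_lie_apply,
          ← hB, hy']
        simp }
  obtain ⟨J', hJ⟩ := hL J
  have hJmem : ∀ x, x ∈ J ↔ B x = 0 := fun x => Iff.rfl
  let B' : LinearMap.BilinForm ℂ J' := LinearMap.BilinForm.restrict B (J' : Submodule ℂ L)
  have hB' : ∀ a b : J', B' a b = B a b := fun a b => rfl
  have hdecomp : ∀ y : L, ∃ a ∈ J, ∃ b ∈ J', a + b = y := by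
    intro y
    have : y ∈ J ⊔ J' := by rw [hJ.sup_eq_top]; exact LieSubmodule.mem_top y
    exact (LieSubmodule.mem_sup _ _ _).1 this
  have hsep : B'.SeparatingLeft := by
    intro a ha
    have h0 : (a : L) ∈ J ⊓ J' := by
      refine ⟨?_, a.2⟩
      change (a : L) ∈ J
      rw [hJmem]
      ext y
      obtain ⟨c, hc, d, hd, rfl⟩ := hdecomp y
      rw [map_add, hB, LieModule.traceForm_comm ℂ L X a c, ← hB, (hJmem c).1 hc]
      simpa [hB'] using ha ⟨d, hd⟩
    rw [hJ.inf_eq_bot, LieSubmodule.mem_bot] at h0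
    exact Subtype.ext h0
  have hsymm : B'.IsSymm := ⟨fun a b => by
    simp only [hB']; exact LieModule.traceForm_comm ℂ L X a b⟩
  have hnd : B'.Nondegenerate := by
    refine ⟨hsep, fun a ha => hsep a fun b => ?_⟩
    rw [← ha b]; exact LieModule.traceForm_comm ℂ L X a b
  let b := Module.finBasis ℂ J'
  let c := B'.dualBasis hnd b
  have hbc : ∀ i j, B' (b i) (c j) = if i = j then 1 else 0 :=
    LinearMap.BilinForm.apply_dualBasis_right hnd hsymm b
  have hexp1 : ∀ y : J', y = ∑ j, B' y (c j) • b j := by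
    intro y
    conv_lhs => rw [← b.sum_repr y]
    refine Finset.sum_congr rfl fun j _ => ?_
    congr 1
    have h := congrArg (fun v => B' v (c j)) (b.sum_repr y)
    simp only [map_sum, LinearMap.sum_apply, map_smul, LinearMap.smul_apply, hbc] at h
    simpa using h
  have hexp2 : ∀ y : J', y = ∑ j, B' (b j) y • c j := by
    intro y
    conv_lhs => rw [← c.sum_repr y]
    refine Finset.sum_congr rfl fun j _ => ?_
    congr 1
    rw [LinearMap.BilinForm.dualBasis_repr_apply]
    exact LieModule.traceForm_comm ℂ L X _ _
  let φ : L → Module.End ℂ X := fun x => toEnd ℂ L X x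
  let T : Module.End ℂ X := ∑ i, φ (b i) * φ (c i)
  have hTapp : ∀ m, T m = ∑ i, ⁅(b i : L), ⁅(c i : L), m⁆⁆ := by
    intro m; simp [T, φ, LinearMap.sum_apply]
  have hnil : IsNilpotent T := by
    refine hT T ?_ ?_
    · intro x m
      have hxb : ∀ i, ⁅x, (b i : L)⁆ = ∑ j, B ⁅x, (b i : L)⁆ (c j) • (b j : L) := by
        intro i
        have := congrArg (Subtype.val) (hexp1 ⟨⁅x, (b i : L)⁆, J'.lie_mem (b i).2⟩)
        simpa [hB'] using this
      have hxc : ∀ i, ⁅x, (c i : L)⁆ = ∑ j, B (b j) ⁅x, (c i : L)⁆ • (c j : L) := by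
        intro i
        have := congrArg (Subtype.val) (hexp2 ⟨⁅x, (c i : L)⁆, J'.lie_mem (c i).2⟩)
        simpa [hB'] using this
      have hinv : ∀ i j, B (b i) ⁅x, (c j : L)⁆ = - B ⁅x, (b i : L)⁆ (c j) := by
        intro i j
        rw [← lie_skew x (b i : L), hB, map_neg, LinearMap.neg_apply, neg_neg,
          LieModule.traceForm_apply_lie_apply]
      have h1 : ∀ i, ⁅x, ⁅(b i : L), ⁅(c i : L), m⁆⁆⁆ =
          ⁅⁅x, (b i : L)⁆, ⁅(c i : L), m⁆⁆ + ⁅(b i : L), ⁅⁅x, (c i : L)⁆, m⁆⁆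
            + ⁅(b i : L), ⁅(c i : L), ⁅x, m⁆⁆⁆ := by
        intro i
        rw [leibniz_lie x (b i : L), leibniz_lie x (c i : L), lie_add, add_assoc]
      have h2 : ∑ i, ⁅⁅x, (b i : L)⁆, ⁅(c i : L), m⁆⁆
          + ∑ i, ⁅(b i : L), ⁅⁅x, (c i : L)⁆, m⁆⁆ = 0 := by
        have e1 : ∀ i, ⁅⁅x, (b i : L)⁆, ⁅(c i : L), m⁆⁆ =
            ∑ j, B ⁅x, (b i : L)⁆ (c j) • ⁅(b j : L), ⁅(c i : L), m⁆⁆ := by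
          intro i
          conv_lhs => rw [hxb i]
          simp [sum_lie, smul_lie]
        have e2 : ∀ i, ⁅(b i : L), ⁅⁅x, (c i : L)⁆, m⁆⁆ =
            ∑ j, (- B ⁅x, (b j : L)⁆ (c i)) • ⁅(b i : L), ⁅(c j : L), m⁆⁆ := by
          intro i
          conv_lhs => rw [hxc i]
          simp only [hinv, sum_lie, smul_lie, lie_sum, lie_smul]
        simp only [e1, e2]
        rw [Finset.sum_comm, ← Finset.sum_add_distrib]
        refine Finset.sum_eq_zero fun i _ => ?_
        rw [← Finset.sum_add_distrib]
        refine Finset.sum_eq_zero fun j _ => ?_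
        rw [← add_smul]; simp
      rw [hTapp, hTapp, lie_sum]
      simp only [h1, Finset.sum_add_distrib]
      rw [h2, zero_add]
    · intro m
      rw [hTapp]
      exact Submodule.sum_mem _ fun i _ => Submodule.subset_span ⟨_, _, rfl⟩
  have htr : LinearMap.trace ℂ X T = Module.finrank ℂ J' := by
    have hone : ∀ i, LinearMap.trace ℂ X (φ (b i) * φ (c i)) = 1 := by
      intro i
      have h1 := hbc i i
      rw [if_pos rfl] at h1
      rw [← h1]
      rfl
    simp only [T, map_sum, hone]
    simp
  have h0 : Module.finrank ℂ J' = 0 := by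
    have := (LinearMap.isNilpotent_trace_of_isNilpotent hnil).eq_zero
    rw [htr] at this
    exact_mod_cast this
  ext x : 1
  obtain ⟨a, ha, d, hd, rfl⟩ := hdecomp x
  have hd0 : (⟨d, hd⟩ : J') = 0 := by
    have := Module.finrank_zero_iff.1 h0
    exact Subsingleton.elim _ _
  have : d = 0 := congrArg Subtype.val hd0
  rw [this, add_zero, (hJmem a).1 ha]
  rfl

end ReductiveLie

namespace ReductiveLie

open LieModule

variable {L : Type*} [LieRing L] [LieAlgebra ℂ L]
variable {X : Type*} [AddCommGroup X] [Module ℂ X] [LieRingModule L X] [LieModule ℂ L X]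

lemma eq_zero_of_isNilpotent_of_ker_sq {Y : Type*} [AddCommGroup Y] [Module ℂ Y]
    {T : Module.End ℂ Y} (hT : IsNilpotent T) (h : ∀ m, T (T m) = 0 → T m = 0) : T = 0 := by
  obtain ⟨k, hk⟩ := hT
  induction k with
  | zero =>
    have h1 : (1 : Module.End ℂ Y) = 0 := by simpa using hk
    rw [← mul_one T, h1, mul_zero]
  | succ k ih =>
    cases k with
    | zero => simpa using hk
    | succ k =>
      refine ih ?_
      ext m
      have h2 := LinearMap.congr_fun hk m
      rw [pow_succ', pow_succ', Module.End.mul_apply, Module.End.mul_apply] at h2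
      rw [pow_succ', Module.End.mul_apply]
      exact h _ h2

/-- An invariant functional on a module with diagonalizable center is nonzero on some invariant
vector. -/
lemma exists_invariant [FiniteDimensional ℂ L] [FiniteDimensional ℂ X]
    (hL : ∀ I : LieIdeal ℂ L, ∃ J : LieIdeal ℂ L, IsCompl I J)
    (hz : ∀ z ∈ LieAlgebra.center ℂ L, ∀ m : X, ⁅z, ⁅z, m⁆⁆ = 0 → ⁅z, m⁆ = 0)
    (l : X →ₗ[ℂ] ℂ) (hl : ∀ (x : L) (m : X), l ⁅x, m⁆ = 0) (m₀ : X) (hm₀ : l m₀ ≠ 0) :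
    ∃ m : X, l m ≠ 0 ∧ ∀ x : L, ⁅x, m⁆ = 0 := by
  have := LieSubmodule.wellFoundedLT_of_isArtinian ℂ L X
  obtain ⟨Y, hYl, hYmin⟩ := WellFounded.has_min
    (wellFounded_lt (α := LieSubmodule ℂ L X)) {Y | ∃ m ∈ Y, l m ≠ 0}
    ⟨⊤, m₀, LieSubmodule.mem_top _, hm₀⟩
  have hnil : ∀ T : Module.End ℂ Y, (∀ (x : L) (m : Y), T ⁅x, m⁆ = ⁅x, T m⁆) →
      (∀ m : Y, l (T m) = 0) → IsNilpotent T := by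
    intro T hT hlT
    obtain ⟨N, hN⟩ := (T.eventually_isCompl_ker_pow_range_pow.and
      (Filter.eventually_ge_atTop 1)).exists
    have hcomm : ∀ k (x : L) (m : Y), (T ^ k) ⁅x, m⁆ = ⁅x, (T ^ k) m⁆ := by
      intro k x
      induction k with
      | zero => simp
      | succ k ih => intro m; rw [pow_succ, Module.End.mul_apply, hT, ih]; rfl
    let Z : LieSubmodule ℂ L Y :=
      { LinearMap.ker (T ^ N) with
        lie_mem := by
          intro x m hm
          have hm' : (T ^ N) m = 0 := hm
          change (T ^ N) ⁅x, m⁆ = 0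
          rw [hcomm, hm', lie_zero] }
    have hZ : ∃ m ∈ Z.map Y.incl, l m ≠ 0 := by
      obtain ⟨m, hm, hlm⟩ := hYl
      have : (⟨m, hm⟩ : Y) ∈ LinearMap.ker (T ^ N) ⊔ LinearMap.range (T ^ N) := by
        rw [hN.1.sup_eq_top]; trivial
      obtain ⟨a, ha, b, ⟨c, rfl⟩, hab⟩ := Submodule.mem_sup.1 this
      refine ⟨a, LieSubmodule.mem_map_of_mem (f := Y.incl) (show a ∈ Z from ha), ?_⟩
      have h1 : m = a + ((T ^ N) c : Y) := by
        rw [← LieSubmodule.coe_add, hab]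
      have h2 : l ((T ^ N) c : Y) = 0 := by
        obtain ⟨N', rfl⟩ := Nat.exists_eq_add_of_le' hN.2
        rw [pow_succ', Module.End.mul_apply, hlT]
      rw [h1, map_add, h2, add_zero] at hlm
      exact hlm
    have hle : Z.map Y.incl ≤ Y := LieSubmodule.map_incl_le
    have heq : Z.map Y.incl = Y := by
      by_contra hne
      exact hYmin _ hZ (lt_of_le_of_ne hle hne)
    refine ⟨N, ?_⟩
    ext m
    have hm : (m : X) ∈ Z.map Y.incl := by rw [heq]; exact m.2
    obtain ⟨m', hm', h⟩ := LieSubmodule.mem_map _ |>.1 hm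
    have : m' = m := Subtype.ext h
    rw [← this]
    have : (T ^ N) m' = 0 := hm'
    rw [this]; rfl
  have hz0 : ∀ z ∈ LieAlgebra.center ℂ L, ∀ m : Y, ⁅z, m⁆ = 0 := by
    intro z hzc m
    have : toEnd ℂ L Y z = 0 := by
      refine eq_zero_of_isNilpotent_of_ker_sq (hnil _ ?_ ?_) ?_
      · intro x m
        have h1 : ⁅x, z⁆ = 0 := (LieModule.mem_maxTrivSubmodule ℂ L L z).1 hzc x
        rw [toEnd_apply_apply, toEnd_apply_apply, leibniz_lie x z m, h1, zero_lie, zero_add]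
      · intro m; exact hl z m
      · intro m hm
        refine Subtype.ext (hz z hzc m ?_)
        exact congrArg Subtype.val hm
    exact LinearMap.congr_fun this m
  have htr : traceForm ℂ L Y = 0 := by
    refine traceForm_eq_zero_of_casimir hL fun T hT hTs => hnil T hT fun m => ?_
    have hm := hTs m
    generalize T m = n at hm
    induction hm using Submodule.span_induction with
    | mem n hn => obtain ⟨x, m, rfl⟩ := hn; exact hl x m
    | zero => simp
    | add a b _ _ ha hb => simp [ha, hb]
    | smul c a _ ha => simp [ha]
  obtain ⟨m, hm, hlm⟩ := hYl
  refine ⟨m, hlm, fun x => ?_⟩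
  exact congrArg Subtype.val (lie_eq_zero_of_traceForm_eq_zero hL hz0 htr x (⟨m, hm⟩ : Y))

lemma sub_smul_eq_zero_of_sq {Y : Type*} [AddCommGroup Y] [Module ℂ Y] {T : Module.End ℂ Y}
    (h : ⨆ μ : ℂ, T.eigenspace μ = ⊤) (μ : ℂ) (v : Y)
    (hv : T (T v - μ • v) = μ • (T v - μ • v)) : T v = μ • v := by
  have hr : ∀ w : Y, T w - μ • w ∈ ⨆ (ν : ℂ) (_ : ν ≠ μ), T.eigenspace ν := by
    intro w
    have hw : w ∈ ⨆ ν : ℂ, T.eigenspace ν := h ▸ Submodule.mem_top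
    induction hw using Submodule.iSup_induction' with
    | mem ν w hw =>
      rw [Module.End.mem_eigenspace_iff] at hw
      rw [hw, ← sub_smul]
      by_cases hν : ν = μ
      · simp [hν]
      · refine Submodule.smul_mem _ _ ?_
        exact Submodule.mem_iSup_of_mem ν (Submodule.mem_iSup_of_mem hν
          (Module.End.mem_eigenspace_iff.2 hw))
    | zero => simp
    | add a b _ _ ha hb =>
      have : T (a + b) - μ • (a + b) = (T a - μ • a) + (T b - μ • b) := by
        rw [map_add, smul_add]; abel
      rw [this]; exact add_mem ha hb
  have h0 := (Submodule.disjoint_def.1 (T.eigenspaces_iSupIndep μ)) _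
    (Module.End.mem_eigenspace_iff.2 hv) (hr v)
  exact sub_eq_zero.1 h0

/-- If `z` is diagonalizable on `X`, then its action on `End X` has no generalized eigenvectors of
depth two for the eigenvalue zero. -/
lemma lie_hom_eq_zero_of_sq {z : L} (h : ⨆ μ : ℂ, (toEnd ℂ L X z).eigenspace μ = ⊤)
    (φ : X →ₗ[ℂ] X) (hφ : ⁅z, ⁅z, φ⁆⁆ = 0) : ⁅z, φ⁆ = 0 := by
  ext v
  have hv : v ∈ ⨆ μ : ℂ, (toEnd ℂ L X z).eigenspace μ := h ▸ Submodule.mem_top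
  induction hv using Submodule.iSup_induction' with
  | mem μ v hv =>
    rw [Module.End.mem_eigenspace_iff, toEnd_apply_apply] at hv
    have h1 := LinearMap.congr_fun hφ v
    simp only [LieHom.lie_apply, hv, map_smul, LinearMap.zero_apply] at h1
    have h2 := sub_smul_eq_zero_of_sq h μ (φ v) (by
      simpa only [toEnd_apply_apply, sub_eq_zero] using h1)
    simp only [LieHom.lie_apply, hv, map_smul, LinearMap.zero_apply, sub_eq_zero]
    exact h2
  | zero => simp
  | add a b _ _ ha hb => rw [map_add, ha, hb]; simp

/-- Complete reducibility of finite-dimensional modules with diagonalizable center. -/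
theorem exists_isCompl_of_diagonalizable_center [FiniteDimensional ℂ L] [FiniteDimensional ℂ X]
    (hL : ∀ I : LieIdeal ℂ L, ∃ J : LieIdeal ℂ L, IsCompl I J)
    (hz : ∀ z ∈ LieAlgebra.center ℂ L, ⨆ μ : ℂ, (toEnd ℂ L X z).eigenspace μ = ⊤)
    (U : LieSubmodule ℂ L X) : ∃ U' : LieSubmodule ℂ L X, IsCompl U U' := by
  by_cases hU : ∃ u ∈ U, u ≠ 0
  swap
  · push Not at hU
    refine ⟨⊤, ?_⟩
    have : U = ⊥ := eq_bot_iff.2 fun u hu => hU u hu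
    rw [this]; exact isCompl_bot_top
  obtain ⟨u, huU, hu⟩ := hU
  obtain ⟨ℓ, hℓ⟩ : ∃ ℓ : X →ₗ[ℂ] ℂ, ℓ u = 1 := by
    obtain ⟨f, hf⟩ : ∃ f : X →ₗ[ℂ] ℂ, f u ≠ 0 := by
      by_contra! h
      exact hu ((Module.forall_dual_apply_eq_zero_iff ℂ u).1 h)
    exact ⟨(f u)⁻¹ • f, by simp [hf]⟩
  let E : LieSubmodule ℂ L (X →ₗ[ℂ] X) :=
    { carrier := {φ | (∀ m, φ m ∈ U) ∧ ∃ c : ℂ, ∀ m ∈ U, φ m = c • m}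
      add_mem' := by
        rintro φ ψ ⟨h1, c, h2⟩ ⟨h3, d, h4⟩
        exact ⟨fun m => add_mem (h1 m) (h3 m), c + d, fun m hm => by
          rw [LinearMap.add_apply, h2 m hm, h4 m hm, add_smul]⟩
      zero_mem' := ⟨fun m => zero_mem _, 0, fun m hm => by simp⟩
      smul_mem' := by
        rintro a φ ⟨h1, c, h2⟩
        exact ⟨fun m => U.smul_mem a (h1 m), a * c, fun m hm => by
          rw [LinearMap.smul_apply, h2 m hm, mul_smul]⟩
      lie_mem := by
        rintro x φ ⟨h1, c, h2⟩
        refine ⟨fun m => ?_, 0, fun m hm => ?_⟩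
        · rw [LieHom.lie_apply]; exact sub_mem (U.lie_mem (h1 _)) (h1 _)
        · rw [LieHom.lie_apply, h2 m hm, h2 _ (U.lie_mem hm)]; simp }
  have hE : ∀ (φ : E), ∀ m ∈ U, (φ : X →ₗ[ℂ] X) m = ℓ ((φ : X →ₗ[ℂ] X) u) • m := by
    rintro ⟨φ, h1, c, h2⟩ m hm
    simp [h2 m hm, h2 u huU, hℓ]
  obtain ⟨q, hq⟩ := (U : Submodule ℂ X).exists_isCompl
  let π : X →ₗ[ℂ] X := (U : Submodule ℂ X).subtype ∘ₗ Submodule.projectionOnto _ _ hq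
  have hπ : π ∈ E := by
    refine ⟨fun m => Submodule.coe_mem _, 1, fun m hm => ?_⟩
    rw [one_smul]
    exact congrArg Subtype.val (Submodule.projectionOnto_apply_left hq ⟨m, hm⟩)
  let l : E →ₗ[ℂ] ℂ := ℓ ∘ₗ LinearMap.applyₗ u ∘ₗ (E : Submodule ℂ (X →ₗ[ℂ] X)).subtype
  have hl : ∀ φ : E, l φ = ℓ ((φ : X →ₗ[ℂ] X) u) := fun φ => rfl
  have hfd : FiniteDimensional ℂ E :=
    inferInstanceAs (FiniteDimensional ℂ (E : Submodule ℂ (X →ₗ[ℂ] X)))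
  obtain ⟨φ, hφl, hφ⟩ := exists_invariant (X := E) hL
    (by
      intro z hzc φ hφ
      exact Subtype.ext (lie_hom_eq_zero_of_sq (hz z hzc) φ (congrArg Subtype.val hφ)))
    l
    (by
      intro x φ
      rw [hl]
      have : ((⁅x, φ⁆ : E) : X →ₗ[ℂ] X) u = 0 := by
        rw [LieSubmodule.coe_bracket, LieHom.lie_apply, hE φ u huU, hE φ _ (U.lie_mem huU)]
        simp
      rw [this, map_zero])
    ⟨π, hπ⟩
    (by
      rw [hl]
      have : π u = u := by
        exact congrArg Subtype.val (Submodule.projectionOnto_apply_left hq ⟨u, huU⟩)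
      simp [this, hℓ])
  have hφc : ∀ (x : L) (m : X), (φ : X →ₗ[ℂ] X) ⁅x, m⁆ = ⁅x, (φ : X →ₗ[ℂ] X) m⁆ := by
    intro x m
    have h1 : ((⁅x, φ⁆ : E) : X →ₗ[ℂ] X) m = 0 := by rw [hφ x]; rfl
    rw [LieSubmodule.coe_bracket, LieHom.lie_apply, sub_eq_zero] at h1
    exact h1.symm
  let U' : LieSubmodule ℂ L X :=
    { LinearMap.ker (φ : X →ₗ[ℂ] X) with
      lie_mem := by
        intro x m hm
        have hm' : (φ : X →ₗ[ℂ] X) m = 0 := hm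
        change (φ : X →ₗ[ℂ] X) ⁅x, m⁆ = 0
        rw [hφc, hm', lie_zero] }
  have hU' : ∀ m, m ∈ U' ↔ (φ : X →ₗ[ℂ] X) m = 0 := fun m => Iff.rfl
  rw [hl] at hφl
  refine ⟨U', ?_⟩
  constructor
  · rw [disjoint_iff, eq_bot_iff]
    rintro m ⟨h1, h2⟩
    have h3 : (φ : X →ₗ[ℂ] X) m = 0 := h2
    rw [hE φ m h1] at h3
    exact (smul_eq_zero.1 h3).resolve_left hφl
  · rw [codisjoint_iff, eq_top_iff]
    intro m _
    rw [LieSubmodule.mem_sup]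
    refine ⟨(ℓ ((φ : X →ₗ[ℂ] X) u))⁻¹ • (φ : X →ₗ[ℂ] X) m, U.smul_mem _ (φ.2.1 m),
      m - (ℓ ((φ : X →ₗ[ℂ] X) u))⁻¹ • (φ : X →ₗ[ℂ] X) m, ?_, by simp⟩
    rw [hU', map_sub, map_smul, hE φ _ (φ.2.1 m), smul_smul, inv_mul_cancel₀ hφl, one_smul,
      sub_self]

/-- The center of `L` acts diagonalizably on completely reducible modules. -/
theorem diagonalizable_center_of_exists_isCompl [FiniteDimensional ℂ X]
    (hX : ∀ U : LieSubmodule ℂ L X, ∃ U' : LieSubmodule ℂ L X, IsCompl U U')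
    {z : L} (hz : z ∈ LieAlgebra.center ℂ L) :
    ⨆ μ : ℂ, (toEnd ℂ L X z).eigenspace μ = ⊤ := by
  have hc : ∀ (x : L) (m : X), ⁅z, ⁅x, m⁆⁆ = ⁅x, ⁅z, m⁆⁆ := by
    intro x m
    have h1 : ⁅x, z⁆ = 0 := (LieModule.mem_maxTrivSubmodule ℂ L L z).1 hz x
    rw [leibniz_lie x z m, h1, zero_lie, zero_add]
  let U : LieSubmodule ℂ L X :=
    { (⨆ μ : ℂ, (toEnd ℂ L X z).eigenspace μ) with
      lie_mem := by
        intro x m hm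
        change m ∈ (⨆ μ : ℂ, (toEnd ℂ L X z).eigenspace μ) at hm
        change ⁅x, m⁆ ∈ (⨆ μ : ℂ, (toEnd ℂ L X z).eigenspace μ)
        induction hm using Submodule.iSup_induction' with
        | mem μ v hv =>
          rw [Module.End.mem_eigenspace_iff, toEnd_apply_apply] at hv
          refine Submodule.mem_iSup_of_mem μ ?_
          rw [Module.End.mem_eigenspace_iff, toEnd_apply_apply, hc, hv, lie_smul]
        | zero => simp
        | add a b _ _ ha hb => rw [lie_add]; exact add_mem ha hb }
  obtain ⟨U', hU'⟩ := hX U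
  by_cases h0 : U' = ⊥
  · rw [h0] at hU'
    have : U = ⊤ := by simpa using hU'.sup_eq_top
    exact congrArg LieSubmodule.toSubmodule this
  · exfalso
    have hnt : Nontrivial U' := (LieSubmodule.nontrivial_iff_ne_bot ℂ L X).2 h0
    have hfd : FiniteDimensional ℂ U' :=
      inferInstanceAs (FiniteDimensional ℂ (U' : Submodule ℂ X))
    obtain ⟨μ, hμ⟩ := Module.End.exists_eigenvalue (toEnd ℂ L U' z)
    obtain ⟨v, hv⟩ := hμ.exists_hasEigenvector
    have hvU : (v : X) ∈ U := by
      refine Submodule.mem_iSup_of_mem μ ?_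
      rw [Module.End.mem_eigenspace_iff]
      exact congrArg Subtype.val hv.apply_eq_smul
    have : (v : X) ∈ U ⊓ U' := ⟨hvU, v.2⟩
    rw [hU'.inf_eq_bot, LieSubmodule.mem_bot] at this
    exact hv.2 (Subtype.ext this)

end ReductiveLie

namespace LieSuperAlgebra

variable (g : LieSuperAlgebra)

lemma even_bracket_mem {x y : g.carrier} (hx : x ∈ g.part 0) (hy : y ∈ g.part 0) :
    g.bracket x y ∈ g.part 0 := by
  simpa using g.bracket_grading 0 0 x hx y hy

lemma even_bracket_skew {x y : g.carrier} (hx : x ∈ g.part 0) (hy : y ∈ g.part 0) :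
    g.bracket x y = - g.bracket y x := by
  simpa [ssgn] using g.bracket_skew 0 0 x hx y hy

/-- The even part of a Lie superalgebra as a Lie ring. -/
instance evenLieRing : LieRing (g.part 0) where
  bracket x y := ⟨g.bracket x y, g.even_bracket_mem x.2 y.2⟩
  add_lie x y z := Subtype.ext (by simp)
  lie_add x y z := Subtype.ext (by simp)
  lie_self x := Subtype.ext (by
    have h := eq_neg_iff_add_eq_zero.1 (g.even_bracket_skew x.2 x.2)
    rw [← two_smul ℂ] at h
    exact (smul_eq_zero.1 h).resolve_left two_ne_zero)
  leibniz_lie x y z := Subtype.ext (by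
    simpa [ssgn] using g.bracket_jacobi 0 0 0 x x.2 y y.2 z z.2)

lemma even_lie_coe (x y : g.part 0) : ((⁅x, y⁆ : g.part 0) : g.carrier) = g.bracket x y := rfl

instance evenLieAlgebra : LieAlgebra ℂ (g.part 0) where
  lie_smul c x y := Subtype.ext (by simp [even_lie_coe])

/-- The center of the even part. -/
def IsEvenCentral (z : g.carrier) : Prop :=
  z ∈ g.part 0 ∧ ∀ x ∈ g.part 0, g.bracket x z = 0

variable {g}

lemma IsClassical.even_complemented (hg : g.IsClassical) (I : LieIdeal ℂ (g.part 0)) :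
    ∃ J : LieIdeal ℂ (g.part 0), IsCompl I J := by
  obtain ⟨U', h1, h2, h3, h4⟩ := hg.even_reducible
    ((I : Submodule ℂ (g.part 0)).map (g.part 0).subtype) (Submodule.map_subtype_le _ _) (by
      rintro x hx _ ⟨y, hy, rfl⟩
      exact ⟨⁅(⟨x, hx⟩ : g.part 0), y⁆, I.lie_mem hy, rfl⟩)
  refine ⟨{ U'.comap (g.part 0).subtype with
    lie_mem := fun {x m} hm => h2 x x.2 m hm }, ?_⟩
  constructor
  · rw [disjoint_iff, eq_bot_iff]
    rintro m ⟨hm1, hm2⟩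
    have : (m : g.carrier) ∈ (I : Submodule ℂ (g.part 0)).map (g.part 0).subtype ⊓ U' :=
      ⟨⟨m, hm1, rfl⟩, hm2⟩
    rw [h3, Submodule.mem_bot] at this
    exact Subtype.ext this
  · rw [codisjoint_iff, eq_top_iff]
    intro m _
    have hm : (m : g.carrier) ∈ (I : Submodule ℂ (g.part 0)).map (g.part 0).subtype ⊔ U' := by
      rw [h4]; exact m.2
    obtain ⟨_, ⟨a, ha, rfl⟩, b, hb, hab⟩ := Submodule.mem_sup.1 hm
    rw [LieSubmodule.mem_sup]
    exact ⟨a, ha, ⟨b, h1 hb⟩, hb, Subtype.ext hab⟩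

/-- Complete reducibility over the even part is equivalent to diagonalizability of its center. -/
theorem IsClassical.completelyReducible_iff (hg : g.IsClassical) {X : Type*} [AddCommGroup X]
    [Module ℂ X] [FiniteDimensional ℂ X] (ρ : g.carrier →ₗ[ℂ] Module.End ℂ X)
    (hρ : ∀ x ∈ g.part 0, ∀ y ∈ g.part 0, ∀ m : X,
      ρ (g.bracket x y) m = ρ x (ρ y m) - ρ y (ρ x m)) :
    (∀ U : Submodule ℂ X, (∀ x ∈ g.part 0, ∀ m ∈ U, ρ x m ∈ U) →
      ∃ U' : Submodule ℂ X, (∀ x ∈ g.part 0, ∀ m ∈ U', ρ x m ∈ U') ∧ IsCompl U U') ↔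
    ∀ z, g.IsEvenCentral z → ⨆ μ : ℂ, Module.End.eigenspace (ρ z) μ = ⊤ := by
  have hfd := hg.finiteDimensional
  let i1 : LieRingModule (g.part 0) X :=
    { bracket := fun x m => ρ x m
      add_lie := fun x y m => by simp
      lie_add := fun x m n => by simp
      leibniz_lie := fun x y m => by
        change ρ x (ρ y m) = ρ (g.bracket x y) m + ρ y (ρ x m)
        rw [hρ x x.2 y y.2]; abel }
  let i2 : LieModule ℂ (g.part 0) X :=
    { smul_lie := fun c x m => by
        change ρ ((c • x : g.part 0) : g.carrier) m = c • ρ x m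
        simp
      lie_smul := fun c x m => map_smul (ρ x) c m }
  have hlie : ∀ (x : g.part 0) (m : X), ⁅x, m⁆ = ρ x m := fun _ _ => rfl
  have hend : ∀ x : g.part 0, LieModule.toEnd ℂ (g.part 0) X x = ρ x := fun _ => rfl
  constructor
  · intro h z hz
    have := ReductiveLie.diagonalizable_center_of_exists_isCompl (L := g.part 0) (X := X)
      (z := ⟨z, hz.1⟩) (by
        intro U
        obtain ⟨U', hU', hc⟩ := h U (fun x hx m hm => U.lie_mem (x := ⟨x, hx⟩) hm)
        refine ⟨{ U' with lie_mem := fun {x m} hm => hU' x x.2 m hm }, ?_⟩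
        rw [← LieSubmodule.isCompl_toSubmodule]
        exact hc)
      (by
        rw [LieModule.mem_maxTrivSubmodule]
        exact fun x => Subtype.ext (hz.2 x x.2))
    exact this
  · intro h U hU
    obtain ⟨U', hU'⟩ := ReductiveLie.exists_isCompl_of_diagonalizable_center (L := g.part 0)
      (X := X) hg.even_complemented (by
        intro z hz
        refine h z ⟨z.2, fun x hx => ?_⟩
        rw [LieModule.mem_maxTrivSubmodule] at hz
        exact congrArg Subtype.val (hz ⟨x, hx⟩))
      { U with lie_mem := fun {x m} hm => hU x x.2 m hm }
    refine ⟨U', fun x hx m hm => U'.lie_mem (x := ⟨x, hx⟩) hm, ?_⟩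
    rw [← LieSubmodule.isCompl_toSubmodule] at hU'
    exact hU'

/-- Central elements of the even part act diagonalizably on the odd part. -/
lemma IsClassical.odd_le_iSup_eigenspace (hg : g.IsClassical) {z : g.carrier}
    (hz : g.IsEvenCentral z) :
    g.part 1 ≤ ⨆ μ : ℂ, g.part 1 ⊓ Module.End.eigenspace (g.bracket z) μ := by
  have hfd := hg.finiteDimensional
  have hmem : ∀ x ∈ g.part 0, ∀ v ∈ g.part 1, g.bracket x v ∈ g.part 1 := fun x hx v hv => by
    simpa using g.bracket_grading 0 1 x hx v hv
  let pr : g.carrier →ₗ[ℂ] g.part 1 := (g.part 1).projectionOnto (g.part 0) g.isCompl.symm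
  have hpr : ∀ v (hv : v ∈ g.part 1), pr v = ⟨v, hv⟩ := fun v hv =>
    Submodule.projectionOnto_apply_left g.isCompl.symm ⟨v, hv⟩
  let ρ : g.carrier →ₗ[ℂ] Module.End ℂ (g.part 1) :=
    (LinearMap.llcomp ℂ (g.part 1) g.carrier (g.part 1) pr) ∘ₗ
      (LinearMap.lcomp ℂ g.carrier (g.part 1).subtype) ∘ₗ g.bracket
  have hρ : ∀ x ∈ g.part 0, ∀ v : g.part 1, ((ρ x v : g.part 1) : g.carrier) = g.bracket x v := by
    intro x hx v
    change ((pr (g.bracket x v) : g.part 1) : g.carrier) = _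
    rw [hpr _ (hmem x hx v v.2)]
  have key := (hg.completelyReducible_iff ρ (by
    intro x hx y hy v
    refine Subtype.ext ?_
    rw [hρ _ (g.even_bracket_mem hx hy), Submodule.coe_sub, hρ x hx, hρ y hy, hρ y hy, hρ x hx,
      g.bracket_jacobi 0 0 1 x hx y hy v v.2]
    simp [ssgn])).1 (by
      intro U hU
      obtain ⟨U', h1, h2, h3, h4⟩ := hg.odd_reducible (U.map (g.part 1).subtype)
        (Submodule.map_subtype_le _ _) (by
          rintro x hx _ ⟨y, hy, rfl⟩
          exact ⟨ρ x y, hU x hx y hy, hρ x hx y⟩)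
      refine ⟨U'.comap (g.part 1).subtype, fun x hx m hm => ?_, ?_, ?_⟩
      · change ((ρ x m : g.part 1) : g.carrier) ∈ U'
        rw [hρ x hx]; exact h2 x hx m hm
      · rw [disjoint_iff, eq_bot_iff]
        rintro m ⟨hm1, hm2⟩
        have : (m : g.carrier) ∈ U.map (g.part 1).subtype ⊓ U' := ⟨⟨m, hm1, rfl⟩, hm2⟩
        rw [h3, Submodule.mem_bot] at this
        exact Subtype.ext this
      · rw [codisjoint_iff, eq_top_iff]
        intro m _
        have hm : (m : g.carrier) ∈ U.map (g.part 1).subtype ⊔ U' := by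
          rw [h4]; exact m.2
        obtain ⟨_, ⟨a, ha, rfl⟩, b, hb, hab⟩ := Submodule.mem_sup.1 hm
        rw [Submodule.mem_sup]
        exact ⟨a, ha, ⟨b, h1 hb⟩, hb, Subtype.ext hab⟩) z hz
  intro v hv
  have hv' : (⟨v, hv⟩ : g.part 1) ∈ ⨆ μ : ℂ, Module.End.eigenspace (ρ z) μ :=
    key ▸ Submodule.mem_top
  have := Submodule.mem_map_of_mem (f := (g.part 1).subtype) hv'
  rw [Submodule.map_iSup] at this
  revert this
  refine SetLike.le_def.1 (iSup_mono fun μ => ?_) (x := v)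
  rintro _ ⟨w, hw, rfl⟩
  rw [SetLike.mem_coe, Module.End.mem_eigenspace_iff] at hw
  refine ⟨w.2, Module.End.mem_eigenspace_iff.2 ?_⟩
  rw [Submodule.subtype_apply, ← hρ z hz.1, hw]
  rfl

end LieSuperAlgebra

/-! ### Representations of graded spaces with prescribed brackets -/

lemma zmodTwo_cases (i : ZMod 2) : i = 0 ∨ i = 1 := by
  revert i; decide

@[simp] lemma ssgn_zero_left (i : ZMod 2) : ssgn 0 i = 1 := by simp [ssgn]

@[simp] lemma ssgn_zero_right (i : ZMod 2) : ssgn i 0 = 1 := by simp [ssgn]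

@[simp] lemma ssgn_one_one : ssgn 1 1 = -1 := by simp [ssgn]

lemma ssgn_mul_self (i j : ZMod 2) : ssgn i j * ssgn i j = 1 := by
  rcases zmodTwo_cases i with rfl | rfl <;> rcases zmodTwo_cases j with rfl | rfl <;> simp

lemma ssgn_comm (i j : ZMod 2) : ssgn i j = ssgn j i := by
  rcases zmodTwo_cases i with rfl | rfl <;> rcases zmodTwo_cases j with rfl | rfl <;> simp

lemma zmodTwo_one_add_one : (1 + 1 : ZMod 2) = 0 := by decide

namespace SuperVS

variable (W : SuperVS)

lemma projEven_of_even {x : W.carrier} (hx : x ∈ W.part 0) : W.projEven x = x :=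
  congrArg Subtype.val (Submodule.projectionOnto_apply_left W.isCompl ⟨x, hx⟩)

lemma projEven_of_odd {x : W.carrier} (hx : x ∈ W.part 1) : W.projEven x = 0 :=
  congrArg Subtype.val (Submodule.projectionOnto_apply_of_mem_right W.isCompl hx)

lemma projOdd_of_odd {x : W.carrier} (hx : x ∈ W.part 1) : W.projOdd x = x :=
  congrArg Subtype.val (Submodule.projectionOnto_apply_left W.isCompl.symm ⟨x, hx⟩)

lemma projOdd_of_even {x : W.carrier} (hx : x ∈ W.part 0) : W.projOdd x = 0 :=
  congrArg Subtype.val (Submodule.projectionOnto_apply_of_mem_right W.isCompl.symm hx)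

lemma projEven_mem (x : W.carrier) : W.projEven x ∈ W.part 0 := Submodule.coe_mem _

lemma projOdd_mem (x : W.carrier) : W.projOdd x ∈ W.part 1 := Submodule.coe_mem _

lemma projEven_add_projOdd (x : W.carrier) : W.projEven x + W.projOdd x = x := by
  obtain ⟨a, ha, b, hb, rfl⟩ : ∃ a ∈ W.part 0, ∃ b ∈ W.part 1, a + b = x :=
    Submodule.mem_sup.1 (W.isCompl.sup_eq_top ▸ Submodule.mem_top)
  simp [W.projEven_of_even ha, W.projEven_of_odd hb, W.projOdd_of_odd hb, W.projOdd_of_even ha]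

lemma pty_of_even {x : W.carrier} (hx : x ∈ W.part 0) : W.pty x = x := by
  simp [pty, W.projEven_of_even hx, W.projOdd_of_even hx]

lemma pty_of_odd {x : W.carrier} (hx : x ∈ W.part 1) : W.pty x = -x := by
  simp [pty, W.projEven_of_odd hx, W.projOdd_of_odd hx]

/-- A property closed under addition holds as soon as it holds on homogeneous elements. -/
lemma induction_homogeneous {p : W.carrier → Prop} (h0 : ∀ x ∈ W.part 0, p x)
    (h1 : ∀ x ∈ W.part 1, p x) (hadd : ∀ x y, p x → p y → p (x + y)) (x : W.carrier) : p x := by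
  rw [← W.projEven_add_projOdd x]
  exact hadd _ _ (h0 _ (W.projEven_mem x)) (h1 _ (W.projOdd_mem x))

lemma pty_pty (x : W.carrier) : W.pty (W.pty x) = x := by
  refine W.induction_homogeneous (p := fun x => W.pty (W.pty x) = x) (fun x hx => ?_)
    (fun x hx => ?_) (fun x y hx hy => ?_) x
  · rw [W.pty_of_even hx, W.pty_of_even hx]
  · rw [W.pty_of_odd hx, map_neg, W.pty_of_odd hx, neg_neg]
  · rw [map_add, map_add, hx, hy]

end SuperVS

/-- A graded space together with a relation prescribing (some of) the graded brackets of
homogeneous elements. -/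
structure BracketData extends SuperVS where
  rel : ZMod 2 → ZMod 2 → carrier → carrier → carrier → Prop
  left_mem : ∀ {i j x y z}, rel i j x y z → x ∈ part i
  right_mem : ∀ {i j x y z}, rel i j x y z → y ∈ part j
  out_mem : ∀ {i j x y z}, rel i j x y z → z ∈ part (i + j)

/-- The bracket data of a Lie superalgebra. -/
def LieSuperAlgebra.bracketData (g : LieSuperAlgebra) : BracketData where
  toSuperVS := g.toSuperVS
  rel i j x y z := x ∈ g.part i ∧ y ∈ g.part j ∧ z = g.bracket x y
  left_mem h := h.1
  right_mem h := h.2.1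
  out_mem h := h.2.2 ▸ g.bracket_grading _ _ _ h.1 _ h.2.1

/-- A representation of bracket data: an involution `σ` giving the parity and operators
realizing the prescribed brackets as graded commutators. -/
structure SRep (B : BracketData) (N : Type*) [AddCommGroup N] [Module ℂ N] where
  σ : Module.End ℂ N
  ρ : B.carrier →ₗ[ℂ] Module.End ℂ N
  sq : σ * σ = 1
  comm : ∀ i, ∀ x ∈ B.part i, σ * ρ x = ssgn 1 i • (ρ x * σ)
  rel : ∀ {i j x y z}, B.rel i j x y z → ρ z = ρ x * ρ y - ssgn i j • (ρ y * ρ x)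

namespace SRep

variable {B : BracketData} {N N₁ N₂ : Type*} [AddCommGroup N] [Module ℂ N]
  [AddCommGroup N₁] [Module ℂ N₁] [AddCommGroup N₂] [Module ℂ N₂]

section

variable (R : SRep B N)

lemma σσ (m : N) : R.σ (R.σ m) = m := LinearMap.congr_fun R.sq m

lemma σρ {i : ZMod 2} {x : B.carrier} (hx : x ∈ B.part i) (m : N) :
    R.σ (R.ρ x m) = ssgn 1 i • R.ρ x (R.σ m) := LinearMap.congr_fun (R.comm i x hx) m

lemma σρ_even {x : B.carrier} (hx : x ∈ B.part 0) (m : N) :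
    R.σ (R.ρ x m) = R.ρ x (R.σ m) := by simpa using R.σρ hx m

lemma σρ_odd {x : B.carrier} (hx : x ∈ B.part 1) (m : N) :
    R.σ (R.ρ x m) = - R.ρ x (R.σ m) := by simpa using R.σρ hx m

lemma rel_apply {i j : ZMod 2} {x y z : B.carrier} (h : B.rel i j x y z) (m : N) :
    R.ρ z m = R.ρ x (R.ρ y m) - ssgn i j • R.ρ y (R.ρ x m) := by
  rw [R.rel h]; rfl

/-- The power `σ ^ i` for a parity `i`. -/
def sg (i : ZMod 2) : Module.End ℂ N := if i = 0 then 1 else R.σ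

@[simp] lemma sg_zero : R.sg 0 = 1 := by simp [sg]

@[simp] lemma sg_one : R.sg 1 = R.σ := by simp [sg]

lemma sg_mul (i j : ZMod 2) : R.sg i * R.sg j = R.sg (i + j) := by
  rcases zmodTwo_cases i with rfl | rfl <;> rcases zmodTwo_cases j with rfl | rfl <;>
    simp [R.sq, zmodTwo_one_add_one]

lemma sg_comm {i : ZMod 2} {x : B.carrier} (hx : x ∈ B.part i) (j : ZMod 2) :
    R.sg j * R.ρ x = ssgn i j • (R.ρ x * R.sg j) := by
  rcases zmodTwo_cases j with rfl | rfl
  · simp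
  · simp [R.comm i x hx, ssgn_comm 1 i]

end

/-- The tensor product of two representations. -/
def tensor (R₁ : SRep B N₁) (R₂ : SRep B N₂) : SRep B (TensorProduct ℂ N₁ N₂) where
  σ := TensorProduct.map R₁.σ R₂.σ
  ρ :=
    { toFun := fun x => TensorProduct.map (R₁.ρ x) 1 + TensorProduct.map 1 (R₂.ρ (B.projEven x))
        + TensorProduct.map R₁.σ (R₂.ρ (B.projOdd x))
      map_add' := fun x y => by
        simp only [map_add, TensorProduct.map_add_left, TensorProduct.map_add_right]; abel
      map_smul' := fun c x => by
        simp only [map_smul, TensorProduct.map_smul_left, TensorProduct.map_smul_right,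
          smul_add, RingHom.id_apply] }
  sq := by rw [← TensorProduct.map_mul, R₁.sq, R₂.sq, TensorProduct.map_one]
  comm := by
    intro i x hx
    rcases zmodTwo_cases i with rfl | rfl
    · simp only [LinearMap.coe_mk, AddHom.coe_mk, B.projEven_of_even hx, B.projOdd_of_even hx,
        map_zero, TensorProduct.map_zero_right, add_zero, mul_add, add_mul, smul_add,
        ← TensorProduct.map_mul, R₁.comm 0 x hx, R₂.comm 0 x hx, mul_one, one_mul,
        TensorProduct.map_smul_left, TensorProduct.map_smul_right]
    · simp only [LinearMap.coe_mk, AddHom.coe_mk, B.projEven_of_odd hx, B.projOdd_of_odd hx,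
        map_zero, TensorProduct.map_zero_right, add_zero, mul_add, add_mul, smul_add,
        ← TensorProduct.map_mul, R₁.comm 1 x hx, R₂.comm 1 x hx, mul_one, one_mul,
        TensorProduct.map_smul_left, TensorProduct.map_smul_right]
  rel := by
    intro i j x y z h
    have key : ∀ {i} {x : B.carrier}, x ∈ B.part i →
        TensorProduct.map (R₁.ρ x) 1 + TensorProduct.map 1 (R₂.ρ (B.projEven x))
        + TensorProduct.map R₁.σ (R₂.ρ (B.projOdd x)) =
        TensorProduct.map (R₁.ρ x) (1 : Module.End ℂ N₂)
          + TensorProduct.map (R₁.sg i) (R₂.ρ x) := by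
      intro i x hx
      rcases zmodTwo_cases i with rfl | rfl
      · simp [B.projEven_of_even hx, B.projOdd_of_even hx]
      · simp [B.projEven_of_odd hx, B.projOdd_of_odd hx]
    simp only [LinearMap.coe_mk, AddHom.coe_mk]
    rw [key (B.left_mem h), key (B.right_mem h), key (B.out_mem h), R₁.rel h, R₂.rel h]
    simp only [mul_add, add_mul, smul_add, ← TensorProduct.map_mul, mul_one, one_mul,
      R₁.sg_comm (B.left_mem h), R₁.sg_comm (B.right_mem h), R₁.sg_mul, add_comm j i,
      TensorProduct.map_smul_left, TensorProduct.map_smul_right, sub_eq_add_neg,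
      TensorProduct.map_add_left, TensorProduct.map_add_right, ← neg_smul]
    simp only [smul_smul, ssgn_comm j i, ssgn_mul_self]
    module

lemma tensor_σ (R₁ : SRep B N₁) (R₂ : SRep B N₂) (a : N₁) (b : N₂) :
    (R₁.tensor R₂).σ (a ⊗ₜ b) = R₁.σ a ⊗ₜ R₂.σ b := rfl

lemma tensor_ρ (R₁ : SRep B N₁) (R₂ : SRep B N₂) {i : ZMod 2} {x : B.carrier}
    (hx : x ∈ B.part i) (a : N₁) (b : N₂) :
    (R₁.tensor R₂).ρ x (a ⊗ₜ b) = R₁.ρ x a ⊗ₜ b + R₁.sg i a ⊗ₜ R₂.ρ x b := by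
  change R₁.ρ x a ⊗ₜ b + a ⊗ₜ R₂.ρ (B.projEven x) b + R₁.σ a ⊗ₜ R₂.ρ (B.projOdd x) b = _
  rcases zmodTwo_cases i with rfl | rfl
  · simp [B.projEven_of_even hx, B.projOdd_of_even hx]
  · simp [B.projEven_of_odd hx, B.projOdd_of_odd hx]

/-- The restriction of a representation to a stable subspace. -/
def restrict (R : SRep B N) (U : Submodule ℂ N) (hσ : ∀ m ∈ U, R.σ m ∈ U)
    (hρ : ∀ x, ∀ m ∈ U, R.ρ x m ∈ U) : SRep B U where
  σ := R.σ.restrict hσ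
  ρ :=
    { toFun := fun x => (R.ρ x).restrict (hρ x)
      map_add' := fun x y => by ext m; simp [LinearMap.restrict_apply]
      map_smul' := fun c x => by ext m; simp [LinearMap.restrict_apply] }
  sq := by
    ext m
    simp [LinearMap.restrict_apply, R.σσ]
  comm i x hx := by
    ext m
    simp [LinearMap.restrict_apply, R.σρ hx]
  rel h := by
    ext m
    simp [LinearMap.restrict_apply, R.rel_apply h]

end SRep

/-! ### The universal representation generated by an even vector killed by a given set -/

namespace BracketData

variable (B : BracketData) (H : Set B.carrier)

/-- The free algebra on the elements of `B` and a parity operator. -/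
abbrev FreeAlg : Type := FreeAlgebra ℂ (Option B.carrier)

/-- The generator of the free algebra attached to an element of `B`. -/
def gen (x : B.carrier) : B.FreeAlg := FreeAlgebra.ι ℂ (some x)

/-- The parity generator of the free algebra. -/
def parityGen : B.FreeAlg := FreeAlgebra.ι ℂ none

/-- The elements of the free algebra which vanish in every representation of `B`. -/
inductive Relator : B.FreeAlg → Prop
  | add (x y) : Relator (B.gen (x + y) - (B.gen x + B.gen y))
  | smul (c : ℂ) (x) : Relator (B.gen (c • x) - c • B.gen x)
  | sq : Relator (B.parityGen * B.parityGen - 1)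
  | comm (i x) (hx : x ∈ B.part i) :
      Relator (B.parityGen * B.gen x - ssgn 1 i • (B.gen x * B.parityGen))
  | rel (i j x y z) (h : B.rel i j x y z) :
      Relator (B.gen z - (B.gen x * B.gen y - ssgn i j • (B.gen y * B.gen x)))

/-- The left ideal defining the universal representation. -/
def univIdeal : Submodule B.FreeAlg B.FreeAlg :=
  Submodule.span B.FreeAlg ({a | ∃ r b, B.Relator r ∧ a = r * b} ∪
    ({a | ∃ x ∈ H, a = B.gen x} ∪ {B.parityGen - 1}))

/-- The universal representation generated by an even vector killed by `H`. -/
def Univ : Type := B.FreeAlg ⧸ B.univIdeal H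

instance : AddCommGroup (B.Univ H) := inferInstanceAs (AddCommGroup (B.FreeAlg ⧸ B.univIdeal H))

instance : Module B.FreeAlg (B.Univ H) :=
  inferInstanceAs (Module B.FreeAlg (B.FreeAlg ⧸ B.univIdeal H))

instance : Module ℂ (B.Univ H) := inferInstanceAs (Module ℂ (B.FreeAlg ⧸ B.univIdeal H))

instance : IsScalarTower ℂ B.FreeAlg (B.Univ H) :=
  inferInstanceAs (IsScalarTower ℂ B.FreeAlg (B.FreeAlg ⧸ B.univIdeal H))

/-- The generating vector. -/
def vac : B.Univ H := Submodule.Quotient.mk 1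

lemma smul_vac (a : B.FreeAlg) : a • B.vac H = Submodule.Quotient.mk a := by
  change Submodule.Quotient.mk (a • (1 : B.FreeAlg)) = _
  rw [smul_eq_mul, mul_one]

lemma exists_smul_vac (m : B.Univ H) : ∃ a : B.FreeAlg, a • B.vac H = m := by
  obtain ⟨a, rfl⟩ := Submodule.Quotient.mk_surjective _ m
  exact ⟨a, B.smul_vac H a⟩

lemma relator_smul {r : B.FreeAlg} (hr : B.Relator r) (m : B.Univ H) : r • m = 0 := by
  obtain ⟨b, rfl⟩ := B.exists_smul_vac H m
  rw [smul_smul, smul_vac]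
  exact (Submodule.Quotient.mk_eq_zero _).2 (Submodule.subset_span (Or.inl ⟨r, b, hr, rfl⟩))

/-- The action of the free algebra on the universal representation. -/
def univAct : B.FreeAlg →ₐ[ℂ] Module.End ℂ (B.Univ H) := Algebra.lsmul ℂ ℂ (B.Univ H)

lemma univAct_relator {r s : B.FreeAlg} (hr : B.Relator (r - s)) :
    B.univAct H r = B.univAct H s := by
  ext m
  have := B.relator_smul H hr m
  rw [sub_smul, sub_eq_zero] at this
  exact this

/-- The representation structure on `Univ`. -/
def univRep : SRep B (B.Univ H) where
  σ := B.univAct H B.parityGen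
  ρ :=
    { toFun := fun x => B.univAct H (B.gen x)
      map_add' := fun x y => by
        rw [B.univAct_relator H (Relator.add x y), map_add]
      map_smul' := fun c x => by
        rw [B.univAct_relator H (Relator.smul c x), map_smul]; rfl }
  sq := by rw [← map_mul, B.univAct_relator H Relator.sq, map_one]
  comm i x hx := by
    change B.univAct H _ * B.univAct H _ = ssgn 1 i • (B.univAct H _ * B.univAct H _)
    rw [← map_mul, ← map_mul, ← map_smul]
    exact B.univAct_relator H (Relator.comm i x hx)
  rel := fun {i j x y z} h => by
    change B.univAct H _ = B.univAct H _ * B.univAct H _ -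
      ssgn i j • (B.univAct H _ * B.univAct H _)
    rw [← map_mul, ← map_mul, ← map_smul, ← map_sub]
    exact B.univAct_relator H (Relator.rel i j x y z h)

lemma univ_ρ_vac {x : B.carrier} (hx : x ∈ H) : (B.univRep H).ρ x (B.vac H) = 0 := by
  change B.gen x • B.vac H = 0
  rw [smul_vac]
  exact (Submodule.Quotient.mk_eq_zero _).2
    (Submodule.subset_span (Or.inr (Or.inl ⟨x, hx, rfl⟩)))

lemma univ_σ_vac : (B.univRep H).σ (B.vac H) = B.vac H := by
  change B.parityGen • B.vac H = B.vac H
  have h : (B.parityGen - 1) • B.vac H = 0 := by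
    rw [smul_vac]
    exact (Submodule.Quotient.mk_eq_zero _).2 (Submodule.subset_span (Or.inr (Or.inr rfl)))
  rw [sub_smul, one_smul, sub_eq_zero] at h
  exact h

/-- A subspace containing the generating vector and stable under all operators is everything. -/
lemma univ_eq_top {U : Submodule ℂ (B.Univ H)} (h1 : B.vac H ∈ U)
    (hσ : ∀ m ∈ U, (B.univRep H).σ m ∈ U) (hρ : ∀ x, ∀ m ∈ U, (B.univRep H).ρ x m ∈ U) :
    U = ⊤ := by
  have key : ∀ a : B.FreeAlg, ∀ m ∈ U, a • m ∈ U := by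
    intro a
    induction a using FreeAlgebra.induction with
    | grade0 c =>
      intro m hm
      rw [algebraMap_smul]; exact U.smul_mem c hm
    | grade1 x =>
      cases x with
      | none => exact hσ
      | some x => exact hρ x
    | mul a b ha hb => intro m hm; rw [mul_smul]; exact ha _ (hb m hm)
    | add a b ha hb => intro m hm; rw [add_smul]; exact add_mem (ha m hm) (hb m hm)
  rw [eq_top_iff]
  intro m _
  obtain ⟨a, rfl⟩ := B.exists_smul_vac H m
  exact key a _ h1

variable {H} {N : Type*} [AddCommGroup N] [Module ℂ N]

/-- The universal property of `Univ`. -/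
theorem exists_univ_hom (R : SRep B N) (n : N) (hσ : R.σ n = n) (hn : ∀ x ∈ H, R.ρ x n = 0) :
    ∃ f : B.Univ H →ₗ[ℂ] N, f (B.vac H) = n ∧
      (∀ m, f ((B.univRep H).σ m) = R.σ (f m)) ∧
      ∀ x m, f ((B.univRep H).ρ x m) = R.ρ x (f m) := by
  let φ : B.FreeAlg →ₐ[ℂ] Module.End ℂ N :=
    FreeAlgebra.lift ℂ (fun o => o.elim R.σ (fun x => R.ρ x))
  have hg : ∀ x, φ (B.gen x) = R.ρ x := fun x => FreeAlgebra.lift_ι_apply _ _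
  have hs : φ B.parityGen = R.σ := FreeAlgebra.lift_ι_apply _ _
  have hr : ∀ r, B.Relator r → φ r = 0 := by
    intro r hr
    induction hr with
    | add x y => simp [hg]
    | smul c x => simp [hg]
    | sq => simp [hs, R.sq]
    | comm i x hx => simp [hg, hs, R.comm i x hx]
    | rel i j x y z h =>
      simp only [map_sub, map_mul, map_smul, hg]
      rw [R.rel h, sub_self]
  have hker : ∀ a ∈ B.univIdeal H, φ a n = 0 := by
    intro a ha
    induction ha using Submodule.span_induction with
    | mem a ha =>
      rcases ha with ⟨r, b, hrr, rfl⟩ | ⟨x, hx, rfl⟩ | rfl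
      · rw [map_mul, hr r hrr, zero_mul]; rfl
      · rw [hg]; exact hn x hx
      · simp [hs, hσ]
    | zero => simp
    | add a b _ _ ha hb => simp [ha, hb]
    | smul c a _ ha => rw [smul_eq_mul, map_mul, Module.End.mul_apply, ha, map_zero]
  let f : B.Univ H →ₗ[ℂ] N :=
    (Submodule.liftQ ((B.univIdeal H).restrictScalars ℂ) (LinearMap.applyₗ n ∘ₗ φ.toLinearMap) hker)
  have hf : ∀ a : B.FreeAlg, f (a • B.vac H) = φ a n := by
    intro a; rw [smul_vac]; rfl
  refine ⟨f, ?_, ?_, ?_⟩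
  · have := hf 1
    simpa using this
  · intro m
    obtain ⟨a, rfl⟩ := B.exists_smul_vac H m
    change f (B.parityGen • a • B.vac H) = _
    rw [smul_smul, hf, hf, map_mul, hs]; rfl
  · intro x m
    obtain ⟨a, rfl⟩ := B.exists_smul_vac H m
    change f (B.gen x • a • B.vac H) = _
    rw [smul_smul, hf, hf, map_mul, hg]; rfl

/-- Homomorphisms out of `Univ` are determined by the image of the generating vector. -/
theorem univ_hom_ext (R : SRep B N) {f f' : B.Univ H →ₗ[ℂ] N} (h : f (B.vac H) = f' (B.vac H))
    (hσ : ∀ m, f ((B.univRep H).σ m) = R.σ (f m))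
    (hσ' : ∀ m, f' ((B.univRep H).σ m) = R.σ (f' m))
    (hρ : ∀ x m, f ((B.univRep H).ρ x m) = R.ρ x (f m))
    (hρ' : ∀ x m, f' ((B.univRep H).ρ x m) = R.ρ x (f' m)) : f = f' := by
  have : LinearMap.eqLocus f f' = ⊤ := by
    refine B.univ_eq_top H h (fun m hm => ?_) (fun x m hm => ?_)
    · rw [LinearMap.mem_eqLocus] at hm ⊢; rw [hσ, hσ', hm]
    · rw [LinearMap.mem_eqLocus] at hm ⊢; rw [hρ, hρ', hm]
  exact LinearMap.eqLocus_eq_top.1 this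

end BracketData

/-! ### The differential graded double of a Lie superalgebra -/

namespace LieSuperAlgebra

variable (g : LieSuperAlgebra)

/-- The brackets of the differential graded double `g ⊕ εg ⊕ ℂ∂ ⊕ ℂe`. -/
inductive HatRel : ZMod 2 → ZMod 2 → g.carrier × g.carrier × ℂ × ℂ →
    g.carrier × g.carrier × ℂ × ℂ → g.carrier × g.carrier × ℂ × ℂ → Prop
  | ii (i j x y) (hx : x ∈ g.part i) (hy : y ∈ g.part j) :
      HatRel i j (x, 0, 0, 0) (y, 0, 0, 0) (g.bracket x y, 0, 0, 0)
  | ik (i j x y) (hx : x ∈ g.part i) (hy : y ∈ g.part j) :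
      HatRel i (j + 1) (x, 0, 0, 0) (0, y, 0, 0) (0, ssgn i 1 • g.bracket x y, 0, 0)
  | kk (i j x y) (hx : x ∈ g.part i) (hy : y ∈ g.part j) :
      HatRel (i + 1) (j + 1) (0, x, 0, 0) (0, y, 0, 0) 0
  | dk (i x) (hx : x ∈ g.part i) : HatRel 1 (i + 1) (0, 0, 1, 0) (0, x, 0, 0) (x, 0, 0, 0)
  | di (i x) (hx : x ∈ g.part i) : HatRel 1 i (0, 0, 1, 0) (x, 0, 0, 0) 0
  | dd : HatRel 1 1 (0, 0, 1, 0) (0, 0, 1, 0) 0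
  | ek (i x) (hx : x ∈ g.part i) : HatRel 0 (i + 1) (0, 0, 0, 1) (0, x, 0, 0) (0, x, 0, 0)
  | ei (i x) (hx : x ∈ g.part i) : HatRel 0 i (0, 0, 0, 1) (x, 0, 0, 0) 0
  | ed : HatRel 0 1 (0, 0, 0, 1) (0, 0, 1, 0) (0, 0, -1, 0)

/-- The grading of the differential graded double. -/
def hatPart (i : ZMod 2) : Submodule ℂ (g.carrier × g.carrier × ℂ × ℂ) :=
  (g.part i).prod ((g.part (i + 1)).prod
    ((if i = 0 then ⊥ else ⊤ : Submodule ℂ ℂ).prod (if i = 0 then ⊤ else ⊥ : Submodule ℂ ℂ)))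

lemma mem_hatPart_zero {v : g.carrier × g.carrier × ℂ × ℂ} :
    v ∈ g.hatPart 0 ↔ v.1 ∈ g.part 0 ∧ v.2.1 ∈ g.part 1 ∧ v.2.2.1 = 0 := by
  simp [hatPart, Submodule.mem_prod]

lemma mem_hatPart_one {v : g.carrier × g.carrier × ℂ × ℂ} :
    v ∈ g.hatPart 1 ↔ v.1 ∈ g.part 1 ∧ v.2.1 ∈ g.part 0 ∧ v.2.2.2 = 0 := by
  simp [hatPart, Submodule.mem_prod, zmodTwo_one_add_one]

lemma isCompl_hatPart : IsCompl (g.hatPart 0) (g.hatPart 1) := by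
  constructor
  · rw [Submodule.disjoint_def]
    intro v hv hv'
    rw [mem_hatPart_zero] at hv
    rw [mem_hatPart_one] at hv'
    have h := Submodule.disjoint_def.1 g.isCompl.disjoint
    exact Prod.ext (h _ hv.1 hv'.1) (Prod.ext (h _ hv'.2.1 hv.2.1) (Prod.ext hv.2.2 hv'.2.2))
  · rw [codisjoint_iff, eq_top_iff]
    rintro ⟨x, y, c, c'⟩ -
    rw [Submodule.mem_sup]
    refine ⟨(g.projEven x, g.projOdd y, 0, c'), ?_, (g.projOdd x, g.projEven y, c, 0), ?_, ?_⟩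
    · exact g.mem_hatPart_zero.2 ⟨g.projEven_mem _, g.projOdd_mem _, rfl⟩
    · exact g.mem_hatPart_one.2 ⟨g.projOdd_mem _, g.projEven_mem _, rfl⟩
    · simp [g.projEven_add_projOdd, add_comm (g.projOdd y)]

/-- The `ι`-copy of `g` in the double. -/
lemma left_mem_hatPart {i : ZMod 2} {x : g.carrier} (hx : x ∈ g.part i) :
    ((x, 0, 0, 0) : g.carrier × g.carrier × ℂ × ℂ) ∈ g.hatPart i := by
  simp [hatPart, Submodule.mem_prod, hx]

lemma right_mem_hatPart {i : ZMod 2} {x : g.carrier} (hx : x ∈ g.part i) :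
    ((0, x, 0, 0) : g.carrier × g.carrier × ℂ × ℂ) ∈ g.hatPart (i + 1) := by
  have h : i + 1 + 1 = i := by rw [add_assoc, zmodTwo_one_add_one, add_zero]
  simp [hatPart, Submodule.mem_prod, h, hx]

lemma d_mem_hatPart (c : ℂ) : ((0, 0, c, 0) : g.carrier × g.carrier × ℂ × ℂ) ∈ g.hatPart 1 := by
  simp [hatPart, Submodule.mem_prod]

lemma e_mem_hatPart : ((0, 0, 0, 1) : g.carrier × g.carrier × ℂ × ℂ) ∈ g.hatPart 0 := by
  simp [hatPart, Submodule.mem_prod]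

/-- The differential graded double of a Lie superalgebra. -/
def hat : BracketData where
  carrier := g.carrier × g.carrier × ℂ × ℂ
  part := g.hatPart
  isCompl := g.isCompl_hatPart
  rel := g.HatRel
  left_mem h := by
    cases h with
    | ii i j x y hx hy => exact g.left_mem_hatPart hx
    | ik i j x y hx hy => exact g.left_mem_hatPart hx
    | kk i j x y hx hy => exact g.right_mem_hatPart hx
    | dk | di | dd => exact g.d_mem_hatPart 1
    | ek | ei | ed => exact g.e_mem_hatPart
  right_mem h := by
    cases h with
    | ii i j x y hx hy => exact g.left_mem_hatPart hy
    | ik i j x y hx hy => exact g.right_mem_hatPart hy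
    | kk i j x y hx hy => exact g.right_mem_hatPart hy
    | dk i x hx => exact g.right_mem_hatPart hx
    | di i x hx => exact g.left_mem_hatPart hx
    | dd => exact g.d_mem_hatPart 1
    | ek i x hx => exact g.right_mem_hatPart hx
    | ei i x hx => exact g.left_mem_hatPart hx
    | ed => exact g.d_mem_hatPart 1
  out_mem h := by
    cases h with
    | ii i j x y hx hy => exact g.left_mem_hatPart (g.bracket_grading _ _ _ hx _ hy)
    | ik i j x y hx hy =>
      rw [← add_assoc]
      exact g.right_mem_hatPart (Submodule.smul_mem _ _ (g.bracket_grading _ _ _ hx _ hy))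
    | kk | di | dd | ei => exact zero_mem _
    | dk i x hx =>
      rw [add_left_comm, zmodTwo_one_add_one, add_zero]; exact g.left_mem_hatPart hx
    | ek i x hx => rw [zero_add]; exact g.right_mem_hatPart hx
    | ed => exact g.d_mem_hatPart (-1)

end LieSuperAlgebra

namespace SRep

variable {g : LieSuperAlgebra} {N : Type*} [AddCommGroup N] [Module ℂ N]

section

variable (R : SRep g.hat N)

/-- The action of the copy of `g`. -/
def opI : g.carrier →ₗ[ℂ] Module.End ℂ N :=
  R.ρ ∘ₗ LinearMap.inl ℂ g.carrier (g.carrier × ℂ × ℂ)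

/-- The action of the copy `εg` of `g`. -/
def opK : g.carrier →ₗ[ℂ] Module.End ℂ N :=
  R.ρ ∘ₗ LinearMap.inr ℂ g.carrier (g.carrier × ℂ × ℂ) ∘ₗ LinearMap.inl ℂ g.carrier (ℂ × ℂ)

/-- The differential. -/
def opD : Module.End ℂ N := R.ρ ((0, 0, 1, 0) : g.carrier × g.carrier × ℂ × ℂ)

/-- The Euler operator. -/
def opE : Module.End ℂ N := R.ρ ((0, 0, 0, 1) : g.carrier × g.carrier × ℂ × ℂ)

lemma ρ_zero : R.ρ (0 : g.carrier × g.carrier × ℂ × ℂ) = 0 := map_zero R.ρ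

lemma ρ_eq (v : g.carrier × g.carrier × ℂ × ℂ) :
    R.ρ v = R.opI v.1 + R.opK v.2.1 + v.2.2.1 • R.opD + v.2.2.2 • R.opE := by
  have h : v = ((v.1, 0, 0, 0) + (0, v.2.1, 0, 0) + v.2.2.1 • (0, 0, 1, 0)
      + v.2.2.2 • (0, 0, 0, 1) : g.carrier × g.carrier × ℂ × ℂ) := by simp
  let T : g.carrier × g.carrier × ℂ × ℂ →ₗ[ℂ] Module.End ℂ N := R.ρ
  have h' := congrArg T h
  rw [map_add, map_add, map_add, map_smul, map_smul] at h'
  exact h'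

variable {i j : ZMod 2} {x y : g.carrier} (m : N)

lemma σ_opI (hx : x ∈ g.part i) : R.σ (R.opI x m) = ssgn 1 i • R.opI x (R.σ m) :=
  R.σρ (g.left_mem_hatPart hx) m

lemma σ_opK (hx : x ∈ g.part i) : R.σ (R.opK x m) = ssgn 1 (i + 1) • R.opK x (R.σ m) :=
  R.σρ (g.right_mem_hatPart hx) m

lemma σ_opD : R.σ (R.opD m) = - R.opD (R.σ m) := R.σρ_odd (g.d_mem_hatPart 1) m

lemma σ_opE : R.σ (R.opE m) = R.opE (R.σ m) := R.σρ_even g.e_mem_hatPart m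

lemma opI_bracket (hx : x ∈ g.part i) (hy : y ∈ g.part j) :
    R.opI (g.bracket x y) m = R.opI x (R.opI y m) - ssgn i j • R.opI y (R.opI x m) :=
  R.rel_apply (LieSuperAlgebra.HatRel.ii i j x y hx hy) m

lemma opK_bracket (hx : x ∈ g.part i) (hy : y ∈ g.part j) :
    ssgn i 1 • R.opK (g.bracket x y) m =
      R.opI x (R.opK y m) - ssgn i (j + 1) • R.opK y (R.opI x m) := by
  rw [← LinearMap.smul_apply, ← map_smul]
  exact R.rel_apply (LieSuperAlgebra.HatRel.ik i j x y hx hy) m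

lemma opK_opK (hx : x ∈ g.part i) (hy : y ∈ g.part j) :
    R.opK x (R.opK y m) = ssgn (i + 1) (j + 1) • R.opK y (R.opK x m) := by
  have h := R.rel_apply (LieSuperAlgebra.HatRel.kk i j x y hx hy) m
  rw [ρ_zero, LinearMap.zero_apply] at h
  exact sub_eq_zero.1 h.symm

lemma opD_opK (hx : x ∈ g.part i) :
    R.opD (R.opK x m) = ssgn 1 (i + 1) • R.opK x (R.opD m) + R.opI x m := by
  have h := R.rel_apply (LieSuperAlgebra.HatRel.dk i x hx) m
  exact (eq_add_of_sub_eq' h.symm)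

lemma opD_opI (hx : x ∈ g.part i) :
    R.opD (R.opI x m) = ssgn 1 i • R.opI x (R.opD m) := by
  have h := R.rel_apply (LieSuperAlgebra.HatRel.di i x hx) m
  rw [ρ_zero, LinearMap.zero_apply] at h
  exact sub_eq_zero.1 h.symm

lemma opD_opD : R.opD (R.opD m) = 0 := by
  have h := R.rel_apply (LieSuperAlgebra.HatRel.dd (g := g)) m
  rw [ρ_zero, LinearMap.zero_apply, ssgn_one_one, neg_smul, one_smul, sub_neg_eq_add,
    ← two_smul ℂ] at h
  exact (smul_eq_zero.1 h.symm).resolve_left two_ne_zero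

lemma opE_opK (x : g.carrier) : R.opE (R.opK x m) = R.opK x (R.opE m) + R.opK x m := by
  have key : ∀ i, ∀ x ∈ g.part i, R.opE (R.opK x m) = R.opK x (R.opE m) + R.opK x m := by
    intro i x hx
    have h := R.rel_apply (LieSuperAlgebra.HatRel.ek i x hx) m
    rw [ssgn_zero_left, one_smul] at h
    exact (eq_add_of_sub_eq' h.symm)
  refine g.induction_homogeneous (p := fun x =>
    R.opE (R.opK x m) = R.opK x (R.opE m) + R.opK x m) (key 0) (key 1) (fun x y hx hy => ?_) x
  simp only [map_add, LinearMap.add_apply, hx, hy]; abel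

lemma opE_opI (x : g.carrier) : R.opE (R.opI x m) = R.opI x (R.opE m) := by
  have key : ∀ i, ∀ x ∈ g.part i, R.opE (R.opI x m) = R.opI x (R.opE m) := by
    intro i x hx
    have h := R.rel_apply (LieSuperAlgebra.HatRel.ei i x hx) m
    rw [ρ_zero, LinearMap.zero_apply, ssgn_zero_left, one_smul] at h
    exact sub_eq_zero.1 h.symm
  refine g.induction_homogeneous (p := fun x =>
    R.opE (R.opI x m) = R.opI x (R.opE m)) (key 0) (key 1) (fun x y hx hy => ?_) x
  simp only [map_add, LinearMap.add_apply, hx, hy]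

lemma opE_opD : R.opE (R.opD m) = R.opD (R.opE m) - R.opD m := by
  have h := R.rel_apply (LieSuperAlgebra.HatRel.ed (g := g)) m
  rw [ssgn_zero_left, one_smul] at h
  have h2 : R.ρ ((0, 0, -1, 0) : g.carrier × g.carrier × ℂ × ℂ) = - R.opD := by
    rw [ρ_eq]; simp
  rw [h2, LinearMap.neg_apply, eq_comm, sub_eq_iff_eq_add] at h
  rw [sub_eq_neg_add]
  exact h

/-- The underlying representation of `g`. -/
def toBase : SRep g.bracketData N where
  σ := R.σ
  ρ := R.opI
  sq := R.sq
  comm i x hx := LinearMap.ext fun m => R.σ_opI m hx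
  rel h := LinearMap.ext fun m => by
    obtain ⟨hx, hy, rfl⟩ := h
    exact R.opI_bracket m hx hy

end

/-- A representation of the double from its four kinds of operators. -/
def ofHat (σ : Module.End ℂ N) (I K : g.carrier →ₗ[ℂ] Module.End ℂ N) (D E : Module.End ℂ N)
    (sq : ∀ m, σ (σ m) = m)
    (σI : ∀ i, ∀ x ∈ g.part i, ∀ m, σ (I x m) = ssgn 1 i • I x (σ m))
    (σK : ∀ i, ∀ x ∈ g.part i, ∀ m, σ (K x m) = ssgn 1 (i + 1) • K x (σ m))
    (σD : ∀ m, σ (D m) = - D (σ m)) (σE : ∀ m, σ (E m) = E (σ m))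
    (ii : ∀ i j, ∀ x ∈ g.part i, ∀ y ∈ g.part j, ∀ m,
      I (g.bracket x y) m = I x (I y m) - ssgn i j • I y (I x m))
    (ik : ∀ i j, ∀ x ∈ g.part i, ∀ y ∈ g.part j, ∀ m,
      ssgn i 1 • K (g.bracket x y) m = I x (K y m) - ssgn i (j + 1) • K y (I x m))
    (kk : ∀ i j, ∀ x ∈ g.part i, ∀ y ∈ g.part j, ∀ m,
      K x (K y m) = ssgn (i + 1) (j + 1) • K y (K x m))
    (dk : ∀ i, ∀ x ∈ g.part i, ∀ m, I x m = D (K x m) - ssgn 1 (i + 1) • K x (D m))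
    (di : ∀ i, ∀ x ∈ g.part i, ∀ m, D (I x m) = ssgn 1 i • I x (D m))
    (dd : ∀ m, D (D m) = 0)
    (ek : ∀ i, ∀ x ∈ g.part i, ∀ m, K x m = E (K x m) - K x (E m))
    (ei : ∀ i, ∀ x ∈ g.part i, ∀ m, E (I x m) = I x (E m))
    (ed : ∀ m, - D m = E (D m) - D (E m)) : SRep g.hat N :=
  let T : g.carrier × g.carrier × ℂ × ℂ →ₗ[ℂ] Module.End ℂ N :=
    I.coprod (K.coprod ((LinearMap.toSpanSingleton ℂ _ D).coprod
      (LinearMap.toSpanSingleton ℂ _ E)))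
  have hT : ∀ v m, T v m = I v.1 m + (K v.2.1 m + (v.2.2.1 • D m + v.2.2.2 • E m)) :=
    fun _ _ => rfl
  have hcomm : ∀ i (v : g.carrier × g.carrier × ℂ × ℂ), v ∈ g.hatPart i → ∀ m,
      σ (T v m) = ssgn 1 i • T v (σ m) := by
    intro i v hv m
    rw [hT, hT]
    rcases zmodTwo_cases i with rfl | rfl
    · obtain ⟨h1, h2, h3⟩ := g.mem_hatPart_zero.1 hv
      simp [σI 0 _ h1, σK 1 _ h2, h3, σE, zmodTwo_one_add_one]
    · obtain ⟨h1, h2, h3⟩ := g.mem_hatPart_one.1 hv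
      simp [σI 1 _ h1, σK 0 _ h2, h3, σD]
  have hrel : ∀ i j x y z, g.HatRel i j x y z → ∀ m,
      T z m = T x (T y m) - ssgn i j • T y (T x m) := by
    intro i j x y z h m
    cases h with
    | ii _ _ x y hx hy => simpa [hT] using ii _ _ x hx y hy m
    | ik _ _ x y hx hy => simpa [hT] using ik _ _ x hx y hy m
    | kk _ _ x y hx hy => simpa [hT] using (sub_eq_zero.2 (kk _ _ x hx y hy m)).symm
    | dk _ x hx => simpa [hT] using dk _ x hx m
    | di _ x hx => simpa [hT] using (sub_eq_zero.2 (di _ x hx m)).symm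
    | dd => simp [hT, dd]
    | ek _ x hx => simpa [hT] using ek _ x hx m
    | ei _ x hx => simpa [hT] using (sub_eq_zero.2 (ei _ x hx m)).symm
    | ed => simpa [hT] using ed m
  { σ := σ
    ρ := T
    sq := LinearMap.ext sq
    comm := fun i v hv => LinearMap.ext (hcomm i v hv)
    rel := fun h => LinearMap.ext (hrel _ _ _ _ _ h) }

end SRep

namespace SRep

variable {g : LieSuperAlgebra} {N N₁ N₂ : Type*} [AddCommGroup N] [Module ℂ N]
  [AddCommGroup N₁] [Module ℂ N₁] [AddCommGroup N₂] [Module ℂ N₂]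

section act

variable (R : SRep g.bracketData N)

/-- The action of a Lie superalgebra on a representation of its bracket data. -/
def act : g.carrier →ₗ[ℂ] Module.End ℂ N := R.ρ

variable {i j : ZMod 2} {x y : g.carrier}

lemma act_bracket (hx : x ∈ g.part i) (hy : y ∈ g.part j) (m : N) :
    R.act (g.bracket x y) m = R.act x (R.act y m) - ssgn i j • R.act y (R.act x m) :=
  R.rel_apply (B := g.bracketData) ⟨hx, hy, rfl⟩ m

lemma σ_act (hx : x ∈ g.part i) (m : N) : R.σ (R.act x m) = ssgn 1 i • R.act x (R.σ m) :=
  R.σρ (B := g.bracketData) hx m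

lemma σ_act_even (hx : x ∈ g.part 0) (m : N) : R.σ (R.act x m) = R.act x (R.σ m) := by
  simpa using R.σ_act hx m

lemma σ_act_odd (hx : x ∈ g.part 1) (m : N) : R.σ (R.act x m) = - R.act x (R.σ m) := by
  simpa using R.σ_act hx m

/-- A representation of a Lie superalgebra from its action. -/
def ofAct (σ : Module.End ℂ N) (a : g.carrier →ₗ[ℂ] Module.End ℂ N) (sq : ∀ m, σ (σ m) = m)
    (comm : ∀ i, ∀ x ∈ g.part i, ∀ m, σ (a x m) = ssgn 1 i • a x (σ m))
    (rel : ∀ i j, ∀ x ∈ g.part i, ∀ y ∈ g.part j, ∀ m,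
      a (g.bracket x y) m = a x (a y m) - ssgn i j • a y (a x m)) : SRep g.bracketData N where
  σ := σ
  ρ := a
  sq := LinearMap.ext sq
  comm i x hx := LinearMap.ext (comm i x hx)
  rel h := LinearMap.ext fun m => by
    obtain ⟨hx, hy, rfl⟩ := h
    exact rel _ _ _ hx _ hy m

lemma tensor_act (R₁ : SRep g.bracketData N₁) (R₂ : SRep g.bracketData N₂)
    (hx : x ∈ g.part i) (a : N₁) (b : N₂) :
    (R₁.tensor R₂).act x (a ⊗ₜ b) = R₁.act x a ⊗ₜ b + R₁.sg i a ⊗ₜ R₂.act x b :=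
  tensor_ρ (B := g.bracketData) R₁ R₂ hx a b

end act

lemma pty_mem {i : ZMod 2} {x : g.carrier} (hx : x ∈ g.part i) :
    g.pty x = ssgn 1 i • x := by
  rcases zmodTwo_cases i with rfl | rfl
  · simp [g.pty_of_even hx]
  · simp [g.pty_of_odd hx]

lemma ssgn_add_one (i j : ZMod 2) : ssgn i (j + 1) = ssgn i j * ssgn i 1 := by
  rcases zmodTwo_cases i with rfl | rfl <;> rcases zmodTwo_cases j with rfl | rfl <;>
    simp [zmodTwo_one_add_one]

/-- The extension of scalars of a representation of `g` to the dual numbers, as a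
representation of the double. -/
def eps (R : SRep g.bracketData N) : SRep g.hat (N × N) :=
  ofHat (R.σ.prodMap (-R.σ))
    { toFun := fun x => (R.act x).prodMap (R.act (g.pty x))
      map_add' := fun x y => by ext <;> simp
      map_smul' := fun c x => by ext <;> simp }
    { toFun := fun x => LinearMap.inr ℂ N N ∘ₗ R.act x ∘ₗ LinearMap.fst ℂ N N
      map_add' := fun x y => by ext <;> simp
      map_smul' := fun c x => by ext <;> simp }
    (LinearMap.inl ℂ N N ∘ₗ LinearMap.snd ℂ N N) (LinearMap.inr ℂ N N ∘ₗ LinearMap.snd ℂ N N)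
    (fun m => by simp [R.σσ])
    (fun i x hx m => by
      ext
      · simp [R.σ_act hx]
      · simp [pty_mem hx, R.σ_act hx])
    (fun i x hx m => by simp [R.σ_act hx, ssgn_add_one])
    (fun m => by simp) (fun m => by simp)
    (fun i j x hx y hy m => by
      ext
      · simp [R.act_bracket hx hy]
      · simp only [LinearMap.coe_mk, AddHom.coe_mk, LinearMap.prodMap_apply, Prod.snd_sub,
          Prod.smul_snd, pty_mem hx, pty_mem hy, pty_mem (g.bracket_grading _ _ _ hx _ hy),
          map_smul, LinearMap.smul_apply, R.act_bracket hx hy]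
        rcases zmodTwo_cases i with rfl | rfl <;> rcases zmodTwo_cases j with rfl | rfl <;>
          simp [zmodTwo_one_add_one] <;> abel)
    (fun i j x hx y hy m => by
      ext
      · simp
      · simp only [LinearMap.coe_mk, AddHom.coe_mk, LinearMap.prodMap_apply, Prod.snd_sub,
          Prod.smul_snd, pty_mem hx, LinearMap.coe_comp, Function.comp_apply,
          LinearMap.inr_apply, LinearMap.fst_apply,
          map_smul, LinearMap.smul_apply, R.act_bracket hx hy]
        rcases zmodTwo_cases i with rfl | rfl <;> rcases zmodTwo_cases j with rfl | rfl <;>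
          simp [zmodTwo_one_add_one] <;> abel)
    (fun i j x hx y hy m => by simp)
    (fun i x hx m => by
      ext
      · simp
      · simp [pty_mem hx, ssgn_add_one])
    (fun i x hx m => by simp [pty_mem hx])
    (fun m => by simp) (fun i x hx m => by simp) (fun i x hx m => by simp) (fun m => by simp)

section eps

variable (R : SRep g.bracketData N) (x : g.carrier) (a b : N)

lemma eps_σ : R.eps.σ (a, b) = (R.σ a, - R.σ b) := rfl

lemma eps_opI : R.eps.opI x (a, b) = (R.act x a, R.act (g.pty x) b) := by
  change (R.act x a, R.act (g.pty x) b) +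
    (((0 : N), R.act (0 : g.carrier) a) + ((0 : ℂ) • (b, (0 : N)) + (0 : ℂ) • ((0 : N), b))) = _
  simp

lemma eps_opK : R.eps.opK x (a, b) = (0, R.act x a) := by
  change (R.act (0 : g.carrier) a, R.act (g.pty (0 : g.carrier)) b) + (((0 : N), R.act x a) +
    ((0 : ℂ) • (b, (0 : N)) + (0 : ℂ) • ((0 : N), b))) = _
  simp

lemma eps_opD : R.eps.opD (a, b) = (b, 0) := by
  change (R.act (0 : g.carrier) a, R.act (g.pty (0 : g.carrier)) b) +
    (((0 : N), R.act (0 : g.carrier) a) + ((1 : ℂ) • (b, (0 : N)) + (0 : ℂ) • ((0 : N), b))) = _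
  simp

lemma eps_opE : R.eps.opE (a, b) = (0, b) := by
  change (R.act (0 : g.carrier) a, R.act (g.pty (0 : g.carrier)) b) +
    (((0 : N), R.act (0 : g.carrier) a) + ((0 : ℂ) • (b, (0 : N)) + (1 : ℂ) • ((0 : N), b))) = _
  simp

end eps

section tensor

variable (R₁ : SRep g.hat N₁) (R₂ : SRep g.hat N₂) {i : ZMod 2} {x : g.carrier} (a : N₁) (b : N₂)

lemma tensor_opI (hx : x ∈ g.part i) :
    (R₁.tensor R₂).opI x (a ⊗ₜ b) = R₁.opI x a ⊗ₜ b + R₁.sg i a ⊗ₜ R₂.opI x b :=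
  R₁.tensor_ρ R₂ (g.left_mem_hatPart hx) a b

lemma tensor_opK (hx : x ∈ g.part i) :
    (R₁.tensor R₂).opK x (a ⊗ₜ b) = R₁.opK x a ⊗ₜ b + R₁.sg (i + 1) a ⊗ₜ R₂.opK x b :=
  R₁.tensor_ρ R₂ (g.right_mem_hatPart hx) a b

lemma tensor_opD :
    (R₁.tensor R₂).opD (a ⊗ₜ b) = R₁.opD a ⊗ₜ b + R₁.σ a ⊗ₜ R₂.opD b := by
  have h := R₁.tensor_ρ R₂ (g.d_mem_hatPart 1) a b
  rw [sg_one] at h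
  exact h

lemma tensor_opE :
    (R₁.tensor R₂).opE (a ⊗ₜ b) = R₁.opE a ⊗ₜ b + a ⊗ₜ R₂.opE b := by
  have h := R₁.tensor_ρ R₂ g.e_mem_hatPart a b
  rw [sg_zero] at h
  exact h

end tensor

/-- The trivial representation of the double. -/
def trivialHat (g : LieSuperAlgebra) : SRep g.hat ℂ where
  σ := 1
  ρ := 0
  sq := one_mul 1
  comm i x hx := by simp
  rel h := by simp

end SRep

/-! ### The universal Koszul module and its filtration -/

namespace LieSuperAlgebra

variable (g : LieSuperAlgebra)

/-- The elements of the double killing the generator of the Koszul module. -/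
def hatEven : Set g.hat.carrier :=
  {v : g.carrier × g.carrier × ℂ × ℂ | v.1 ∈ g.part 0 ∧ v.2.1 ∈ g.part 0}

/-- The Koszul module: the representation of the double induced from the trivial
representation of `g₀ ⊕ εg₀ ⊕ ℂ∂ ⊕ ℂe`. -/
abbrev Kos : Type := g.hat.Univ g.hatEven

/-- The action of the double on the Koszul module. -/
def kos : SRep g.hat g.Kos := g.hat.univRep g.hatEven

/-- The generator of the Koszul module. -/
def kvac : g.Kos := g.hat.vac g.hatEven

lemma kos_σ_vac : g.kos.σ g.kvac = g.kvac := g.hat.univ_σ_vac _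

lemma kos_ρ_vac {v : g.carrier × g.carrier × ℂ × ℂ} (h1 : v.1 ∈ g.part 0)
    (h2 : v.2.1 ∈ g.part 0) : g.kos.ρ v g.kvac = 0 :=
  g.hat.univ_ρ_vac g.hatEven ⟨h1, h2⟩

variable {g} in
lemma opI_vac {x : g.carrier} (hx : x ∈ g.part 0) : g.kos.opI x g.kvac = 0 :=
  g.kos_ρ_vac (v := (x, 0, 0, 0)) hx (zero_mem _)

variable {g} in
lemma opK_vac {x : g.carrier} (hx : x ∈ g.part 0) : g.kos.opK x g.kvac = 0 :=
  g.kos_ρ_vac (v := (0, x, 0, 0)) (zero_mem _) hx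

lemma opD_vac : g.kos.opD g.kvac = 0 :=
  g.kos_ρ_vac (v := (0, 0, 1, 0)) (zero_mem _) (zero_mem _)

lemma opE_vac : g.kos.opE g.kvac = 0 :=
  g.kos_ρ_vac (v := (0, 0, 0, 1)) (zero_mem _) (zero_mem _)

/-- The subspace of the Koszul module spanned by words of length less than `p` in the odd
elements of `g` and `εg`. -/
def filt : ℕ → Submodule ℂ g.Kos
  | 0 => ⊥
  | p + 1 => (ℂ ∙ g.kvac) ⊔ (Submodule.map₂ g.kos.opI (g.part 1) (filt p) ⊔
      Submodule.map₂ g.kos.opK (g.part 1) (filt p))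

lemma vac_mem_filt (p : ℕ) : g.kvac ∈ g.filt (p + 1) :=
  Submodule.mem_sup_left (Submodule.mem_span_singleton_self _)

variable {g} in
lemma opI_mem_filt {p : ℕ} {v : g.carrier} (hv : v ∈ g.part 1) {m : g.Kos} (hm : m ∈ g.filt p) :
    g.kos.opI v m ∈ g.filt (p + 1) :=
  Submodule.mem_sup_right (Submodule.mem_sup_left (Submodule.apply_mem_map₂ _ hv hm))

variable {g} in
lemma opK_mem_filt {p : ℕ} {v : g.carrier} (hv : v ∈ g.part 1) {m : g.Kos} (hm : m ∈ g.filt p) :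
    g.kos.opK v m ∈ g.filt (p + 1) :=
  Submodule.mem_sup_right (Submodule.mem_sup_right (Submodule.apply_mem_map₂ _ hv hm))

lemma filt_succ_le {p : ℕ} {S : Submodule ℂ g.Kos} (h0 : g.kvac ∈ S)
    (hI : ∀ v ∈ g.part 1, ∀ m ∈ g.filt p, g.kos.opI v m ∈ S)
    (hK : ∀ v ∈ g.part 1, ∀ m ∈ g.filt p, g.kos.opK v m ∈ S) : g.filt (p + 1) ≤ S :=
  sup_le ((Submodule.span_singleton_le_iff_mem _ _).2 h0)
    (sup_le (Submodule.map₂_le.2 hI) (Submodule.map₂_le.2 hK))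

lemma filt_mono_succ (p : ℕ) : g.filt p ≤ g.filt (p + 1) := by
  induction p with
  | zero => exact bot_le
  | succ p ih =>
    exact g.filt_succ_le (g.vac_mem_filt _) (fun v hv m hm => opI_mem_filt hv (ih hm))
      (fun v hv m hm => opK_mem_filt hv (ih hm))

lemma filt_mono : Monotone g.filt := monotone_nat_of_le_succ g.filt_mono_succ

/-- An operator preserving the filtration: a criterion on generators. -/
lemma filt_stable {T : Module.End ℂ g.Kos} (h0 : ∀ p, T g.kvac ∈ g.filt (p + 1))
    (hI : ∀ p, (∀ m ∈ g.filt p, T m ∈ g.filt p) → ∀ v ∈ g.part 1, ∀ m ∈ g.filt p,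
      T (g.kos.opI v m) ∈ g.filt (p + 1))
    (hK : ∀ p, (∀ m ∈ g.filt p, T m ∈ g.filt p) → ∀ v ∈ g.part 1, ∀ m ∈ g.filt p,
      T (g.kos.opK v m) ∈ g.filt (p + 1)) (p : ℕ) : ∀ m ∈ g.filt p, T m ∈ g.filt p := by
  induction p with
  | zero =>
    intro m hm
    rw [(Submodule.mem_bot ℂ).1 hm, map_zero]
    exact zero_mem _
  | succ p ih =>
    exact g.filt_succ_le (S := (g.filt (p + 1)).comap T) (h0 p) (hI p ih) (hK p ih)

variable {g}

lemma σ_mem_filt {p : ℕ} {m : g.Kos} (hm : m ∈ g.filt p) : g.kos.σ m ∈ g.filt p := by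
  refine g.filt_stable (fun p => ?_) (fun p ih v hv m hm => ?_) (fun p ih v hv m hm => ?_) p m hm
  · rw [g.kos_σ_vac]; exact g.vac_mem_filt p
  · rw [g.kos.σ_opI _ hv]; exact Submodule.smul_mem _ _ (opI_mem_filt hv (ih m hm))
  · rw [g.kos.σ_opK _ hv]; exact Submodule.smul_mem _ _ (opK_mem_filt hv (ih m hm))

lemma opI_even_mem_filt {p : ℕ} {x : g.carrier} (hx : x ∈ g.part 0) {m : g.Kos}
    (hm : m ∈ g.filt p) : g.kos.opI x m ∈ g.filt p := by
  refine g.filt_stable (fun p => ?_) (fun p ih v hv m hm => ?_) (fun p ih v hv m hm => ?_) p m hm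
  · rw [opI_vac hx]; exact zero_mem _
  · have h := g.kos.opI_bracket m hx hv
    rw [ssgn_zero_left, one_smul, eq_sub_iff_add_eq] at h
    rw [← h]
    exact add_mem (opI_mem_filt (by simpa using g.bracket_grading _ _ _ hx _ hv) hm)
      (opI_mem_filt hv (ih m hm))
  · have h := g.kos.opK_bracket m hx hv
    rw [ssgn_zero_left, ssgn_zero_left, one_smul, one_smul, eq_sub_iff_add_eq] at h
    rw [← h]
    exact add_mem (opK_mem_filt (by simpa using g.bracket_grading _ _ _ hx _ hv) hm)
      (opK_mem_filt hv (ih m hm))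

lemma opK_even_mem_filt {p : ℕ} {x : g.carrier} (hx : x ∈ g.part 0) {m : g.Kos}
    (hm : m ∈ g.filt p) : g.kos.opK x m ∈ g.filt p := by
  refine g.filt_stable (fun p => ?_) (fun p ih v hv m hm => ?_) (fun p ih v hv m hm => ?_) p m hm
  · rw [opK_vac hx]; exact zero_mem _
  · have h := g.kos.opK_bracket m hv hx
    rw [ssgn_one_one, zero_add, ssgn_one_one, neg_smul, neg_smul, one_smul, one_smul,
      sub_neg_eq_add, ← sub_eq_iff_eq_add'] at h
    rw [← h]
    refine sub_mem (neg_mem (opK_mem_filt (by simpa using g.bracket_grading _ _ _ hv _ hx) hm))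
      (opI_mem_filt hv (ih m hm))
  · rw [g.kos.opK_opK m hx hv]
    exact Submodule.smul_mem _ _ (opK_mem_filt hv (ih m hm))

lemma opD_mem_filt {p : ℕ} {m : g.Kos} (hm : m ∈ g.filt p) : g.kos.opD m ∈ g.filt p := by
  refine g.filt_stable (fun p => ?_) (fun p ih v hv m hm => ?_) (fun p ih v hv m hm => ?_) p m hm
  · rw [g.opD_vac]; exact zero_mem _
  · rw [g.kos.opD_opI m hv]
    exact Submodule.smul_mem _ _ (opI_mem_filt hv (ih m hm))
  · rw [g.kos.opD_opK m hv]
    exact add_mem (Submodule.smul_mem _ _ (opK_mem_filt hv (ih m hm))) (opI_mem_filt hv hm)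

lemma opE_mem_filt {p : ℕ} {m : g.Kos} (hm : m ∈ g.filt p) : g.kos.opE m ∈ g.filt p := by
  refine g.filt_stable (fun p => ?_) (fun p ih v hv m hm => ?_) (fun p ih v hv m hm => ?_) p m hm
  · rw [g.opE_vac]; exact zero_mem _
  · rw [g.kos.opE_opI m]
    exact opI_mem_filt hv (ih m hm)
  · rw [g.kos.opE_opK m]
    exact add_mem (opK_mem_filt hv (ih m hm)) (opK_mem_filt hv hm)

lemma opI_opI_mem_filt {p : ℕ} {v w : g.carrier} (hv : v ∈ g.part 1) (hw : w ∈ g.part 1)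
    {m : g.Kos} (hm : m ∈ g.filt p) :
    g.kos.opI v (g.kos.opI w m) + g.kos.opI w (g.kos.opI v m) ∈ g.filt p := by
  have h := g.kos.opI_bracket m hv hw
  rw [ssgn_one_one, neg_smul, one_smul, sub_neg_eq_add] at h
  rw [← h]
  exact opI_even_mem_filt (by simpa [zmodTwo_one_add_one] using g.bracket_grading _ _ _ hv _ hw) hm

lemma opI_opK_mem_filt {p : ℕ} {v w : g.carrier} (hv : v ∈ g.part 1) (hw : w ∈ g.part 1)
    {m : g.Kos} (hm : m ∈ g.filt p) :
    g.kos.opI v (g.kos.opK w m) - g.kos.opK w (g.kos.opI v m) ∈ g.filt p := by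
  have h := g.kos.opK_bracket m hv hw
  rw [zmodTwo_one_add_one, ssgn_zero_right, one_smul] at h
  rw [← h]
  exact Submodule.smul_mem _ _ (opK_even_mem_filt
    (by simpa [zmodTwo_one_add_one] using g.bracket_grading _ _ _ hv _ hw) hm)

lemma opK_comm {v w : g.carrier} (hv : v ∈ g.part 1) (hw : w ∈ g.part 1) (m : g.Kos) :
    g.kos.opK v (g.kos.opK w m) = g.kos.opK w (g.kos.opK v m) := by
  rw [g.kos.opK_opK m hv hw, zmodTwo_one_add_one, ssgn_zero_right, one_smul]

lemma exists_mem_filt (m : g.Kos) : ∃ p, m ∈ g.filt p := by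
  have hdir := g.filt_mono.directed_le
  have hmem : ∀ m, m ∈ ⨆ p, g.filt p ↔ ∃ p, m ∈ g.filt p := fun m =>
    Submodule.mem_iSup_of_directed _ hdir
  have htop : ⨆ p, g.filt p = ⊤ := by
    refine g.hat.univ_eq_top g.hatEven ((hmem _).2 ⟨1, g.vac_mem_filt 0⟩) (fun m hm => ?_) ?_
    · obtain ⟨p, hp⟩ := (hmem m).1 hm
      exact (hmem _).2 ⟨p, σ_mem_filt hp⟩
    · intro v m hm
      obtain ⟨p, hp⟩ := (hmem m).1 hm
      refine (hmem _).2 ⟨p + 1, ?_⟩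
      revert v
      change ∀ v : g.carrier × g.carrier × ℂ × ℂ, g.kos.ρ v m ∈ g.filt (p + 1)
      intro v
      rw [g.kos.ρ_eq v, ← g.projEven_add_projOdd v.1, ← g.projEven_add_projOdd v.2.1, map_add,
        map_add]
      have hp' := g.filt_mono_succ p hp
      exact add_mem (add_mem (add_mem
        (add_mem (opI_even_mem_filt (g.projEven_mem _) hp') (opI_mem_filt (g.projOdd_mem _) hp))
        (add_mem (opK_even_mem_filt (g.projEven_mem _) hp') (opK_mem_filt (g.projOdd_mem _) hp)))
        (Submodule.smul_mem _ _ (opD_mem_filt hp'))) (Submodule.smul_mem _ _ (opE_mem_filt hp'))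
  exact (hmem m).1 (htop ▸ Submodule.mem_top)

/-- The Koszul module is generated by its vacuum under the odd elements. -/
lemma kos_eq_top {U : Submodule ℂ g.Kos} (h0 : g.kvac ∈ U)
    (hI : ∀ v ∈ g.part 1, ∀ m ∈ U, g.kos.opI v m ∈ U)
    (hK : ∀ v ∈ g.part 1, ∀ m ∈ U, g.kos.opK v m ∈ U) : U = ⊤ := by
  have h : ∀ p, g.filt p ≤ U := by
    intro p
    induction p with
    | zero => exact bot_le
    | succ p ih =>
      exact g.filt_succ_le h0 (fun v hv m hm => hI v hv m (ih hm))
        (fun v hv m hm => hK v hv m (ih hm))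
  rw [eq_top_iff]
  intro m _
  obtain ⟨p, hp⟩ := exists_mem_filt m
  exact h p hp

end LieSuperAlgebra

lemma iSupIndep_eq_of_le {N ι : Type*} [AddCommGroup N] [Module ℂ N] {Z K : ι → Submodule ℂ N}
    (hK : iSupIndep K) (hle : ∀ n, Z n ≤ K n) (htop : ⨆ n, Z n = ⊤) (n : ι) : Z n = K n := by
  refine le_antisymm (hle n) ?_
  have h1 : Z n ⊔ ⨆ k, ⨆ _ : k ≠ n, K k = ⊤ := by
    rw [eq_top_iff, ← htop]
    refine iSup_le fun k => ?_
    by_cases hk : k = n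
    · subst hk; exact le_sup_left
    · exact ((hle k).trans (le_iSup₂_of_le k hk le_rfl)).trans le_sup_right
  have h2 := hK n
  calc K n = (Z n ⊔ ⨆ k, ⨆ _ : k ≠ n, K k) ⊓ K n := by rw [h1, top_inf_eq]
    _ = Z n ⊔ (⨆ k, ⨆ _ : k ≠ n, K k) ⊓ K n := (sup_inf_assoc_of_le _ (hle n))
    _ ≤ Z n := by rw [inf_comm, h2.eq_bot, sup_bot_eq]

namespace LieSuperAlgebra

variable (g : LieSuperAlgebra)

/-- The homogeneous component of degree `n` of the Koszul module. -/
def kosDeg (n : ℕ) : Submodule ℂ g.Kos := Module.End.eigenspace g.kos.opE (n : ℂ)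

variable {g}

lemma mem_kosDeg {n : ℕ} {m : g.Kos} : m ∈ g.kosDeg n ↔ g.kos.opE m = (n : ℂ) • m :=
  Module.End.mem_eigenspace_iff

lemma vac_mem_kosDeg : g.kvac ∈ g.kosDeg 0 := by
  rw [mem_kosDeg, g.opE_vac]; simp

lemma opI_mem_kosDeg {n : ℕ} (x : g.carrier) {m : g.Kos} (hm : m ∈ g.kosDeg n) :
    g.kos.opI x m ∈ g.kosDeg n := by
  rw [mem_kosDeg] at *
  rw [g.kos.opE_opI, hm, map_smul]

lemma opK_mem_kosDeg {n : ℕ} (x : g.carrier) {m : g.Kos} (hm : m ∈ g.kosDeg n) :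
    g.kos.opK x m ∈ g.kosDeg (n + 1) := by
  rw [mem_kosDeg] at *
  rw [g.kos.opE_opK, hm, map_smul]
  push_cast
  rw [add_smul, one_smul]

lemma σ_mem_kosDeg {n : ℕ} {m : g.Kos} (hm : m ∈ g.kosDeg n) : g.kos.σ m ∈ g.kosDeg n := by
  rw [mem_kosDeg] at *
  rw [← g.kos.σ_opE, hm, map_smul]

lemma opD_mem_kosDeg {n : ℕ} {m : g.Kos} (hm : m ∈ g.kosDeg (n + 1)) :
    g.kos.opD m ∈ g.kosDeg n := by
  rw [mem_kosDeg] at *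
  rw [g.kos.opE_opD, hm, map_smul]
  push_cast
  rw [add_smul, one_smul, add_sub_cancel_right]

lemma iSupIndep_kosDeg : iSupIndep g.kosDeg :=
  (Module.End.eigenspaces_iSupIndep g.kos.opE).comp (f := fun n : ℕ => (n : ℂ)) Nat.cast_injective

variable (g) in
lemma iSup_kosDeg : ⨆ n, g.kosDeg n = ⊤ := by
  refine kos_eq_top (Submodule.mem_iSup_of_mem 0 vac_mem_kosDeg) (fun v _ m hm => ?_)
    (fun v _ m hm => ?_)
  · refine Submodule.iSup_induction _ (motive := fun m => g.kos.opI v m ∈ ⨆ n, g.kosDeg n) hm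
      (fun n m hm => Submodule.mem_iSup_of_mem n (opI_mem_kosDeg v hm)) (by simp) ?_
    intro m m' h h'
    rw [map_add]; exact add_mem h h'
  · refine Submodule.iSup_induction _ (motive := fun m => g.kos.opK v m ∈ ⨆ n, g.kosDeg n) hm
      (fun n m hm => Submodule.mem_iSup_of_mem (n + 1) (opK_mem_kosDeg v hm)) (by simp) ?_
    intro m m' h h'
    rw [map_add]; exact add_mem h h'

lemma opD_eq_zero {m : g.Kos} (hm : m ∈ g.kosDeg 0) : g.kos.opD m = 0 := by
  have h1 : g.kos.opD m ∈ Module.End.eigenspace g.kos.opE (-1) := by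
    rw [mem_kosDeg] at hm
    rw [Module.End.mem_eigenspace_iff, g.kos.opE_opD, hm]
    simp
  have h2 : ⨆ μ, ⨆ _ : μ ≠ (-1 : ℂ), Module.End.eigenspace g.kos.opE μ = ⊤ := by
    rw [eq_top_iff, ← g.iSup_kosDeg]
    refine iSup_le fun n => le_iSup₂_of_le (n : ℂ) ?_ le_rfl
    intro h
    have := congrArg Complex.re h
    simp at this
    linarith [(Nat.cast_nonneg n : (0 : ℝ) ≤ n)]
  have h3 := Module.End.eigenspaces_iSupIndep g.kos.opE (-1)
  rw [h2, disjoint_top] at h3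
  exact (Submodule.mem_bot ℂ).1 (h3 ▸ h1)

/-- Central elements of the even part act diagonalizably on the Koszul module. -/
lemma kosDeg_le_iSup_eigenspace (hg : g.IsClassical) {z : g.carrier} (hz : g.IsEvenCentral z)
    (n : ℕ) : ⨆ μ, g.kosDeg n ⊓ Module.End.eigenspace (g.kos.opI z) μ = g.kosDeg n := by
  refine iSupIndep_eq_of_le
    (Z := fun n => ⨆ μ, g.kosDeg n ⊓ Module.End.eigenspace (g.kos.opI z) μ)
    iSupIndep_kosDeg (fun n => iSup_le fun μ => inf_le_left) ?_ n
  set U := ⨆ n, ⨆ μ, g.kosDeg n ⊓ Module.End.eigenspace (g.kos.opI z) μ with hU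
  have hmem : ∀ {n} {μ : ℂ} {m : g.Kos}, m ∈ g.kosDeg n → g.kos.opI z m = μ • m → m ∈ U := by
    intro n μ m h1 h2
    exact Submodule.mem_iSup_of_mem n (Submodule.mem_iSup_of_mem μ
      ⟨h1, Module.End.mem_eigenspace_iff.2 h2⟩)
  have hstep : ∀ T : g.carrier →ₗ[ℂ] Module.End ℂ g.Kos,
      (∀ n (μ ν : ℂ) v, v ∈ g.part 1 → g.bracket z v = ν • v → ∀ m ∈ g.kosDeg n,
        g.kos.opI z m = μ • m → T v m ∈ U) → ∀ v ∈ g.part 1, ∀ m ∈ U, T v m ∈ U := by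
    intro T hT v hv m hm
    have hm' : U ≤ U.comap (T v) := by
      refine iSup_le fun n => iSup_le fun μ => ?_
      rintro m ⟨h1, h2⟩
      rw [SetLike.mem_coe, Module.End.mem_eigenspace_iff] at h2
      have hv' : g.part 1 ≤ U.comap (T.flip m) := by
        refine (hg.odd_le_iSup_eigenspace hz).trans (iSup_le fun ν => ?_)
        rintro w ⟨hw1, hw2⟩
        exact hT n μ ν w hw1 (Module.End.mem_eigenspace_iff.1 hw2) m h1 h2
      exact hv' hv
    exact hm' hm
  refine kos_eq_top (hmem (n := 0) (μ := 0) vac_mem_kosDeg (by rw [opI_vac hz.1, zero_smul])) ?_ ?_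
  · refine hstep g.kos.opI fun n μ ν v hv hzv m hm hzm => ?_
    refine hmem (n := n) (μ := ν + μ) (opI_mem_kosDeg v hm) ?_
    have h := g.kos.opI_bracket m hz.1 hv
    rw [ssgn_zero_left, one_smul, eq_sub_iff_add_eq, hzv, hzm, map_smul, map_smul] at h
    rw [← h, add_smul]; rfl
  · refine hstep g.kos.opK fun n μ ν v hv hzv m hm hzm => ?_
    refine hmem (n := n + 1) (μ := ν + μ) (opK_mem_kosDeg v hm) ?_
    have h := g.kos.opK_bracket m hz.1 hv
    rw [ssgn_zero_left, ssgn_zero_left, one_smul, one_smul, eq_sub_iff_add_eq, hzv, hzm,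
      map_smul, map_smul] at h
    rw [← h, add_smul]; rfl

end LieSuperAlgebra

/-! ### Dimensions of the homogeneous components of the Koszul module -/

namespace LieSuperAlgebra

variable {g : LieSuperAlgebra} (v : ℕ → g.carrier)

/-- The span of the monomials of degree `n` in the first `j` commuting operators of `εg₁`. -/
def symPart : ℕ → ℕ → Submodule ℂ g.Kos
  | 0, 0 => ℂ ∙ g.kvac
  | 0, _ + 1 => ⊥
  | j + 1, 0 => symPart j 0
  | j + 1, n + 1 => symPart j (n + 1) ⊔ (symPart (j + 1) n).map (g.kos.opK (v j))
  termination_by j n => (j, n)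

lemma symPart_zero_zero : symPart v 0 0 = ℂ ∙ g.kvac := by rw [symPart]

lemma symPart_zero_succ (n : ℕ) : symPart v 0 (n + 1) = ⊥ := by rw [symPart]

lemma symPart_succ_zero (j : ℕ) : symPart v (j + 1) 0 = symPart v j 0 := by rw [symPart]

lemma symPart_succ_succ (j n : ℕ) : symPart v (j + 1) (n + 1) =
    symPart v j (n + 1) ⊔ (symPart v (j + 1) n).map (g.kos.opK (v j)) := by
  rw [symPart]

lemma symPart_finrank (j n : ℕ) : FiniteDimensional ℂ (symPart v j n) ∧
    finrank ℂ (symPart v j n) ≤ Nat.multichoose j n := by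
  induction j generalizing n with
  | zero =>
    cases n with
    | zero =>
      rw [symPart_zero_zero]
      exact ⟨inferInstance, (finrank_span_le_card _).trans (by simp)⟩
    | succ n =>
      rw [symPart_zero_succ]
      exact ⟨inferInstance, by simp⟩
  | succ j ih =>
    induction n with
    | zero =>
      rw [symPart_succ_zero]
      exact ⟨(ih 0).1, (ih 0).2.trans (by simp)⟩
    | succ n ihn =>
      rw [symPart_succ_succ, Nat.multichoose_succ_succ]
      have := (ih (n + 1)).1
      have := ihn.1
      refine ⟨inferInstance, (Submodule.finrank_add_le_finrank_add_finrank _ _).trans ?_⟩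
      exact add_le_add (ih (n + 1)).2 ((Submodule.finrank_map_le _ _).trans ihn.2)

lemma symPart_le_kosDeg (j n : ℕ) : symPart v j n ≤ g.kosDeg n := by
  induction j generalizing n with
  | zero =>
    cases n with
    | zero =>
      rw [symPart_zero_zero]
      exact (Submodule.span_singleton_le_iff_mem _ _).2 vac_mem_kosDeg
    | succ n => rw [symPart_zero_succ]; exact bot_le
  | succ j ih =>
    induction n with
    | zero => rw [symPart_succ_zero]; exact ih 0
    | succ n ihn =>
      rw [symPart_succ_succ]
      exact sup_le (ih _) (Submodule.map_le_iff_le_comap.2 fun m hm => opK_mem_kosDeg _ (ihn hm))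

section

variable {v}

lemma symPart_le_filt (hv : ∀ j, v j ∈ g.part 1) (j n : ℕ) : symPart v j n ≤ g.filt (n + 1) := by
  induction j generalizing n with
  | zero =>
    cases n with
    | zero =>
      rw [symPart_zero_zero]
      exact (Submodule.span_singleton_le_iff_mem _ _).2 (g.vac_mem_filt 0)
    | succ n => rw [symPart_zero_succ]; exact bot_le
  | succ j ih =>
    induction n with
    | zero => rw [symPart_succ_zero]; exact ih 0
    | succ n ihn =>
      rw [symPart_succ_succ]
      exact sup_le (ih _) (Submodule.map_le_iff_le_comap.2 fun m hm =>
        opK_mem_filt (hv j) (ihn hm))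

lemma opK_mem_symPart (hv : ∀ j, v j ∈ g.part 1) {i j : ℕ} (hij : i < j) (n : ℕ) :
    symPart v j n ≤ (symPart v j (n + 1)).comap (g.kos.opK (v i)) := by
  induction j generalizing n with
  | zero => exact absurd hij (Nat.not_lt_zero _)
  | succ j ih =>
    rcases Nat.lt_succ_iff_lt_or_eq.1 hij with h | rfl
    · induction n with
      | zero =>
        rw [symPart_succ_zero, symPart_succ_succ]
        exact (ih h 0).trans (Submodule.comap_mono le_sup_left)
      | succ n ihn =>
        rw [symPart_succ_succ v j n]
        refine sup_le ?_ (Submodule.map_le_iff_le_comap.2 fun m hm => ?_)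
        · rw [symPart_succ_succ v j (n + 1)]
          exact (ih h (n + 1)).trans (Submodule.comap_mono le_sup_left)
        · rw [Submodule.mem_comap, Submodule.mem_comap, opK_comm (hv i) (hv j),
            symPart_succ_succ v j (n + 1)]
          exact Submodule.mem_sup_right (Submodule.mem_map_of_mem (ihn hm))
    · rw [symPart_succ_succ]
      exact fun m hm => Submodule.mem_sup_right (Submodule.mem_map_of_mem hm)

end

variable (d : ℕ)

/-- The span of the ordered monomials of length less than `p`, in all the commuting operators
of `εg₁` and the first `j` odd operators of `g`. -/
def ordPart : ℕ → ℕ → Submodule ℂ g.Kos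
  | 0, p => ⨆ n, ⨆ _ : n < p, symPart v d n
  | _ + 1, 0 => ⊥
  | j + 1, p + 1 => ordPart j (p + 1) ⊔ (ordPart j p).map (g.kos.opI (v j))

lemma symPart_le_ordPart {n p : ℕ} (h : n < p) : symPart v d n ≤ ordPart v d 0 p :=
  le_iSup₂_of_le (f := fun n (_ : n < p) => symPart v d n) n h le_rfl

lemma ordPart_mono_succ (j p : ℕ) : ordPart v d j p ≤ ordPart v d j (p + 1) := by
  induction j generalizing p with
  | zero => exact iSup₂_le fun n hn => symPart_le_ordPart v d (hn.trans (Nat.lt_succ_self p))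
  | succ j ih =>
    cases p with
    | zero => exact bot_le
    | succ p => exact sup_le_sup (ih _) (Submodule.map_mono (ih _))

lemma vac_mem_ordPart (j p : ℕ) : g.kvac ∈ ordPart v d j (p + 1) := by
  induction j with
  | zero =>
    refine symPart_le_ordPart v d (Nat.succ_pos p) ?_
    induction d with
    | zero => rw [symPart_zero_zero]; exact Submodule.mem_span_singleton_self _
    | succ d ih => rwa [symPart_succ_zero]
  | succ j ih => exact Submodule.mem_sup_left ih

/-- The span of the ordered monomials of degree `n`. -/
def degPart : ℕ → ℕ → Submodule ℂ g.Kos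
  | 0, n => symPart v d n
  | j + 1, n => degPart j n ⊔ (degPart j n).map (g.kos.opI (v j))

lemma degPart_le_kosDeg (j n : ℕ) : degPart v d j n ≤ g.kosDeg n := by
  induction j with
  | zero => exact symPart_le_kosDeg v d n
  | succ j ih =>
    exact sup_le ih (Submodule.map_le_iff_le_comap.2 fun m hm => opI_mem_kosDeg _ (ih hm))

lemma degPart_finrank (j n : ℕ) : FiniteDimensional ℂ (degPart v d j n) ∧
    finrank ℂ (degPart v d j n) ≤ 2 ^ j * Nat.multichoose d n := by
  induction j with
  | zero =>
    rw [pow_zero, one_mul]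
    exact symPart_finrank v d n
  | succ j ih =>
    have := ih.1
    rw [degPart]
    refine ⟨inferInstance, (Submodule.finrank_add_le_finrank_add_finrank _ _).trans ?_⟩
    have h := (Submodule.finrank_map_le (g.kos.opI (v j)) (degPart v d j n)).trans ih.2
    have h' := ih.2
    rw [pow_succ]
    linarith

lemma ordPart_le_degPart (j p : ℕ) : ordPart v d j p ≤ ⨆ n, degPart v d j n := by
  induction j generalizing p with
  | zero => exact iSup₂_le fun n _ => le_iSup (fun n => degPart v d 0 n) n
  | succ j ih =>
    cases p with
    | zero => exact bot_le
    | succ p =>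
      refine sup_le ((ih _).trans (iSup_mono fun n => le_sup_left)) ?_
      refine (Submodule.map_mono (ih p)).trans ?_
      rw [Submodule.map_iSup]
      exact iSup_mono fun n => le_sup_right

section

variable {v}

lemma ordPart_le_filt (hv : ∀ j, v j ∈ g.part 1) (j p : ℕ) : ordPart v d j p ≤ g.filt p := by
  induction j generalizing p with
  | zero => exact iSup₂_le fun n hn => (symPart_le_filt hv d n).trans (g.filt_mono hn)
  | succ j ih =>
    cases p with
    | zero => exact bot_le
    | succ p =>
      exact sup_le (ih _)
        (Submodule.map_le_iff_le_comap.2 fun m hm => opI_mem_filt (hv j) (ih p hm))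

lemma opI_sup_mem (hv : ∀ j, v j ∈ g.part 1) {j p : ℕ} {m : g.Kos}
    (hm : m ∈ ordPart v d j (p + 1) ⊔ g.filt p) :
    g.kos.opI (v j) m ∈ ordPart v d (j + 1) (p + 2) ⊔ g.filt (p + 1) := by
  obtain ⟨a, ha, b, hb, rfl⟩ := Submodule.mem_sup.1 hm
  rw [map_add]
  exact add_mem (Submodule.mem_sup_left (Submodule.mem_sup_right (Submodule.mem_map_of_mem ha)))
    (Submodule.mem_sup_right (opI_mem_filt (hv j) hb))

lemma opK_mem_ordPart (hv : ∀ j, v j ∈ g.part 1) {i : ℕ} (hi : i < d) (j p : ℕ) :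
    ordPart v d j p ≤ (ordPart v d j (p + 1) ⊔ g.filt p).comap (g.kos.opK (v i)) := by
  induction j generalizing p with
  | zero =>
    refine iSup₂_le fun n hn => (opK_mem_symPart hv hi n).trans (Submodule.comap_mono ?_)
    exact (symPart_le_ordPart v d (Nat.succ_lt_succ hn)).trans le_sup_left
  | succ j ih =>
    cases p with
    | zero => exact bot_le
    | succ p =>
      refine sup_le ((ih (p + 1)).trans (Submodule.comap_mono (sup_le_sup_right le_sup_left _))) ?_
      refine Submodule.map_le_iff_le_comap.2 fun u hu => ?_
      rw [Submodule.mem_comap, Submodule.mem_comap]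
      have h1 := opI_opK_mem_filt (hv j) (hv i) (ordPart_le_filt d hv j p hu)
      have h2 := opI_sup_mem d hv (ih p hu)
      rw [← sub_sub_cancel (g.kos.opI (v j) (g.kos.opK (v i) u))
        (g.kos.opK (v i) (g.kos.opI (v j) u))]
      exact sub_mem h2 (Submodule.mem_sup_right (g.filt_mono_succ p h1))

lemma opI_mem_ordPart (hv : ∀ j, v j ∈ g.part 1) {i j : ℕ} (hij : i < j) (p : ℕ) :
    ordPart v d j p ≤ (ordPart v d j (p + 1) ⊔ g.filt p).comap (g.kos.opI (v i)) := by
  induction j generalizing p with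
  | zero => exact absurd hij (Nat.not_lt_zero _)
  | succ j ih =>
    cases p with
    | zero => exact bot_le
    | succ p =>
      rcases Nat.lt_succ_iff_lt_or_eq.1 hij with h | rfl
      · refine sup_le ((ih h (p + 1)).trans
          (Submodule.comap_mono (sup_le_sup_right le_sup_left _))) ?_
        refine Submodule.map_le_iff_le_comap.2 fun u hu => ?_
        rw [Submodule.mem_comap, Submodule.mem_comap]
        have h1 := opI_opI_mem_filt (hv i) (hv j) (ordPart_le_filt d hv j p hu)
        have h2 := opI_sup_mem d hv (ih h p hu)
        rw [← add_sub_cancel_right (g.kos.opI (v i) (g.kos.opI (v j) u))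
          (g.kos.opI (v j) (g.kos.opI (v i) u))]
        exact sub_mem (Submodule.mem_sup_right (g.filt_mono_succ p h1)) h2
      · refine sup_le (fun u hu => ?_) (Submodule.map_le_iff_le_comap.2 fun u hu => ?_)
        · exact Submodule.mem_sup_left (Submodule.mem_sup_right (Submodule.mem_map_of_mem hu))
        · have h1 := opI_opI_mem_filt (hv i) (hv i) (ordPart_le_filt d hv i p hu)
          rw [← two_smul ℂ] at h1
          rw [Submodule.mem_comap, Submodule.mem_comap]
          exact Submodule.mem_sup_right (g.filt_mono_succ p
            ((Submodule.smul_mem_iff _ two_ne_zero).1 h1))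

variable {d}

lemma filt_le_ordPart (hv : ∀ j, v j ∈ g.part 1)
    (hspan : g.part 1 ≤ Submodule.span ℂ (v '' Set.Iio d)) (p : ℕ) :
    g.filt p ≤ ordPart v d d p := by
  induction p with
  | zero => exact bot_le
  | succ p ih =>
    have key : ∀ T : g.carrier →ₗ[ℂ] Module.End ℂ g.Kos,
        (∀ i < d, ordPart v d d p ≤ (ordPart v d d (p + 1) ⊔ g.filt p).comap (T (v i))) →
        ∀ w ∈ g.part 1, ∀ m ∈ g.filt p, T w m ∈ ordPart v d d (p + 1) := by
      intro T hT w hw m hm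
      have h1 : Submodule.span ℂ (v '' Set.Iio d) ≤
          (ordPart v d d (p + 1) ⊔ g.filt p).comap (T.flip m) := by
        rw [Submodule.span_le]
        rintro _ ⟨i, hi, rfl⟩
        exact hT i hi (ih hm)
      have h2 := h1 (hspan hw)
      rwa [sup_eq_left.2 (ih.trans (ordPart_mono_succ v d d p))] at h2
    exact g.filt_succ_le (vac_mem_ordPart v d d p)
      (key g.kos.opI fun i hi => opI_mem_ordPart d hv hi p)
      (key g.kos.opK fun i hi => opK_mem_ordPart d hv hi d p)

lemma degPart_eq_kosDeg (hv : ∀ j, v j ∈ g.part 1)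
    (hspan : g.part 1 ≤ Submodule.span ℂ (v '' Set.Iio d)) (n : ℕ) :
    degPart v d d n = g.kosDeg n := by
  refine iSupIndep_eq_of_le (Z := degPart v d d) iSupIndep_kosDeg (degPart_le_kosDeg v d d) ?_ n
  rw [eq_top_iff]
  intro m _
  obtain ⟨p, hp⟩ := exists_mem_filt m
  exact ordPart_le_degPart v d d p (filt_le_ordPart hv hspan p hp)

end

lemma kosDeg_finrank [FiniteDimensional ℂ g.carrier] (n : ℕ) :
    FiniteDimensional ℂ (g.kosDeg n) ∧ finrank ℂ (g.kosDeg n) ≤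
      2 ^ finrank ℂ (g.part 1) * Nat.multichoose (finrank ℂ (g.part 1)) n := by
  set d := finrank ℂ (g.part 1) with hd
  let b := Module.finBasis ℂ (g.part 1)
  let v : ℕ → g.carrier := fun j => if h : j < d then (b ⟨j, h⟩ : g.carrier) else 0
  have hv : ∀ j, v j ∈ g.part 1 := by
    intro j
    by_cases h : j < d
    · simp only [v, dif_pos h]; exact Submodule.coe_mem _
    · simp only [v, dif_neg h]; exact zero_mem _
  have hspan : g.part 1 ≤ Submodule.span ℂ (v '' Set.Iio d) := by
    have h1 : (Submodule.span ℂ (Set.range b)).map (g.part 1).subtype = g.part 1 := by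
      rw [b.span_eq, Submodule.map_subtype_top]
    rw [← h1, Submodule.map_span]
    refine Submodule.span_mono ?_
    rintro _ ⟨_, ⟨i, rfl⟩, rfl⟩
    exact ⟨i, i.2, by simp only [v]; rw [dif_pos i.2]; rfl⟩
  rw [← degPart_eq_kosDeg hv hspan n]
  exact degPart_finrank v d d n

end LieSuperAlgebra

/-! ### Representations on spaces of linear maps; faithfulness of the odd part -/

namespace SRep

variable {g : LieSuperAlgebra} {N₁ N₂ : Type*} [AddCommGroup N₁] [Module ℂ N₁]
  [AddCommGroup N₂] [Module ℂ N₂]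

/-- The action on the space of linear maps between two representations. -/
def homAct (R₁ : SRep g.bracketData N₁) (R₂ : SRep g.bracketData N₂) :
    g.carrier →ₗ[ℂ] Module.End ℂ (N₁ →ₗ[ℂ] N₂) where
  toFun x :=
    { toFun := fun φ => R₂.act x ∘ₗ φ - φ ∘ₗ R₁.act (g.projEven x)
        - R₂.σ ∘ₗ φ ∘ₗ R₁.σ ∘ₗ R₁.act (g.projOdd x)
      map_add' := fun φ ψ => by ext m; simp; abel
      map_smul' := fun c φ => by ext m; simp [smul_sub] }
  map_add' x y := by ext φ m; simp; abel
  map_smul' c x := by ext φ m; simp [smul_sub]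

lemma homAct_even (R₁ : SRep g.bracketData N₁) (R₂ : SRep g.bracketData N₂) {x : g.carrier}
    (hx : x ∈ g.part 0) (φ : N₁ →ₗ[ℂ] N₂) (m : N₁) :
    homAct R₁ R₂ x φ m = R₂.act x (φ m) - φ (R₁.act x m) := by
  simp [homAct, g.projEven_of_even hx, g.projOdd_of_even hx]

lemma homAct_odd (R₁ : SRep g.bracketData N₁) (R₂ : SRep g.bracketData N₂) {x : g.carrier}
    (hx : x ∈ g.part 1) (φ : N₁ →ₗ[ℂ] N₂) (m : N₁) :
    homAct R₁ R₂ x φ m = R₂.act x (φ m) - R₂.σ (φ (R₁.σ (R₁.act x m))) := by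
  simp [homAct, g.projEven_of_odd hx, g.projOdd_of_odd hx]

lemma homAct_apply (R₁ : SRep g.bracketData N₁) (R₂ : SRep g.bracketData N₂) {i : ZMod 2}
    {x : g.carrier} (hx : x ∈ g.part i) (φ : N₁ →ₗ[ℂ] N₂) (m : N₁) :
    homAct R₁ R₂ x φ m = R₂.act x (φ m) - R₂.sg i (φ (R₁.sg i (R₁.act x m))) := by
  rcases zmodTwo_cases i with rfl | rfl
  · simp [homAct_even R₁ R₂ hx]
  · simp [homAct_odd R₁ R₂ hx]

lemma sg_act (R : SRep g.bracketData N₁) {i : ZMod 2} {x : g.carrier} (hx : x ∈ g.part i)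
    (j : ZMod 2) (m : N₁) : R.sg j (R.act x m) = ssgn i j • R.act x (R.sg j m) :=
  LinearMap.congr_fun (R.sg_comm (B := g.bracketData) hx j) m

lemma sg_sg (R : SRep g.bracketData N₁) (i j : ZMod 2) (m : N₁) :
    R.sg i (R.sg j m) = R.sg (i + j) m := LinearMap.congr_fun (R.sg_mul i j) m

/-- The representation on the space of linear maps between two representations. -/
def hom (R₁ : SRep g.bracketData N₁) (R₂ : SRep g.bracketData N₂) :
    SRep g.bracketData (N₁ →ₗ[ℂ] N₂) :=
  ofAct ((LinearMap.llcomp ℂ N₁ N₂ N₂ R₂.σ) ∘ₗ (LinearMap.lcomp ℂ N₂ R₁.σ)) (homAct R₁ R₂)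
    (fun φ => by ext m; simp [R₁.σσ, R₂.σσ])
    (fun i x hx φ => by
      ext m
      simp only [LinearMap.coe_comp, Function.comp_apply, LinearMap.llcomp_apply,
        LinearMap.lcomp_apply, LinearMap.smul_apply, homAct_apply R₁ R₂ hx, map_sub, R₂.σ_act hx,
        smul_sub]
      rcases zmodTwo_cases i with rfl | rfl
      · simp [R₁.σ_act hx]
      · simp [R₁.σ_act hx, R₁.σσ, R₂.σσ])
    (fun i j x hx y hy φ => by
      ext m
      simp only [LinearMap.smul_apply, LinearMap.sub_apply, homAct_apply R₁ R₂ hx,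
        homAct_apply R₁ R₂ hy, homAct_apply R₁ R₂ (g.bracket_grading _ _ _ hx _ hy), map_sub,
        R₂.act_bracket hx hy, R₁.act_bracket hx hy, map_smul, sg_act _ hx, sg_act _ hy, sg_sg,
        smul_sub, smul_smul, ssgn_comm j i, add_comm j i]
      rcases zmodTwo_cases i with rfl | rfl <;> rcases zmodTwo_cases j with rfl | rfl <;>
        simp [zmodTwo_one_add_one] <;> abel)

lemma hom_σ (R₁ : SRep g.bracketData N₁) (R₂ : SRep g.bracketData N₂) (φ : N₁ →ₗ[ℂ] N₂) (m : N₁) :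
    (hom R₁ R₂).σ φ m = R₂.σ (φ (R₁.σ m)) := rfl

lemma hom_act_even (R₁ : SRep g.bracketData N₁) (R₂ : SRep g.bracketData N₂) {x : g.carrier}
    (hx : x ∈ g.part 0) (φ : N₁ →ₗ[ℂ] N₂) (m : N₁) :
    (hom R₁ R₂).act x φ m = R₂.act x (φ m) - φ (R₁.act x m) := homAct_even R₁ R₂ hx φ m

lemma hom_act_odd (R₁ : SRep g.bracketData N₁) (R₂ : SRep g.bracketData N₂) {x : g.carrier}
    (hx : x ∈ g.part 1) (φ : N₁ →ₗ[ℂ] N₂) (m : N₁) :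
    (hom R₁ R₂).act x φ m = R₂.act x (φ m) - R₂.σ (φ (R₁.σ (R₁.act x m))) :=
  homAct_odd R₁ R₂ hx φ m

/-- The direct sum of two representations. -/
def prod (R₁ : SRep g.bracketData N₁) (R₂ : SRep g.bracketData N₂) :
    SRep g.bracketData (N₁ × N₂) :=
  ofAct (R₁.σ.prodMap R₂.σ)
    { toFun := fun x => (R₁.act x).prodMap (R₂.act x)
      map_add' := fun x y => by ext <;> simp
      map_smul' := fun c x => by ext <;> simp }
    (fun m => by simp [R₁.σσ, R₂.σσ])
    (fun i x hx m => by simp [R₁.σ_act hx, R₂.σ_act hx])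
    (fun i j x hx y hy m => by simp [R₁.act_bracket hx hy, R₂.act_bracket hx hy])

/-- The adjoint representation. -/
def adjoint (g : LieSuperAlgebra) : SRep g.bracketData g.carrier :=
  ofAct g.pty g.bracket g.pty_pty
    (fun i x hx m => by
      refine g.induction_homogeneous
        (p := fun m => g.pty (g.bracket x m) = ssgn 1 i • g.bracket x (g.pty m))
        (fun y hy => ?_) (fun y hy => ?_) (fun y y' h h' => ?_) m
      · rw [g.pty_of_even hy, pty_mem (g.bracket_grading _ _ _ hx _ hy), add_zero]
      · rw [g.pty_of_odd hy, pty_mem (g.bracket_grading _ _ _ hx _ hy), ssgn_add_one]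
        simp
      · rw [map_add, map_add, h, h', map_add, map_add, smul_add])
    (fun i j x hx y hy m => by
      refine g.induction_homogeneous
        (p := fun m => g.bracket (g.bracket x y) m =
          g.bracket x (g.bracket y m) - ssgn i j • g.bracket y (g.bracket x m))
        (fun z hz => ?_) (fun z hz => ?_) (fun z z' h h' => ?_) m
      · rw [g.bracket_jacobi _ _ _ _ hx _ hy _ hz, add_sub_cancel_right]
      · rw [g.bracket_jacobi _ _ _ _ hx _ hy _ hz, add_sub_cancel_right]
      · simp only [map_add, h, h', smul_add]; abel)

/-- A two-step representation attached to a linear map vanishing on brackets. -/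
def twoStep (lam : g.carrier →ₗ[ℂ] g.carrier) (h0 : ∀ x ∈ g.part 0, lam x = 0)
    (hb : ∀ i j, ∀ x ∈ g.part i, ∀ y ∈ g.part j, lam (g.bracket x y) = 0) :
    SRep g.bracketData (ℂ × g.carrier) :=
  ofAct (LinearMap.prodMap LinearMap.id (-LinearMap.id))
    { toFun := fun x => LinearMap.inr ℂ ℂ g.carrier ∘ₗ
        LinearMap.toSpanSingleton ℂ _ (lam x) ∘ₗ LinearMap.fst ℂ ℂ g.carrier
      map_add' := fun x y => by ext <;> simp
      map_smul' := fun c x => by ext <;> simp }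
    (fun m => by simp)
    (fun i x hx m => by
      rcases zmodTwo_cases i with rfl | rfl
      · simp [h0 x hx]
      · simp)
    (fun i j x hx y hy m => by simp [hb i j x hx y hy])

end SRep

namespace LieSuperAlgebra

variable {g : LieSuperAlgebra}

/-- The odd elements commuting with everything. -/
def oddCenter (g : LieSuperAlgebra) : Submodule ℂ g.carrier :=
  g.part 1 ⊓ LinearMap.ker g.bracket

lemma bracket_oddCenter_right {i : ZMod 2} {x v : g.carrier} (hx : x ∈ g.part i)
    (hv : v ∈ g.oddCenter) : g.bracket x v = 0 := by
  rw [g.bracket_skew _ _ _ hx _ hv.1, LinearMap.mem_ker.1 hv.2]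
  simp

/-- A projection of `g` onto the odd center which vanishes on all brackets. -/
lemma exists_oddCenter_proj (hg : g.IsClassical) : ∃ lam : g.carrier →ₗ[ℂ] g.carrier,
    (∀ x ∈ g.part 0, lam x = 0) ∧ (∀ v ∈ g.oddCenter, lam v = v) ∧
    ∀ i j, ∀ x ∈ g.part i, ∀ y ∈ g.part j, lam (g.bracket x y) = 0 := by
  obtain ⟨C, hC1, hCst, hinf, hsup⟩ := hg.odd_reducible g.oddCenter inf_le_left
    (fun x hx y hy => by rw [bracket_oddCenter_right hx hy]; exact zero_mem _)
  have hcompl : IsCompl g.oddCenter (g.part 0 ⊔ C) := by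
    constructor
    · rw [Submodule.disjoint_def]
      intro v hv hv'
      obtain ⟨a, ha, c, hc, rfl⟩ := Submodule.mem_sup.1 hv'
      have ha' : a ∈ g.part 1 := by
        have := sub_mem hv.1 (hC1 hc)
        rwa [add_sub_cancel_right] at this
      have ha0 := Submodule.disjoint_def.1 g.isCompl.disjoint a ha ha'
      rw [ha0, zero_add] at hv ⊢
      exact (Submodule.mem_bot ℂ).1 (hinf ▸ ⟨hv, hc⟩)
    · rw [codisjoint_iff, sup_left_comm, hsup]
      exact g.isCompl.sup_eq_top
  have hright : ∀ v ∈ g.part 0 ⊔ C, ((g.oddCenter.projectionOnto (g.part 0 ⊔ C) hcompl v :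
      g.oddCenter) : g.carrier) = 0 := fun v hv => by
    rw [Submodule.projectionOnto_apply_of_mem_right hcompl hv]; rfl
  refine ⟨g.oddCenter.subtype ∘ₗ g.oddCenter.projectionOnto (g.part 0 ⊔ C) hcompl, ?_, ?_, ?_⟩
  · exact fun x hx => hright x (Submodule.mem_sup_left hx)
  · exact fun v hv => congrArg Subtype.val (Submodule.projectionOnto_apply_left hcompl ⟨v, hv⟩)
  · have hmixed : ∀ x ∈ g.part 0, ∀ y ∈ g.part 1, g.bracket x y ∈ g.part 0 ⊔ C := by
      intro x hx y hy
      rw [← hsup] at hy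
      obtain ⟨z, hz, c, hc, rfl⟩ := Submodule.mem_sup.1 hy
      rw [map_add, bracket_oddCenter_right hx hz, zero_add]
      exact Submodule.mem_sup_right (hCst x hx c hc)
    intro i j x hx y hy
    refine hright _ ?_
    rcases zmodTwo_cases i with rfl | rfl <;> rcases zmodTwo_cases j with rfl | rfl
    · exact Submodule.mem_sup_left (by simpa using g.bracket_grading _ _ _ hx _ hy)
    · exact hmixed x hx y hy
    · rw [g.bracket_skew _ _ _ hx _ hy]
      exact Submodule.smul_mem _ _ (hmixed y hy x hx)
    · exact Submodule.mem_sup_left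
        (by simpa [zmodTwo_one_add_one] using g.bracket_grading _ _ _ hx _ hy)

/-- There is a representation with an even vector killed by `g₀` on which `g₁` acts freely. -/
lemma exists_faithful_vector (hg : g.IsClassical) :
    ∃ (R : SRep g.bracketData (Module.End ℂ g.carrier × (ℂ × g.carrier)))
      (w : Module.End ℂ g.carrier × (ℂ × g.carrier))
      (θ : (Module.End ℂ g.carrier × (ℂ × g.carrier)) →ₗ[ℂ] g.carrier),
      R.σ w = w ∧ (∀ x ∈ g.part 0, R.act x w = 0) ∧ (∀ a, θ a ∈ g.part 1) ∧
      (∀ a, θ (R.σ a) = - θ a) ∧ ∀ v ∈ g.part 1, θ (R.act v w) = v := by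
  obtain ⟨lam, h0, hlam, hb⟩ := exists_oddCenter_proj hg
  let A := SRep.adjoint g
  let R := (A.hom A).prod (SRep.twoStep lam h0 hb)
  let w : Module.End ℂ g.carrier × (ℂ × g.carrier) := (g.pty, (1, 0))
  have hw : R.σ w = w := by
    refine Prod.ext (LinearMap.ext fun m => ?_) (Prod.ext rfl neg_zero)
    change g.pty (g.pty (g.pty m)) = g.pty m
    rw [g.pty_pty]
  have hact : ∀ x, R.act x w = ((A.hom A).act x g.pty, (0, lam x)) := fun x =>
    Prod.ext rfl (Prod.ext rfl (one_smul ℂ (lam x)))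
  have hw0 : ∀ x ∈ g.part 0, R.act x w = 0 := by
    intro x hx
    rw [hact, h0 x hx]
    refine Prod.ext (LinearMap.ext fun m => ?_) rfl
    change (A.hom A).act x g.pty m = 0
    rw [SRep.hom_act_even A A hx]
    exact sub_eq_zero.2 (A.σ_act_even hx m).symm
  let j : g.part 1 →ₗ[ℂ] Module.End ℂ g.carrier × (ℂ × g.carrier) :=
    R.act.flip w ∘ₗ (g.part 1).subtype
  have hj : LinearMap.ker j = ⊥ := by
    rw [LinearMap.ker_eq_bot']
    rintro ⟨v, hv⟩ hv0
    have hv1 : R.act v w = 0 := hv0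
    rw [hact, Prod.mk_eq_zero, Prod.mk_eq_zero] at hv1
    have hz : v ∈ g.oddCenter := by
      refine ⟨hv, LinearMap.mem_ker.2 (LinearMap.ext fun m => ?_)⟩
      have h := LinearMap.congr_fun hv1.1 (g.pty m)
      rw [SRep.hom_act_odd A A hv] at h
      have h2 : A.act v (g.pty (g.pty m)) - g.pty (g.pty (g.pty (A.act v (g.pty m)))) = 0 := h
      have h3 : g.pty (A.act v (g.pty m)) = - A.act v (g.pty (g.pty m)) := A.σ_act_odd hv _
      rw [g.pty_pty, g.pty_pty, h3, g.pty_pty, sub_neg_eq_add, ← two_smul ℂ] at h2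
      exact (smul_eq_zero.1 h2).resolve_left two_ne_zero
    exact Subtype.ext ((hlam v hz).symm.trans hv1.2.2)
  obtain ⟨l, hl⟩ := LinearMap.exists_leftInverse_of_injective j hj
  refine ⟨R, w, (2⁻¹ : ℂ) • ((g.part 1).subtype ∘ₗ (l - l ∘ₗ R.σ)), hw, hw0, fun a => ?_,
    fun a => ?_, fun v hv => ?_⟩
  · exact Submodule.smul_mem _ _ (Submodule.coe_mem ((l - l ∘ₗ R.σ) a))
  · simp [R.σσ, ← smul_neg]
  · have h1 : l (R.act v w) = ⟨v, hv⟩ := LinearMap.congr_fun hl ⟨v, hv⟩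
    have h2 : R.σ (R.act v w) = - R.act v w := by rw [R.σ_act_odd hv, hw]
    simp only [LinearMap.smul_apply, LinearMap.comp_apply, LinearMap.sub_apply, h2, map_neg, h1,
      Submodule.subtype_apply, sub_neg_eq_add, ← two_smul ℂ]
    rw [Submodule.coe_smul, smul_smul, inv_mul_cancel₀ two_ne_zero, one_smul]

end LieSuperAlgebra

/-! ### Exactness of the Koszul complex -/

open scoped TensorProduct

namespace LieSuperAlgebra

variable {g : LieSuperAlgebra} {N : Type*} [AddCommGroup N] [Module ℂ N]

/-- An even `g₀`-invariant vector `w` of a representation of `g` determines a homomorphism from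
the Koszul module to its tensor product with the dual-number extension. -/
lemma exists_comult (R : SRep g.bracketData N) {w : N} (hσ : R.σ w = w)
    (h0 : ∀ x ∈ g.part 0, R.act x w = 0) :
    ∃ Δ : g.Kos →ₗ[ℂ] (N × N) ⊗[ℂ] g.Kos, Δ g.kvac = (w, 0) ⊗ₜ g.kvac ∧
      (∀ m, Δ (g.kos.σ m) = (R.eps.tensor g.kos).σ (Δ m)) ∧
      ∀ v m, Δ (g.kos.ρ v m) = (R.eps.tensor g.kos).ρ v (Δ m) := by
  refine g.hat.exists_univ_hom (H := g.hatEven) (R.eps.tensor g.kos) ((w, 0) ⊗ₜ g.kvac) ?_ ?_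
  · rw [SRep.tensor_σ, SRep.eps_σ, g.kos_σ_vac, hσ, map_zero, neg_zero]
  · change ∀ v : g.carrier × g.carrier × ℂ × ℂ, v.1 ∈ g.part 0 ∧ v.2.1 ∈ g.part 0 →
      (R.eps.tensor g.kos).ρ v ((w, 0) ⊗ₜ g.kvac) = 0
    rintro v ⟨h1, h2⟩
    rw [SRep.ρ_eq]
    simp only [LinearMap.add_apply, LinearMap.smul_apply]
    rw [SRep.tensor_opI _ _ _ _ h1, SRep.tensor_opK _ _ _ _ h2, SRep.tensor_opD,
      SRep.tensor_opE, SRep.eps_opI, SRep.eps_opK, SRep.eps_opD, SRep.eps_opE, opI_vac h1,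
      opK_vac h2, opD_vac, opE_vac, h0 _ h1, h0 _ h2]
    have h00 : ((0 : N), (0 : N)) = 0 := rfl
    simp [h00]

section homotopy

variable (R : SRep g.bracketData N) (θ : N →ₗ[ℂ] g.carrier)

/-- The contraction of the first tensor factor into `εg`. -/
def contrK : (N × N) ⊗[ℂ] g.Kos →ₗ[ℂ] g.Kos :=
  TensorProduct.lift (g.kos.opK ∘ₗ θ ∘ₗ LinearMap.fst ℂ N N)

/-- The contraction of the first tensor factor into `g ⊕ εg`. -/
def contr : (N × N) ⊗[ℂ] g.Kos →ₗ[ℂ] g.Kos :=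
  TensorProduct.lift (g.kos.opI ∘ₗ θ ∘ₗ LinearMap.fst ℂ N N +
    g.kos.opK ∘ₗ θ ∘ₗ LinearMap.snd ℂ N N)

lemma contrK_tmul (a b : N) (u : g.Kos) : contrK θ ((a, b) ⊗ₜ u) = g.kos.opK (θ a) u := rfl

lemma contr_tmul (a b : N) (u : g.Kos) :
    contr θ ((a, b) ⊗ₜ u) = g.kos.opI (θ a) u + g.kos.opK (θ b) u := rfl

variable {R θ}

lemma opD_contrK (hθ : ∀ a, θ a ∈ g.part 1) (hσ : ∀ a, θ (R.σ a) = - θ a)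
    (t : (N × N) ⊗[ℂ] g.Kos) :
    g.kos.opD (contrK θ t) + contrK θ ((R.eps.tensor g.kos).opD t) = contr θ t := by
  induction t using TensorProduct.induction_on with
  | zero => simp
  | tmul e u =>
    obtain ⟨a, b⟩ := e
    rw [SRep.tensor_opD, SRep.eps_opD, SRep.eps_σ, map_add, contrK_tmul, contrK_tmul, contrK_tmul,
      contr_tmul, g.kos.opD_opK u (hθ a), zmodTwo_one_add_one, ssgn_zero_right, one_smul, hσ,
      map_neg, LinearMap.neg_apply]
    abel
  | add s t hs ht => rw [map_add, map_add, map_add, map_add, map_add, ← hs, ← ht]; abel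

lemma opE_contrK (t : (N × N) ⊗[ℂ] g.Kos) :
    g.kos.opE (contrK θ t) = contrK θ ((R.eps.tensor g.kos).opE t) + contrK θ t := by
  induction t using TensorProduct.induction_on with
  | zero => simp
  | tmul e u =>
    obtain ⟨a, b⟩ := e
    rw [SRep.tensor_opE, SRep.eps_opE, map_add, contrK_tmul, contrK_tmul, contrK_tmul,
      g.kos.opE_opK, map_zero, map_zero, LinearMap.zero_apply, zero_add]
  | add s t hs ht => rw [map_add, map_add, map_add, map_add, hs, ht]; abel

/-- The tensors whose second factor lies in a given step of the filtration. -/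
def tfilt (N : Type*) [AddCommGroup N] [Module ℂ N] (g : LieSuperAlgebra) (p : ℕ) :
    Submodule ℂ ((N × N) ⊗[ℂ] g.Kos) :=
  Submodule.map₂ (TensorProduct.mk ℂ (N × N) g.Kos) ⊤ (g.filt p)

lemma tmul_mem_tfilt {p : ℕ} (e : N × N) {u : g.Kos} (hu : u ∈ g.filt p) :
    e ⊗ₜ u ∈ tfilt N g p := Submodule.apply_mem_map₂ _ Submodule.mem_top hu

lemma tfilt_le {p : ℕ} {S : Submodule ℂ ((N × N) ⊗[ℂ] g.Kos)}
    (h : ∀ (a b : N), ∀ u ∈ g.filt p, (a, b) ⊗ₜ u ∈ S) : tfilt N g p ≤ S :=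
  Submodule.map₂_le.2 fun e _ u hu => h e.1 e.2 u hu

variable {w : N} {Δ : g.Kos →ₗ[ℂ] (N × N) ⊗[ℂ] g.Kos}

/-- The leading term of the comultiplication. -/
lemma comult_sub_mem (hw : R.σ w = w) (h1 : Δ g.kvac = (w, 0) ⊗ₜ g.kvac)
    (hΔ : ∀ v m, Δ (g.kos.ρ v m) = (R.eps.tensor g.kos).ρ v (Δ m)) (p : ℕ) :
    ∀ u ∈ g.filt (p + 1), Δ u - (w, 0) ⊗ₜ u ∈ tfilt N g p := by
  have hI : ∀ x m, Δ (g.kos.opI x m) = (R.eps.tensor g.kos).opI x (Δ m) := fun x m => hΔ _ m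
  have hK : ∀ x m, Δ (g.kos.opK x m) = (R.eps.tensor g.kos).opK x (Δ m) := fun x m => hΔ _ m
  have hS : ∀ p, (∀ u ∈ g.filt p, ∀ v ∈ g.part 1,
      Δ (g.kos.opI v u) - (w, 0) ⊗ₜ g.kos.opI v u ∈ tfilt N g p ∧
      Δ (g.kos.opK v u) - (w, 0) ⊗ₜ g.kos.opK v u ∈ tfilt N g p) →
      ∀ u ∈ g.filt (p + 1), Δ u - (w, 0) ⊗ₜ u ∈ tfilt N g p := by
    intro p h
    refine g.filt_succ_le (S := (tfilt N g p).comap (Δ - TensorProduct.mk ℂ (N × N) g.Kos (w, 0))) ?_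
      (fun v hv m hm => (h m hm v hv).1) (fun v hv m hm => (h m hm v hv).2)
    rw [Submodule.mem_comap, LinearMap.sub_apply, h1, TensorProduct.mk_apply, sub_self]
    exact zero_mem _
  induction p with
  | zero =>
    refine hS 0 fun u hu v hv => ?_
    rw [(Submodule.mem_bot ℂ).1 hu]
    simp
  | succ p ih =>
    refine hS (p + 1) fun u hu v hv => ?_
    have hsub := ih u hu
    have hst : ∀ t ∈ tfilt N g p, (R.eps.tensor g.kos).opI v t ∈ tfilt N g (p + 1) ∧
        (R.eps.tensor g.kos).opK v t ∈ tfilt N g (p + 1) := by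
      have : tfilt N g p ≤ (tfilt N g (p + 1)).comap ((R.eps.tensor g.kos).opI v) ⊓
          (tfilt N g (p + 1)).comap ((R.eps.tensor g.kos).opK v) := by
        refine tfilt_le fun a b u hu => ⟨?_, ?_⟩
        · change _ ∈ tfilt N g (p + 1)
          rw [SRep.tensor_opI _ _ _ _ hv]
          exact add_mem (tmul_mem_tfilt _ (g.filt_mono_succ p hu))
            (tmul_mem_tfilt _ (opI_mem_filt hv hu))
        · change _ ∈ tfilt N g (p + 1)
          rw [SRep.tensor_opK _ _ _ _ hv]
          exact add_mem (tmul_mem_tfilt _ (g.filt_mono_succ p hu))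
            (tmul_mem_tfilt _ (opK_mem_filt hv hu))
      exact fun t ht => ⟨(this ht).1, (this ht).2⟩
    obtain ⟨t, ht, hΔu⟩ : ∃ t ∈ tfilt N g p, Δ u = (w, 0) ⊗ₜ u + t :=
      ⟨_, hsub, by abel⟩
    constructor
    · rw [hI, hΔu, map_add, SRep.tensor_opI _ _ _ _ hv, SRep.sg_one, SRep.eps_σ, hw, map_zero,
        neg_zero, add_assoc, add_sub_assoc, add_sub_cancel_left]
      exact add_mem (tmul_mem_tfilt _ hu) (hst t ht).1
    · rw [hK, hΔu, map_add, SRep.tensor_opK _ _ _ _ hv, zmodTwo_one_add_one, SRep.sg_zero,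
        Module.End.one_apply, add_assoc, add_sub_assoc, add_sub_cancel_left]
      exact add_mem (tmul_mem_tfilt _ hu) (hst t ht).2

end homotopy

end LieSuperAlgebra

namespace LieSuperAlgebra

open scoped TensorProduct

variable {g : LieSuperAlgebra} {N : Type*} [AddCommGroup N] [Module ℂ N]

section homotopy

variable {R : SRep g.bracketData N} {θ : N →ₗ[ℂ] g.carrier} {v : g.carrier}

lemma contr_opI_tmul (hv : v ∈ g.part 1) (hσ : ∀ a, θ (R.σ a) = - θ a) (a b : N) (m : g.Kos) :
    contr θ ((R.eps.tensor g.kos).opI v ((a, b) ⊗ₜ m)) =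
      g.kos.opI (θ (R.act v a)) m - g.kos.opK (θ (R.act v b)) m -
        g.kos.opI (θ a) (g.kos.opI v m) + g.kos.opK (θ b) (g.kos.opI v m) := by
  rw [SRep.tensor_opI _ _ _ _ hv, SRep.sg_one, SRep.eps_σ, SRep.eps_opI, map_add, contr_tmul,
    contr_tmul, hσ, map_neg θ, hσ, g.toSuperVS.pty_of_odd hv]
  simp only [map_neg, LinearMap.neg_apply, neg_neg]
  abel

lemma contr_opK_tmul (hv : v ∈ g.part 1) (a b : N) (m : g.Kos) :
    contr θ ((R.eps.tensor g.kos).opK v ((a, b) ⊗ₜ m)) =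
      g.kos.opK (θ (R.act v a)) m + g.kos.opI (θ a) (g.kos.opK v m) +
        g.kos.opK (θ b) (g.kos.opK v m) := by
  rw [SRep.tensor_opK _ _ _ _ hv, zmodTwo_one_add_one, SRep.sg_zero, SRep.eps_opK, map_add,
    contr_tmul, Module.End.one_apply, contr_tmul, map_zero, map_zero,
    LinearMap.zero_apply, zero_add]
  abel

lemma contr_comm_mem (hv : v ∈ g.part 1) (hθ : ∀ a, θ a ∈ g.part 1)
    (hσ : ∀ a, θ (R.σ a) = - θ a) {p : ℕ} {t : (N × N) ⊗[ℂ] g.Kos} (ht : t ∈ tfilt N g p) :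
    contr θ ((R.eps.tensor g.kos).opI v t) - g.kos.opI v (contr θ t) ∈ g.filt (p + 1) ∧
      contr θ ((R.eps.tensor g.kos).opK v t) - g.kos.opK v (contr θ t) ∈ g.filt (p + 1) := by
  have : tfilt N g p ≤
      (g.filt (p + 1)).comap
        (contr θ ∘ₗ (R.eps.tensor g.kos).opI v - g.kos.opI v ∘ₗ contr θ) ⊓
      (g.filt (p + 1)).comap
        (contr θ ∘ₗ (R.eps.tensor g.kos).opK v - g.kos.opK v ∘ₗ contr θ) := by
    refine tfilt_le fun a b m hm => ⟨?_, ?_⟩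
    · rw [SetLike.mem_coe, Submodule.mem_comap, LinearMap.sub_apply, LinearMap.comp_apply,
        LinearMap.comp_apply, contr_opI_tmul hv hσ, contr_tmul, map_add]
      have h1 := opI_mem_filt (hθ (R.act v a)) hm
      have h2 := opK_mem_filt (hθ (R.act v b)) hm
      have h3 := g.filt_mono_succ _ (opI_opI_mem_filt (hθ a) hv hm)
      have h4 := g.filt_mono_succ _ (opI_opK_mem_filt hv (hθ b) hm)
      convert sub_mem (sub_mem (sub_mem h1 h2) h3) h4 using 1
      abel
    · rw [SetLike.mem_coe, Submodule.mem_comap, LinearMap.sub_apply, LinearMap.comp_apply,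
        LinearMap.comp_apply, contr_opK_tmul hv, contr_tmul, map_add, opK_comm (hθ b) hv]
      have h1 := opK_mem_filt (hθ (R.act v a)) hm
      have h4 := g.filt_mono_succ _ (opI_opK_mem_filt (hθ a) hv hm)
      convert add_mem h1 h4 using 1
      abel
  exact this ht

variable {w : N} {Δ : g.Kos →ₗ[ℂ] (N × N) ⊗[ℂ] g.Kos}

/-- Contracting the comultiplication acts on the associated graded of the filtration as the
Euler operator. -/
lemma contr_comult_sub_mem (hw : R.σ w = w) (hθ : ∀ a, θ a ∈ g.part 1)
    (hσ : ∀ a, θ (R.σ a) = - θ a) (hθw : ∀ v ∈ g.part 1, θ (R.act v w) = v)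
    (h1 : Δ g.kvac = (w, 0) ⊗ₜ g.kvac)
    (hΔ : ∀ v m, Δ (g.kos.ρ v m) = (R.eps.tensor g.kos).ρ v (Δ m)) (p : ℕ) :
    ∀ u ∈ g.filt (p + 1), contr θ (Δ u) - (p : ℂ) • u ∈ g.filt p := by
  have hI : ∀ x m, Δ (g.kos.opI x m) = (R.eps.tensor g.kos).opI x (Δ m) := fun x m => hΔ _ m
  have hK : ∀ x m, Δ (g.kos.opK x m) = (R.eps.tensor g.kos).opK x (Δ m) := fun x m => hΔ _ m
  have hw0 : θ w = 0 := by
    have h := hσ w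
    rw [hw] at h
    have h2 : (2 : ℂ) • θ w = 0 := by
      rw [two_smul]
      nth_rewrite 1 [h]
      exact neg_add_cancel _
    exact (smul_eq_zero.1 h2).resolve_left two_ne_zero
  have hcw : ∀ u, contr θ ((w, 0) ⊗ₜ[ℂ] u) = 0 := fun u => by
    rw [contr_tmul, hw0, map_zero, map_zero, map_zero, LinearMap.zero_apply, add_zero]
  have hvac : contr θ (Δ g.kvac) = 0 := by rw [h1, hcw]
  have hS : ∀ p, contr θ (Δ g.kvac) - (p : ℂ) • g.kvac ∈ g.filt p → (∀ u ∈ g.filt p, ∀ v ∈ g.part 1,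
      contr θ (Δ (g.kos.opI v u)) - (p : ℂ) • g.kos.opI v u ∈ g.filt p ∧
      contr θ (Δ (g.kos.opK v u)) - (p : ℂ) • g.kos.opK v u ∈ g.filt p) →
      ∀ u ∈ g.filt (p + 1), contr θ (Δ u) - (p : ℂ) • u ∈ g.filt p := by
    intro p h0 h
    have hmem : ∀ u, u ∈ (g.filt p).comap (contr θ ∘ₗ Δ - (p : ℂ) • LinearMap.id) ↔
        contr θ (Δ u) - (p : ℂ) • u ∈ g.filt p := fun u => by
      rw [Submodule.mem_comap, LinearMap.sub_apply, LinearMap.comp_apply, LinearMap.smul_apply,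
        LinearMap.id_apply]
    exact fun u hu => (hmem u).1 (g.filt_succ_le ((hmem _).2 h0)
      (fun v hv m hm => (hmem _).2 (h m hm v hv).1)
      (fun v hv m hm => (hmem _).2 (h m hm v hv).2) hu)
  induction p with
  | zero =>
    refine hS 0 ?_ fun u hu v hv => ?_
    · rw [hvac, Nat.cast_zero, zero_smul, sub_zero]
      exact zero_mem _
    · rw [(Submodule.mem_bot ℂ).1 hu]
      simp
  | succ p ih =>
    refine hS (p + 1) ?_ fun u hu v hv => ?_
    · rw [hvac, zero_sub]
      exact neg_mem (Submodule.smul_mem _ _ (g.vac_mem_filt p))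
    obtain ⟨t, ht, hΔu⟩ : ∃ t ∈ tfilt N g p, Δ u = (w, 0) ⊗ₜ u + t :=
      ⟨_, comult_sub_mem hw h1 hΔ p u hu, by abel⟩
    have hct : contr θ t - (p : ℂ) • u ∈ g.filt p := by
      have := ih u hu
      rwa [hΔu, map_add, hcw, zero_add] at this
    have hst := contr_comm_mem hv hθ hσ ht
    constructor
    · have hB := opI_mem_filt hv hct
      rw [map_sub, map_smul] at hB
      rw [hI, hΔu, map_add, map_add, contr_opI_tmul hv hσ, hθw v hv, hw0]
      simp only [map_zero, LinearMap.zero_apply, sub_zero, add_zero]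
      convert add_mem hst.1 hB using 1
      push_cast
      module
    · have hB := opK_mem_filt hv hct
      rw [map_sub, map_smul] at hB
      rw [hK, hΔu, map_add, map_add, contr_opK_tmul hv, hθw v hv, hw0]
      simp only [map_zero, LinearMap.zero_apply, add_zero]
      convert add_mem hst.2 hB using 1
      push_cast
      module

end homotopy

variable (g) in
/-- The augmentation of the Koszul module. -/
lemma exists_counit : ∃ ε : g.Kos →ₗ[ℂ] ℂ, ε g.kvac = 1 ∧ (∀ m, ε (g.kos.σ m) = ε m) ∧
    ∀ v m, ε (g.kos.ρ v m) = 0 :=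
  g.hat.exists_univ_hom (H := g.hatEven) (SRep.trivialHat g) 1 rfl fun _ _ => rfl

variable (g) in
/-- The augmentation of the Koszul module. -/
def counit : g.Kos →ₗ[ℂ] ℂ := g.exists_counit.choose

lemma counit_vac : g.counit g.kvac = 1 := g.exists_counit.choose_spec.1

lemma counit_σ (m : g.Kos) : g.counit (g.kos.σ m) = g.counit m := g.exists_counit.choose_spec.2.1 m

lemma counit_opI (x : g.carrier) (m : g.Kos) : g.counit (g.kos.opI x m) = 0 :=
  g.exists_counit.choose_spec.2.2 _ m

lemma counit_opD (m : g.Kos) : g.counit (g.kos.opD m) = 0 :=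
  g.exists_counit.choose_spec.2.2 _ m

/-- The Koszul complex is a resolution of the trivial module. -/
theorem exists_opD_eq (hg : g.IsClassical) {n : ℕ} {u : g.Kos} (hu : u ∈ g.kosDeg n)
    (hd : g.kos.opD u = 0) (h0 : g.counit u = 0) :
    ∃ u' ∈ g.kosDeg (n + 1), g.kos.opD u' = u := by
  obtain ⟨R, w, θ, hw, hw0, hθ, hσ, hθw⟩ := exists_faithful_vector hg
  obtain ⟨Δ, h1, -, hΔ⟩ := exists_comult R hw hw0
  have hD : ∀ m, Δ (g.kos.opD m) = (R.eps.tensor g.kos).opD (Δ m) := fun m => hΔ _ m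
  have hE : ∀ m, Δ (g.kos.opE m) = (R.eps.tensor g.kos).opE (Δ m) := fun m => hΔ _ m
  obtain ⟨p, hp⟩ := g.exists_mem_filt u
  induction p generalizing u with
  | zero =>
    rw [(Submodule.mem_bot ℂ).1 hp]
    exact ⟨0, zero_mem _, map_zero _⟩
  | succ p ih =>
    have hc := contr_comult_sub_mem hw hθ hσ hθw h1 hΔ p u hp
    have hdeg : contrK θ (Δ u) ∈ g.kosDeg (n + 1) := by
      rw [mem_kosDeg, opE_contrK (R := R), ← hE, (mem_kosDeg).1 hu, map_smul, map_smul]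
      push_cast
      module
    have hdh : g.kos.opD (contrK θ (Δ u)) = contr θ (Δ u) := by
      have := opD_contrK hθ hσ (Δ u)
      rwa [← hD, hd, map_zero, map_zero, add_zero] at this
    rcases Nat.eq_zero_or_pos p with rfl | hpos
    · have : g.filt 1 ≤ ℂ ∙ g.kvac := by
        refine g.filt_succ_le (Submodule.mem_span_singleton_self _) (fun v hv m hm => ?_)
          (fun v hv m hm => ?_) <;> rw [(Submodule.mem_bot ℂ).1 hm, map_zero] <;> exact zero_mem _
      obtain ⟨c, rfl⟩ := Submodule.mem_span_singleton.1 (this hp)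
      rw [map_smul, counit_vac, smul_eq_mul, mul_one] at h0
      rw [h0, zero_smul]
      exact ⟨0, zero_mem _, map_zero _⟩
    · have hp0 : (p : ℂ) ≠ 0 := Nat.cast_ne_zero.2 hpos.ne'
      set s := (p : ℂ)⁻¹ • contrK θ (Δ u) with hs
      have hsdeg : s ∈ g.kosDeg (n + 1) := Submodule.smul_mem _ _ hdeg
      obtain ⟨u', hu', h'⟩ := ih (u := u - g.kos.opD s)
        (sub_mem hu (opD_mem_kosDeg hsdeg))
        (by rw [map_sub, hd, g.kos.opD_opD, sub_zero])
        (by rw [map_sub, counit_opD, h0, sub_zero])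
        (by
          have h2 := Submodule.smul_mem _ (-(p : ℂ)⁻¹) hc
          rw [hs, map_smul, hdh]
          convert h2 using 1
          rw [smul_sub, smul_smul, neg_mul, inv_mul_cancel₀ hp0]
          module)
      exact ⟨u' + s, add_mem hu' hsdeg, by rw [map_add, h', sub_add_cancel]⟩

end LieSuperAlgebra

/-! ### Relative projectivity of the Koszul module -/

open scoped TensorProduct

namespace SRep

variable {B : BracketData} {g : LieSuperAlgebra} {N N₁ N₂ N₃ : Type*} [AddCommGroup N] [Module ℂ N]
  [AddCommGroup N₁] [Module ℂ N₁] [AddCommGroup N₂] [Module ℂ N₂] [AddCommGroup N₃] [Module ℂ N₃]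

/-- An even homomorphism of representations. -/
structure IsEvenHom (R₁ : SRep B N₁) (R₂ : SRep B N₂) (f : N₁ →ₗ[ℂ] N₂) : Prop where
  map_σ : ∀ m, f (R₁.σ m) = R₂.σ (f m)
  map_ρ : ∀ x m, f (R₁.ρ x m) = R₂.ρ x (f m)

lemma IsEvenHom.map_act {R₁ : SRep g.bracketData N₁} {R₂ : SRep g.bracketData N₂}
    {f : N₁ →ₗ[ℂ] N₂} (h : IsEvenHom R₁ R₂ f) (x : g.carrier) (m : N₁) :
    f (R₁.act x m) = R₂.act x (f m) := h.map_ρ x m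

lemma IsEvenHom.comp {R₁ : SRep B N₁} {R₂ : SRep B N₂} {R₃ : SRep B N₃} {f : N₁ →ₗ[ℂ] N₂}
    {f' : N₂ →ₗ[ℂ] N₃} (h' : IsEvenHom R₂ R₃ f') (h : IsEvenHom R₁ R₂ f) :
    IsEvenHom R₁ R₃ (f' ∘ₗ f) where
  map_σ m := by rw [comp_apply, h.map_σ, h'.map_σ, comp_apply]
  map_ρ x m := by rw [comp_apply, h.map_ρ, h'.map_ρ, comp_apply]

lemma IsEvenHom.rTensor {R₁ : SRep B N₁} {R₂ : SRep B N₂} {f : N₁ →ₗ[ℂ] N₂}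
    (h : IsEvenHom R₁ R₂ f) (R : SRep B N) :
    IsEvenHom (R₁.tensor R) (R₂.tensor R) (f.rTensor N) where
  map_σ m := by
    induction m using TensorProduct.induction_on with
    | zero => simp
    | add s t hs ht => simp only [map_add, hs, ht]
    | tmul a b => rw [tensor_σ, rTensor_tmul, rTensor_tmul, tensor_σ, h.map_σ]
  map_ρ x m := by
    induction m using TensorProduct.induction_on with
    | zero => simp
    | add s t hs ht => simp only [map_add, hs, ht]
    | tmul a b =>
      change f.rTensor N (R₁.ρ x a ⊗ₜ b + a ⊗ₜ R.ρ (B.projEven x) b +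
        R₁.σ a ⊗ₜ R.ρ (B.projOdd x) b) = R₂.ρ x (f a) ⊗ₜ b + f a ⊗ₜ R.ρ (B.projEven x) b +
          R₂.σ (f a) ⊗ₜ R.ρ (B.projOdd x) b
      simp only [map_add, rTensor_tmul, h.map_σ, h.map_ρ]

lemma IsEvenHom.eps {R₁ : SRep g.bracketData N₁} {R₂ : SRep g.bracketData N₂}
    {f : N₁ →ₗ[ℂ] N₂} (h : IsEvenHom R₁ R₂ f) : IsEvenHom R₁.eps R₂.eps (f.prodMap f) where
  map_σ := by
    rintro ⟨a, b⟩
    rw [eps_σ, prodMap_apply, prodMap_apply, eps_σ]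
    simp only [map_neg, h.map_σ]
  map_ρ := by
    change ∀ (v : g.carrier × g.carrier × ℂ × ℂ) (m : N₁ × N₁),
      f.prodMap f (R₁.eps.ρ v m) = R₂.eps.ρ v (f.prodMap f m)
    rintro v ⟨a, b⟩
    rw [ρ_eq, ρ_eq]
    simp only [LinearMap.add_apply, LinearMap.smul_apply, eps_opI, eps_opK, eps_opD, eps_opE,
      map_add, map_smul, prodMap_apply, map_zero, h.map_act]

/-- Postcomposition with an even homomorphism. -/
lemma IsEvenHom.hom_right {R₁ : SRep g.bracketData N₁} {R₂ : SRep g.bracketData N₂}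
    {f : N₁ →ₗ[ℂ] N₂} (h : IsEvenHom R₁ R₂ f) (R : SRep g.bracketData N) :
    IsEvenHom (hom R R₁) (hom R R₂) (LinearMap.llcomp ℂ N N₁ N₂ f) where
  map_σ φ := by
    ext m
    change f _ = _
    rw [hom_σ, hom_σ, h.map_σ]
    rfl
  map_ρ x φ := by
    revert x
    refine g.induction_homogeneous (fun x hx => ?_) (fun x hx => ?_) (fun x y hx hy => ?_)
    · ext m
      change f ((hom R R₁).act x φ m) = (hom R R₂).act x _ m
      rw [hom_act_even _ _ hx, hom_act_even _ _ hx, map_sub, h.map_act]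
      rfl
    · ext m
      change f ((hom R R₁).act x φ m) = (hom R R₂).act x _ m
      rw [hom_act_odd _ _ hx, hom_act_odd _ _ hx, map_sub, h.map_act, h.map_σ]
      rfl
    · change (LinearMap.llcomp ℂ N N₁ N₂ f) ((hom R R₁).act (x + y) φ) =
        (hom R R₂).act (x + y) _
      rw [map_add, map_add, LinearMap.add_apply, LinearMap.add_apply, map_add]
      exact congrArg₂ (· + ·) hx hy

/-- An even homomorphism is an invariant vector of the space of linear maps. -/
lemma IsEvenHom.act_eq_zero {R₁ : SRep g.bracketData N₁} {R₂ : SRep g.bracketData N₂}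
    {f : N₁ →ₗ[ℂ] N₂} (h : IsEvenHom R₁ R₂ f) (x : g.carrier) : (hom R₁ R₂).act x f = 0 := by
  revert x
  refine g.induction_homogeneous (fun x hx => ?_) (fun x hx => ?_) (fun x y hx hy => ?_)
  · ext m
    rw [hom_act_even _ _ hx, h.map_act, sub_self, LinearMap.zero_apply]
  · ext m
    rw [hom_act_odd _ _ hx, h.map_σ, h.map_act, R₂.σσ, sub_self, LinearMap.zero_apply]
  · rw [map_add, LinearMap.add_apply, hx, hy, add_zero]

lemma IsEvenHom.σ_eq {R₁ : SRep g.bracketData N₁} {R₂ : SRep g.bracketData N₂}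
    {f : N₁ →ₗ[ℂ] N₂} (h : ∀ m, f (R₁.σ m) = R₂.σ (f m)) : (hom R₁ R₂).σ f = f := by
  ext m
  rw [hom_σ, h, R₂.σσ]

end SRep

namespace LieSuperAlgebra

open SRep

variable {g : LieSuperAlgebra} {M A B : Type*} [AddCommGroup M] [Module ℂ M]
  [AddCommGroup A] [Module ℂ A] [AddCommGroup B] [Module ℂ B]

/-- Evaluation of the first component of a family of linear maps on `K ⊗ M`. -/
def evalFst (g : LieSuperAlgebra) (M A : Type*) [AddCommGroup M] [Module ℂ M] [AddCommGroup A]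
    [Module ℂ A] :
    (((g.Kos ⊗[ℂ] M →ₗ[ℂ] A) × (g.Kos ⊗[ℂ] M →ₗ[ℂ] A)) ⊗[ℂ] g.Kos) ⊗[ℂ] M →ₗ[ℂ] A :=
  TensorProduct.lift (LinearMap.id ∘ₗ LinearMap.fst ℂ _ _) ∘ₗ
    (TensorProduct.assoc ℂ _ g.Kos M).toLinearMap

lemma evalFst_tmul (e e' : g.Kos ⊗[ℂ] M →ₗ[ℂ] A) (k : g.Kos) (m : M) :
    evalFst g M A (((e, e') ⊗ₜ k) ⊗ₜ m) = e (k ⊗ₜ m) := rfl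

section

variable (RM : SRep g.bracketData M) (RA : SRep g.bracketData A)

lemma evalFst_σ (t : ((g.Kos ⊗[ℂ] M →ₗ[ℂ] A) × (g.Kos ⊗[ℂ] M →ₗ[ℂ] A)) ⊗[ℂ] g.Kos) (m : M) :
    evalFst g M A (((hom (g.kos.toBase.tensor RM) RA).eps.tensor g.kos).σ t ⊗ₜ RM.σ m) =
      RA.σ (evalFst g M A (t ⊗ₜ m)) := by
  induction t using TensorProduct.induction_on with
  | zero => simp
  | add s t hs ht => simp only [map_add, TensorProduct.add_tmul, hs, ht]
  | tmul e k =>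
    obtain ⟨e, e'⟩ := e
    rw [tensor_σ, eps_σ, evalFst_tmul, hom_σ, tensor_σ, evalFst_tmul, RM.σσ]
    congr 3
    exact g.kos.σσ k

lemma evalFst_act_even {x : g.carrier} (hx : x ∈ g.part 0)
    (t : ((g.Kos ⊗[ℂ] M →ₗ[ℂ] A) × (g.Kos ⊗[ℂ] M →ₗ[ℂ] A)) ⊗[ℂ] g.Kos) (m : M) :
    evalFst g M A (((hom (g.kos.toBase.tensor RM) RA).eps.tensor g.kos).opI x t ⊗ₜ m) +
      evalFst g M A (t ⊗ₜ RM.act x m) = RA.act x (evalFst g M A (t ⊗ₜ m)) := by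
  induction t using TensorProduct.induction_on with
  | zero => simp
  | add s t hs ht =>
    simp only [map_add, TensorProduct.add_tmul, ← hs, ← ht]
    abel
  | tmul e k =>
    obtain ⟨e, e'⟩ := e
    rw [tensor_opI _ _ _ _ hx, eps_opI, sg_zero, Module.End.one_apply, TensorProduct.add_tmul,
      map_add, evalFst_tmul, evalFst_tmul, evalFst_tmul, evalFst_tmul, hom_act_even _ _ hx,
      tensor_act _ _ hx, map_add, sg_zero]
    change _ - (e (g.kos.opI x k ⊗ₜ m) + e (k ⊗ₜ RM.act x m)) + _ + _ = _
    abel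

lemma evalFst_act_odd {x : g.carrier} (hx : x ∈ g.part 1)
    (t : ((g.Kos ⊗[ℂ] M →ₗ[ℂ] A) × (g.Kos ⊗[ℂ] M →ₗ[ℂ] A)) ⊗[ℂ] g.Kos) (m : M) :
    evalFst g M A (((hom (g.kos.toBase.tensor RM) RA).eps.tensor g.kos).opI x t ⊗ₜ m) +
      evalFst g M A (((hom (g.kos.toBase.tensor RM) RA).eps.tensor g.kos).σ t ⊗ₜ RM.act x m) =
        RA.act x (evalFst g M A (t ⊗ₜ m)) := by
  induction t using TensorProduct.induction_on with
  | zero => simp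
  | add s t hs ht =>
    simp only [map_add, TensorProduct.add_tmul, ← hs, ← ht]
    abel
  | tmul e k =>
    obtain ⟨e, e'⟩ := e
    rw [tensor_opI _ _ _ _ hx, eps_opI, sg_one, eps_σ, TensorProduct.add_tmul,
      map_add, evalFst_tmul, evalFst_tmul, evalFst_tmul, hom_act_odd _ _ hx, tensor_σ, eps_σ,
      evalFst_tmul, ← hom_σ (g.kos.toBase.tensor RM) RA e,
      tensor_act _ _ hx, map_add, sg_one]
    change _ - (_ + (hom (g.kos.toBase.tensor RM) RA).σ e (g.kos.σ k ⊗ₜ RM.act x m)) +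
      (hom (g.kos.toBase.tensor RM) RA).σ e (g.kos.opI x k ⊗ₜ m) + _ = _
    change _ - ((hom (g.kos.toBase.tensor RM) RA).σ e (g.kos.opI x k ⊗ₜ m) + _) + _ + _ = _
    abel

end

/-- Even homomorphisms from `K ⊗ M` lift along surjections split over `g₀`. -/
theorem exists_evenHom_lift {RM : SRep g.bracketData M} {RA : SRep g.bracketData A}
    {RB : SRep g.bracketData B} {p : A →ₗ[ℂ] B} (hp : IsEvenHom RA RB p) {t : B →ₗ[ℂ] A}
    (htσ : ∀ b, t (RB.σ b) = RA.σ (t b))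
    (hta : ∀ x ∈ g.part 0, ∀ b, t (RB.act x b) = RA.act x (t b))
    (hpt : ∀ b, p (t b) = b) {f : g.Kos ⊗[ℂ] M →ₗ[ℂ] B}
    (hf : IsEvenHom (g.kos.toBase.tensor RM) RB f) :
    ∃ h : g.Kos ⊗[ℂ] M →ₗ[ℂ] A, IsEvenHom (g.kos.toBase.tensor RM) RA h ∧ p ∘ₗ h = f := by
  set KM := g.kos.toBase.tensor RM with hKM
  obtain ⟨Δ, h1, hΔσ, hΔ⟩ := exists_comult (w := t ∘ₗ f) (hom KM RA)
    (IsEvenHom.σ_eq fun m => by rw [comp_apply, hf.map_σ, htσ, comp_apply])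
    (fun x hx => by
      refine LinearMap.ext fun m => ?_
      rw [hom_act_even _ _ hx, comp_apply, comp_apply, hf.map_act, hta x hx, sub_self,
        LinearMap.zero_apply])
  have hI : ∀ x m, Δ (g.kos.opI x m) = ((hom KM RA).eps.tensor g.kos).opI x (Δ m) :=
    fun x m => hΔ _ m
  refine ⟨evalFst g M A ∘ₗ Δ.rTensor M, ⟨fun u => ?_, fun x u => ?_⟩, ?_⟩
  · induction u using TensorProduct.induction_on with
    | zero => simp
    | add s t hs ht => simp only [map_add, hs, ht]
    | tmul k m =>
      rw [tensor_σ, comp_apply, comp_apply, rTensor_tmul, rTensor_tmul, ← evalFst_σ RM RA, ← hΔσ]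
      rfl
  · induction u using TensorProduct.induction_on with
    | zero => simp
    | add s t hs ht => simp only [map_add, hs, ht]
    | tmul k m =>
      revert x
      refine g.induction_homogeneous (fun x hx => ?_) (fun x hx => ?_) (fun x y hx hy => ?_)
      · change (evalFst g M A ∘ₗ Δ.rTensor M) (KM.act x _) = RA.act x _
        rw [tensor_act _ _ hx, comp_apply, comp_apply, map_add, rTensor_tmul, rTensor_tmul,
          rTensor_tmul, ← evalFst_act_even RM RA hx, ← hI, map_add, sg_zero]
        rfl
      · change (evalFst g M A ∘ₗ Δ.rTensor M) (KM.act x _) = RA.act x _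
        rw [tensor_act _ _ hx, comp_apply, comp_apply, map_add, rTensor_tmul, rTensor_tmul,
          rTensor_tmul, ← evalFst_act_odd RM RA hx, ← hI, map_add, sg_one, ← hΔσ]
        rfl
      · change (evalFst g M A ∘ₗ Δ.rTensor M) (KM.act (x + y) (k ⊗ₜ m)) =
          RA.act (x + y) ((evalFst g M A ∘ₗ Δ.rTensor M) (k ⊗ₜ m))
        rw [map_add, map_add, LinearMap.add_apply, LinearMap.add_apply, map_add]
        exact congrArg₂ (· + ·) hx hy
  · let p' : (g.Kos ⊗[ℂ] M →ₗ[ℂ] A) →ₗ[ℂ] (g.Kos ⊗[ℂ] M →ₗ[ℂ] B) :=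
      LinearMap.llcomp ℂ (g.Kos ⊗[ℂ] M) A B p
    have hP := ((hp.hom_right KM).eps).rTensor g.kos
    have hfac : ((p'.prodMap p').rTensor g.Kos) ∘ₗ Δ =
        TensorProduct.mk ℂ _ g.Kos (f, 0) := by
      have hf0 := hf.act_eq_zero
      have hfσ : (hom KM RB).eps.σ (f, 0) = (f, 0) := by
        rw [eps_σ, IsEvenHom.σ_eq hf.map_σ, map_zero, neg_zero]
      have hfρ : ∀ v : g.carrier × g.carrier × ℂ × ℂ, (hom KM RB).eps.ρ v (f, 0) = 0 := fun v => by
        rw [ρ_eq]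
        simp only [LinearMap.add_apply, LinearMap.smul_apply, eps_opI, eps_opK, eps_opD, eps_opE,
          hf0, map_zero]
        have h00 : ((0 : g.Kos ⊗[ℂ] M →ₗ[ℂ] B), (0 : g.Kos ⊗[ℂ] M →ₗ[ℂ] B)) = 0 := rfl
        simp [h00]
      refine g.hat.univ_hom_ext (H := g.hatEven) ((hom KM RB).eps.tensor g.kos) ?_
        (fun m => ?_) (fun m => ?_) (fun v m => ?_) (fun v m => ?_)
      · rw [comp_apply]
        change (p'.prodMap p').rTensor g.Kos (Δ g.kvac) = (f, 0) ⊗ₜ g.kvac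
        rw [h1, rTensor_tmul, prodMap_apply, map_zero]
        congr 2
        exact LinearMap.ext fun m => hpt (f m)
      · rw [comp_apply, comp_apply, ← hP.map_σ, ← hΔσ]
        rfl
      · rw [TensorProduct.mk_apply, TensorProduct.mk_apply, tensor_σ, hfσ]
        rfl
      · rw [comp_apply, comp_apply, ← hP.map_ρ, ← hΔ]
        rfl
      · change (f, 0) ⊗ₜ g.kos.ρ v m = (hom KM RB).eps.ρ v (f, 0) ⊗ₜ m +
          (f, 0) ⊗ₜ g.kos.ρ (g.hat.projEven v) m +
            (hom KM RB).eps.σ (f, 0) ⊗ₜ g.kos.ρ (g.hat.projOdd v) m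
        have hv : (hom KM RB).eps.ρ v (f, 0) = 0 := hfρ v
        rw [hfσ, hv, TensorProduct.zero_tmul, zero_add, ← TensorProduct.tmul_add,
          ← LinearMap.add_apply, ← map_add, g.hat.projEven_add_projOdd]
    refine TensorProduct.ext' fun k m => ?_
    have hev : ∀ s : ((g.Kos ⊗[ℂ] M →ₗ[ℂ] A) × (g.Kos ⊗[ℂ] M →ₗ[ℂ] A)) ⊗[ℂ] g.Kos,
        p (evalFst g M A (s ⊗ₜ m)) =
          evalFst g M B ((p'.prodMap p').rTensor g.Kos s ⊗ₜ m) := fun s => by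
      induction s using TensorProduct.induction_on with
      | zero => simp
      | add s t hs ht => simp only [map_add, TensorProduct.add_tmul, hs, ht]
      | tmul e k => rfl
    rw [comp_apply, comp_apply, rTensor_tmul, hev, ← comp_apply, hfac]
    rfl

end LieSuperAlgebra

namespace SRep

variable {g : LieSuperAlgebra} {N N₁ N₂ : Type*} [AddCommGroup N] [Module ℂ N]
  [AddCommGroup N₁] [Module ℂ N₁] [AddCommGroup N₂] [Module ℂ N₂]

/-- A homomorphism of representations which need not preserve the parity. -/
def IsHom (R₁ : SRep g.bracketData N₁) (R₂ : SRep g.bracketData N₂) (f : N₁ →ₗ[ℂ] N₂) : Prop :=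
  ∀ i, ∀ x ∈ g.part i, ∀ m, f (R₁.act x m) = R₂.act x (R₂.sg i (f (R₁.sg i m)))

lemma IsHom.map_even {R₁ : SRep g.bracketData N₁} {R₂ : SRep g.bracketData N₂} {f : N₁ →ₗ[ℂ] N₂}
    (h : IsHom R₁ R₂ f) {x : g.carrier} (hx : x ∈ g.part 0) (m : N₁) :
    f (R₁.act x m) = R₂.act x (f m) := by
  simpa using h 0 x hx m

lemma IsHom.map_odd {R₁ : SRep g.bracketData N₁} {R₂ : SRep g.bracketData N₂} {f : N₁ →ₗ[ℂ] N₂}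
    (h : IsHom R₁ R₂ f) {x : g.carrier} (hx : x ∈ g.part 1) (m : N₁) :
    f (R₁.act x m) = R₂.act x (R₂.σ (f (R₁.σ m))) := by
  simpa using h 1 x hx m

/-- The sum of a representation and its parity shift, in the coordinates given by the sum and
the difference of the components. -/
def dbl (R : SRep g.bracketData N) : SRep g.bracketData (N × N) :=
  ofAct (LinearMap.prod (R.σ ∘ₗ LinearMap.snd ℂ N N) (R.σ ∘ₗ LinearMap.fst ℂ N N))
    { toFun := fun x => LinearMap.prod
        (R.act (g.projEven x) ∘ₗ LinearMap.fst ℂ N N + R.act (g.projOdd x) ∘ₗ LinearMap.snd ℂ N N)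
        (R.act (g.projEven x) ∘ₗ LinearMap.snd ℂ N N + R.act (g.projOdd x) ∘ₗ LinearMap.fst ℂ N N)
      map_add' := fun x y => by ext <;> simp
      map_smul' := fun c x => by ext <;> simp }
    (fun m => by simp [R.σσ])
    (fun i x hx m => by
      rcases zmodTwo_cases i with rfl | rfl
      · simp [g.projEven_of_even hx, g.projOdd_of_even hx, R.σ_act_even hx]
      · simp [g.projEven_of_odd hx, g.projOdd_of_odd hx, R.σ_act_odd hx])
    (fun i j x hx y hy m => by
      have hb := g.bracket_grading _ _ _ hx _ hy
      have hab := fun m => R.act_bracket hx hy m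
      rcases zmodTwo_cases i with rfl | rfl <;> rcases zmodTwo_cases j with rfl | rfl <;>
        simp only [zero_add, add_zero, zmodTwo_one_add_one] at hb <;>
        simp [g.projEven_of_even, g.projOdd_of_even, g.projEven_of_odd, g.projOdd_of_odd, hx, hy,
          hb, hab])

lemma dbl_σ (R : SRep g.bracketData N) (a b : N) : R.dbl.σ (a, b) = (R.σ b, R.σ a) := rfl

lemma dbl_act_even (R : SRep g.bracketData N) {x : g.carrier} (hx : x ∈ g.part 0) (a b : N) :
    R.dbl.act x (a, b) = (R.act x a, R.act x b) := by
  change (R.act (g.projEven x) a + R.act (g.projOdd x) b,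
    R.act (g.projEven x) b + R.act (g.projOdd x) a) = _
  simp [g.projEven_of_even hx, g.projOdd_of_even hx]

lemma dbl_act_odd (R : SRep g.bracketData N) {x : g.carrier} (hx : x ∈ g.part 1) (a b : N) :
    R.dbl.act x (a, b) = (R.act x b, R.act x a) := by
  change (R.act (g.projEven x) a + R.act (g.projOdd x) b,
    R.act (g.projEven x) b + R.act (g.projOdd x) a) = _
  simp [g.projEven_of_odd hx, g.projOdd_of_odd hx]

lemma IsEvenHom.of_homogeneous {R₁ : SRep g.bracketData N₁} {R₂ : SRep g.bracketData N₂}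
    {f : N₁ →ₗ[ℂ] N₂} (hσ : ∀ m, f (R₁.σ m) = R₂.σ (f m))
    (h0 : ∀ x ∈ g.part 0, ∀ m, f (R₁.act x m) = R₂.act x (f m))
    (h1 : ∀ x ∈ g.part 1, ∀ m, f (R₁.act x m) = R₂.act x (f m)) : IsEvenHom R₁ R₂ f where
  map_σ := hσ
  map_ρ x m := by
    revert x
    refine g.induction_homogeneous (fun x hx => h0 x hx m) (fun x hx => h1 x hx m)
      (fun x y hx hy => ?_)
    change f (R₁.act (x + y) m) = R₂.act (x + y) (f m)
    rw [map_add, map_add, LinearMap.add_apply, LinearMap.add_apply, map_add]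
    exact congrArg₂ (· + ·) hx hy

/-- A homomorphism together with its conjugate by the parity is an even map into the double. -/
lemma IsHom.prod_dbl {R₁ : SRep g.bracketData N₁} {R₂ : SRep g.bracketData N₂} {f : N₁ →ₗ[ℂ] N₂}
    (h : IsHom R₁ R₂ f) : IsEvenHom R₁ R₂.dbl (f.prod (R₂.σ ∘ₗ f ∘ₗ R₁.σ)) := by
  refine IsEvenHom.of_homogeneous (fun m => ?_) (fun x hx m => ?_) (fun x hx m => ?_)
  · simp [dbl_σ, R₁.σσ, R₂.σσ]
  · simp [dbl_act_even _ hx, R₁.σ_act_even hx, h.map_even hx, R₂.σ_act_even hx]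
  · simp [dbl_act_odd _ hx, R₁.σ_act_odd hx, h.map_odd hx, R₂.σ_act_odd hx, R₁.σσ, R₂.σσ]

lemma IsHom.prodMap_dbl {R₁ : SRep g.bracketData N₁} {R₂ : SRep g.bracketData N₂}
    {f : N₁ →ₗ[ℂ] N₂} (h : IsHom R₁ R₂ f) :
    IsEvenHom R₁.dbl R₂.dbl (f.prodMap (R₂.σ ∘ₗ f ∘ₗ R₁.σ)) := by
  refine IsEvenHom.of_homogeneous ?_ ?_ ?_
  · rintro ⟨a, b⟩
    simp [dbl_σ, R₁.σσ, R₂.σσ]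
  · rintro x hx ⟨a, b⟩
    simp [dbl_act_even _ hx, R₁.σ_act_even hx, h.map_even hx, R₂.σ_act_even hx]
  · rintro x hx ⟨a, b⟩
    simp [dbl_act_odd _ hx, R₁.σ_act_odd hx, h.map_odd hx, R₂.σ_act_odd hx, R₁.σσ, R₂.σσ]

lemma IsEvenHom.fst_dbl {R₁ : SRep g.bracketData N₁} {R₂ : SRep g.bracketData N₂}
    {h : N₁ →ₗ[ℂ] N₂ × N₂} (hh : IsEvenHom R₁ R₂.dbl h) :
    IsHom R₁ R₂ (LinearMap.fst ℂ N₂ N₂ ∘ₗ h) := by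
  have hσ : ∀ m, (h (R₁.σ m)).1 = R₂.σ (h m).2 := fun m => by rw [hh.map_σ]; rfl
  intro i x hx m
  rcases zmodTwo_cases i with rfl | rfl
  · simp only [comp_apply, hh.map_act, sg_zero, fst_apply, Module.End.one_apply]
    exact congrArg Prod.fst (R₂.dbl_act_even hx (h m).1 (h m).2)
  · simp only [comp_apply, hh.map_act, sg_one, fst_apply, hσ, R₂.σσ]
    exact congrArg Prod.fst (R₂.dbl_act_odd hx (h m).1 (h m).2)

/-- A surjection of representations which is completely reducible over `g₀` splits over `g₀`. -/
lemma IsHom.exists_section {R₁ : SRep g.bracketData N₁} {R₂ : SRep g.bracketData N₂}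
    {p : N₁ →ₗ[ℂ] N₂} (h : IsHom R₁ R₂ p) (hp : Function.Surjective p)
    (hcr : ∀ U : Submodule ℂ N₁, (∀ x ∈ g.part 0, ∀ m ∈ U, R₁.act x m ∈ U) →
      ∃ U' : Submodule ℂ N₁, (∀ x ∈ g.part 0, ∀ m ∈ U', R₁.act x m ∈ U') ∧ IsCompl U U') :
    ∃ t : N₂ →ₗ[ℂ] N₁, (∀ b, p (t b) = b) ∧
      ∀ x ∈ g.part 0, ∀ b, t (R₂.act x b) = R₁.act x (t b) := by
  obtain ⟨U, hU, hc⟩ := hcr (LinearMap.ker p) fun x hx m hm => by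
    rw [LinearMap.mem_ker] at hm ⊢
    rw [h.map_even hx, hm, map_zero]
  have hbij : Function.Bijective (p.domRestrict U) := by
    refine ⟨LinearMap.ker_eq_bot.1 ?_, fun b => ?_⟩
    · rw [eq_bot_iff]
      intro u hu
      have : (u : N₁) ∈ LinearMap.ker p ⊓ U := ⟨hu, u.2⟩
      rw [hc.inf_eq_bot] at this
      exact Subtype.ext this
    · obtain ⟨a, rfl⟩ := hp b
      obtain ⟨k, hk, u, hu, rfl⟩ := Submodule.mem_sup.1 (hc.sup_eq_top ▸ Submodule.mem_top (x := a))
      exact ⟨⟨u, hu⟩, by rw [map_add, LinearMap.mem_ker.1 hk, zero_add]; rfl⟩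
  let e := LinearEquiv.ofBijective _ hbij
  have he : ∀ b, p (e.symm b : N₁) = b := fun b => e.apply_symm_apply b
  refine ⟨U.subtype ∘ₗ e.symm.toLinearMap, he, fun x hx b => ?_⟩
  have : e.symm (R₂.act x b) = ⟨R₁.act x (e.symm b), hU x hx _ (e.symm b).2⟩ := by
    rw [LinearEquiv.symm_apply_eq]
    change _ = p (R₁.act x (e.symm b))
    rw [h.map_even hx, he]
  exact congrArg Subtype.val this

end SRep

namespace LieSuperAlgebra

open SRep
open scoped TensorProduct

variable {g : LieSuperAlgebra}

variable (g) in
/-- The `n`-th term of the Koszul complex as a representation of `g`. -/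
def kosRep (n : ℕ) : SRep g.bracketData (g.kosDeg n) :=
  g.kos.toBase.restrict (g.kosDeg n) (fun _ hm => σ_mem_kosDeg hm)
    (fun x _ hm => opI_mem_kosDeg x hm)

variable (g) in
/-- Each term of the Koszul complex is a direct summand of the Koszul module over `g`. -/
lemma exists_kosDeg_proj (n : ℕ) : ∃ π : g.Kos →ₗ[ℂ] g.kosDeg n, (∀ m : g.kosDeg n, π m = m) ∧
    IsEvenHom g.kos.toBase (g.kosRep n) π := by
  have hc : IsCompl (g.kosDeg n) (⨆ k, ⨆ _ : k ≠ n, g.kosDeg k) := by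
    refine ⟨iSupIndep_kosDeg n, codisjoint_iff.2 (eq_top_iff.2 ?_)⟩
    rw [← g.iSup_kosDeg]
    refine iSup_le fun k => ?_
    rcases eq_or_ne k n with rfl | hk
    · exact le_sup_left
    · exact le_sup_of_le_right (le_iSup₂_of_le k hk le_rfl)
  set C := ⨆ k, ⨆ _ : k ≠ n, g.kosDeg k with hC
  have hstab : ∀ T : Module.End ℂ g.Kos, (∀ k, ∀ m ∈ g.kosDeg k, T m ∈ g.kosDeg k) →
      ∀ m, ((g.kosDeg n).projectionOnto C hc (T m) : g.Kos) =
        T ((g.kosDeg n).projectionOnto C hc m) := by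
    intro T hT m
    have hTC : ∀ m ∈ C, T m ∈ C := by
      have : C ≤ C.comap T := iSup₂_le fun k hk m hm =>
        (le_iSup₂_of_le (f := fun k (_ : k ≠ n) => g.kosDeg k) k hk le_rfl) (hT k m hm)
      exact this
    obtain ⟨a, ha, b, hb, rfl⟩ := Submodule.mem_sup.1
      (hc.sup_eq_top ▸ Submodule.mem_top (x := m))
    rw [map_add, map_add, map_add, Submodule.projectionOnto_apply_of_mem_right hc hb,
      Submodule.projectionOnto_apply_of_mem_right hc (hTC b hb), add_zero, add_zero,
      Submodule.projectionOnto_apply_left hc ⟨a, ha⟩,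
      Submodule.projectionOnto_apply_left hc ⟨T a, hT n a ha⟩]
  refine ⟨(g.kosDeg n).projectionOnto C hc, Submodule.projectionOnto_apply_left hc, ?_, ?_⟩
  · exact fun m => Subtype.ext (hstab g.kos.σ (fun k m hm => σ_mem_kosDeg hm) m)
  · exact fun x m => Subtype.ext (hstab (g.kos.opI x) (fun k m hm => opI_mem_kosDeg x hm) m)

lemma isEvenHom_kosDeg_subtype (n : ℕ) :
    IsEvenHom (g.kosRep n) g.kos.toBase (g.kosDeg n).subtype where
  map_σ _ := rfl
  map_ρ _ _ := rfl

variable {M A B : Type*} [AddCommGroup M] [Module ℂ M]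
  [AddCommGroup A] [Module ℂ A] [AddCommGroup B] [Module ℂ B]

/-- Homomorphisms from `Kₙ ⊗ M` lift along surjections from modules which are completely reducible
over `g₀`. -/
theorem exists_isHom_lift {n : ℕ} {RM : SRep g.bracketData M} {RA : SRep g.bracketData A}
    {RB : SRep g.bracketData B} {p : A →ₗ[ℂ] B} (hp : IsHom RA RB p) (hps : Function.Surjective p)
    (hcr : ∀ U : Submodule ℂ A, (∀ x ∈ g.part 0, ∀ m ∈ U, RA.act x m ∈ U) →
      ∃ U' : Submodule ℂ A, (∀ x ∈ g.part 0, ∀ m ∈ U', RA.act x m ∈ U') ∧ IsCompl U U')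
    {f : g.kosDeg n ⊗[ℂ] M →ₗ[ℂ] B} (hf : IsHom ((g.kosRep n).tensor RM) RB f) :
    ∃ h : g.kosDeg n ⊗[ℂ] M →ₗ[ℂ] A, IsHom ((g.kosRep n).tensor RM) RA h ∧ p ∘ₗ h = f := by
  obtain ⟨t, hpt, hta⟩ := hp.exists_section hps hcr
  obtain ⟨π, hπ, hπe⟩ := g.exists_kosDeg_proj n
  obtain ⟨h, hh, hph⟩ := exists_evenHom_lift (RM := RM) hp.prodMap_dbl
    (t := t.prodMap (RA.σ ∘ₗ t ∘ₗ RB.σ))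
    (by
      rintro ⟨a, b⟩
      simp [dbl_σ, RA.σσ, RB.σσ])
    (by
      rintro x hx ⟨a, b⟩
      simp [dbl_act_even _ hx, RB.σ_act_even hx, hta x hx, RA.σ_act_even hx])
    (by
      rintro ⟨a, b⟩
      simp [hpt, RA.σσ, RB.σσ])
    (hf.prod_dbl.comp (hπe.rTensor RM))
  refine ⟨LinearMap.fst ℂ A A ∘ₗ h ∘ₗ (g.kosDeg n).subtype.rTensor M,
    (hh.comp ((isEvenHom_kosDeg_subtype n).rTensor RM)).fst_dbl, LinearMap.ext fun u => ?_⟩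
  have h1 := LinearMap.congr_fun hph ((g.kosDeg n).subtype.rTensor M u)
  have h2 : π.rTensor M ((g.kosDeg n).subtype.rTensor M u) = u := by
    rw [← LinearMap.rTensor_comp_apply]
    have : π ∘ₗ (g.kosDeg n).subtype = LinearMap.id := LinearMap.ext hπ
    rw [this, LinearMap.rTensor_id, LinearMap.id_apply]
  have h3 := congrArg Prod.fst h1
  rw [comp_apply, comp_apply, h2] at h3
  exact h3

end LieSuperAlgebra

/-! ### Representations and supermodules -/

namespace LieSuperAlgebra

open SRep

variable {g : LieSuperAlgebra}

namespace SuperModule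

variable (M : g.SuperModule)

lemma pty_act {i : ZMod 2} {x : g.carrier} (hx : x ∈ g.part i) (m : M.carrier) :
    M.pty (M.act x m) = ssgn 1 i • M.act x (M.pty m) := by
  induction m using M.induction_homogeneous with
  | h0 m hm =>
    have h := M.act_grading i 0 x hx m hm
    rw [M.pty_of_even hm]
    rcases zmodTwo_cases i with rfl | rfl
    · rw [M.pty_of_even h, ssgn_zero_right, one_smul]
    · rw [M.pty_of_odd h, ssgn_one_one, neg_smul, one_smul]
  | h1 m hm =>
    have h := M.act_grading i 1 x hx m hm
    rw [M.pty_of_odd hm, map_neg]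
    rcases zmodTwo_cases i with rfl | rfl
    · rw [M.pty_of_odd h, ssgn_zero_right, one_smul]
    · rw [M.pty_of_even h, ssgn_one_one, neg_smul, one_smul, neg_neg]
  | hadd a b ha hb => simp only [map_add, ha, hb, smul_add]

/-- The representation underlying a supermodule. -/
def toSRep : SRep g.bracketData M.carrier :=
  ofAct M.pty M.act M.pty_pty (fun _ _ hx m => M.pty_act hx m) M.act_bracket

lemma isHom_toSRep {M N : g.SuperModule} (f : g.SuperHom M N) :
    IsHom M.toSRep N.toSRep f.toLinearMap := f.compat

end SuperModule

variable {X Y : Type} [AddCommGroup X] [Module ℂ X] [AddCommGroup Y] [Module ℂ Y]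

/-- The supermodule with a given underlying representation. -/
def _root_.SRep.toSuperModule (R : SRep g.bracketData X) : g.SuperModule where
  carrier := X
  part i := Module.End.eigenspace R.σ (ssgn 1 i)
  isCompl := by
    refine ⟨?_, codisjoint_iff.2 (eq_top_iff.2 fun m _ => ?_)⟩
    · refine Submodule.disjoint_def.2 fun m h0 h1 => ?_
      rw [Module.End.mem_eigenspace_iff] at h0 h1
      rw [h0, ssgn_zero_right, ssgn_one_one, one_smul, neg_smul, one_smul] at h1
      have := IsAddTorsionFree.of_isTorsionFree ℂ X
      exact self_eq_neg.1 h1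
    · refine Submodule.mem_sup.2 ⟨(2⁻¹ : ℂ) • (m + R.σ m), ?_, (2⁻¹ : ℂ) • (m - R.σ m), ?_, ?_⟩
      · rw [Module.End.mem_eigenspace_iff, map_smul, map_add, R.σσ, ssgn_zero_right, one_smul,
          add_comm]
      · rw [Module.End.mem_eigenspace_iff, map_smul, map_sub, R.σσ, ssgn_one_one, neg_smul,
          one_smul, ← smul_neg, neg_sub]
      · module
  act := R.act
  act_grading i j x hx m hm := by
    rw [Module.End.mem_eigenspace_iff] at *
    rw [R.σ_act hx, hm, map_smul, smul_smul]
    congr 1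
    rcases zmodTwo_cases i with rfl | rfl <;> rcases zmodTwo_cases j with rfl | rfl <;>
      simp [zmodTwo_one_add_one]
  act_bracket _ _ _ hx _ hy m := R.act_bracket hx hy m

lemma _root_.SRep.toSuperModule_pty (R : SRep g.bracketData X) : R.toSuperModule.pty = R.σ := by
  refine LinearMap.ext fun m => ?_
  induction m using R.toSuperModule.induction_homogeneous with
  | h0 m hm =>
    rw [SuperVS.pty_of_even _ hm]
    have h : R.σ m = ssgn 1 0 • (id m : X) := Module.End.mem_eigenspace_iff.1 hm
    rw [ssgn_zero_right, one_smul] at h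
    exact h.symm
  | h1 m hm =>
    rw [SuperVS.pty_of_odd _ hm]
    have h : R.σ m = ssgn 1 1 • (id m : X) := Module.End.mem_eigenspace_iff.1 hm
    rw [ssgn_one_one, neg_smul, one_smul] at h
    exact h.symm
  | hadd a b ha hb => rw [map_add, ha, hb]; exact (map_add R.σ a b).symm

lemma _root_.SRep.toSuperModule_ptyPow (R : SRep g.bracketData X) (i : ZMod 2) :
    R.toSuperModule.ptyPow i = R.sg i := by
  rw [SuperVS.ptyPow, R.toSuperModule_pty]
  rfl

/-- Supermodule homomorphisms out of the supermodule of a representation. -/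
def homOfIsHom {R : SRep g.bracketData X} {N : g.SuperModule} (f : X →ₗ[ℂ] N.carrier)
    (hf : IsHom R N.toSRep f) : g.SuperHom R.toSuperModule N where
  toLinearMap := f
  compat i x hx m := by
    rw [R.toSuperModule_ptyPow]
    exact hf i x hx m

/-- Supermodule homomorphisms between the supermodules of two representations. -/
def homOfIsHom₂ {R : SRep g.bracketData X} {R' : SRep g.bracketData Y} (f : X →ₗ[ℂ] Y)
    (hf : IsHom R R' f) : g.SuperHom R.toSuperModule R'.toSuperModule where
  toLinearMap := f
  compat i x hx m := by
    rw [R.toSuperModule_ptyPow, R'.toSuperModule_ptyPow]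
    exact hf i x hx m

lemma isHom_of_superHom {R : SRep g.bracketData X} {N : g.SuperModule}
    (f : g.SuperHom R.toSuperModule N) : IsHom R N.toSRep f.toLinearMap := by
  intro i x hx m
  have h := f.compat i x hx m
  rw [R.toSuperModule_ptyPow] at h
  exact h

end LieSuperAlgebra

namespace LieSuperAlgebra

open SRep
open scoped TensorProduct

variable {g : LieSuperAlgebra}

lemma kosRep_act (n : ℕ) (x : g.carrier) (k : g.kosDeg n) :
    (((g.kosRep n).act x k : g.kosDeg n) : g.Kos) = g.kos.opI x k := rfl

lemma kosRep_σ (n : ℕ) (k : g.kosDeg n) :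
    (((g.kosRep n).σ k : g.kosDeg n) : g.Kos) = g.kos.σ k := rfl

lemma iSup_eigenspace_kosRep (hg : g.IsClassical) {z : g.carrier} (hz : g.IsEvenCentral z)
    (n : ℕ) : ⨆ μ, Module.End.eigenspace ((g.kosRep n).act z) μ = ⊤ := by
  refine (Submodule.map_injective_of_injective (g.kosDeg n).injective_subtype) ?_
  rw [Submodule.map_iSup, Submodule.map_top, Submodule.range_subtype]
  refine le_antisymm (iSup_le fun μ => Submodule.map_subtype_le _ _) ?_
  conv_lhs => rw [← kosDeg_le_iSup_eigenspace hg hz n]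
  refine iSup_mono fun μ => ?_
  rintro k ⟨h1, h2⟩
  exact ⟨⟨k, h1⟩, Module.End.mem_eigenspace_iff.2
    (Subtype.ext (Module.End.mem_eigenspace_iff.1 h2)), rfl⟩

lemma iSup_eigenspace_tensor {N₁ N₂ : Type*} [AddCommGroup N₁] [Module ℂ N₁] [AddCommGroup N₂]
    [Module ℂ N₂] (R₁ : SRep g.bracketData N₁) (R₂ : SRep g.bracketData N₂) {z : g.carrier}
    (hz : z ∈ g.part 0) (h₁ : ⨆ μ, Module.End.eigenspace (R₁.act z) μ = ⊤)
    (h₂ : ⨆ μ, Module.End.eigenspace (R₂.act z) μ = ⊤) :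
    ⨆ μ, Module.End.eigenspace ((R₁.tensor R₂).act z) μ = ⊤ := by
  set T := ⨆ μ, Module.End.eigenspace ((R₁.tensor R₂).act z) μ with hT
  have hmem : ∀ (a : N₁) (b : N₂), a ⊗ₜ[ℂ] b ∈ T := by
    intro a b
    have ha : ⊤ ≤ T.comap ((TensorProduct.mk ℂ N₁ N₂).flip b) := by
      rw [← h₁]
      refine iSup_le fun μ a ha => ?_
      have hb : ⊤ ≤ T.comap (TensorProduct.mk ℂ N₁ N₂ a) := by
        rw [← h₂]
        refine iSup_le fun ν b hb => ?_
        rw [Module.End.mem_eigenspace_iff] at ha hb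
        refine Submodule.mem_iSup_of_mem (μ + ν) (Module.End.mem_eigenspace_iff.2 ?_)
        rw [TensorProduct.mk_apply, tensor_act _ _ hz, ha, hb, sg_zero, Module.End.one_apply,
          TensorProduct.tmul_smul, ← TensorProduct.smul_tmul', add_smul]
      exact hb (Submodule.mem_top (x := b))
    exact ha (Submodule.mem_top (x := a))
  refine eq_top_iff.2 fun t _ => ?_
  induction t using TensorProduct.induction_on with
  | zero => exact zero_mem _
  | add s t hs ht => exact add_mem (hs trivial) (ht trivial)
  | tmul a b => exact hmem a b

lemma memF_kosRep_tensor (hg : g.IsClassical) {M : g.SuperModule} (hM : M.MemF) (n : ℕ) :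
    ((g.kosRep n).tensor M.toSRep).toSuperModule.MemF := by
  have := hg.finiteDimensional
  have := hM.1
  have := (g.kosDeg_finrank n).1
  refine ⟨inferInstanceAs (FiniteDimensional ℂ (g.kosDeg n ⊗[ℂ] M.carrier)), ?_⟩
  refine (hg.completelyReducible_iff ((g.kosRep n).tensor M.toSRep).act fun x hx y hy m => ?_).2
    fun z hz => iSup_eigenspace_tensor _ _ hz.1 (iSup_eigenspace_kosRep hg hz n) ?_
  · simpa using ((g.kosRep n).tensor M.toSRep).act_bracket hx hy m
  · exact (hg.completelyReducible_iff M.act fun x hx y hy m => by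
      simpa using M.act_bracket 0 0 x hx y hy m).1 hM.2 z hz

lemma isProjectiveInF_kosRep_tensor (hg : g.IsClassical) {M : g.SuperModule} (hM : M.MemF)
    (n : ℕ) : g.IsProjectiveInF ((g.kosRep n).tensor M.toSRep).toSuperModule := by
  refine ⟨memF_kosRep_tensor hg hM n, fun A B hA _ p hp f => ?_⟩
  obtain ⟨h, hh, hph⟩ := exists_isHom_lift (SuperModule.isHom_toSRep p) hp hA.2
    (isHom_of_superHom f)
  exact ⟨homOfIsHom h hh, hph⟩

variable (g) in
/-- The differential of the Koszul complex. -/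
def kosDiff (n : ℕ) : g.kosDeg (n + 1) →ₗ[ℂ] g.kosDeg n :=
  g.kos.opD.restrict fun _ hk => opD_mem_kosDeg hk

variable (g) in
/-- The augmentation of the Koszul complex. -/
def kosAug : g.kosDeg 0 →ₗ[ℂ] ℂ := g.counit ∘ₗ (g.kosDeg 0).subtype

lemma kosAug_apply (k : g.kosDeg 0) : g.kosAug k = g.counit k := rfl

lemma counit_eq_zero {n : ℕ} {k : g.Kos} (hk : k ∈ g.kosDeg (n + 1)) : g.counit k = 0 := by
  have h : g.counit (g.kos.opE k) = 0 := g.exists_counit.choose_spec.2.2 _ k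
  rw [mem_kosDeg.1 hk, map_smul, smul_eq_mul, mul_eq_zero] at h
  exact h.resolve_left (Nat.cast_ne_zero.2 n.succ_ne_zero)

lemma exact_kosDiff_kosAug (hg : g.IsClassical) : Function.Exact (g.kosDiff 0) g.kosAug := by
  intro k
  refine ⟨fun h => ?_, ?_⟩
  · obtain ⟨u, hu, huk⟩ := exists_opD_eq hg k.2 (opD_eq_zero k.2) h
    exact ⟨⟨u, hu⟩, Subtype.ext huk⟩
  · rintro ⟨u, rfl⟩
    exact counit_opD _

lemma exact_kosDiff (hg : g.IsClassical) (n : ℕ) :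
    Function.Exact (g.kosDiff (n + 1)) (g.kosDiff n) := by
  intro k
  refine ⟨fun h => ?_, ?_⟩
  · obtain ⟨u, hu, huk⟩ := exists_opD_eq hg k.2 (congrArg Subtype.val h) (counit_eq_zero k.2)
    exact ⟨⟨u, hu⟩, Subtype.ext huk⟩
  · rintro ⟨u, rfl⟩
    exact Subtype.ext (g.kos.opD_opD _)

lemma kosAug_surjective : Function.Surjective g.kosAug := fun c =>
  ⟨c • ⟨g.kvac, vac_mem_kosDeg⟩, by rw [map_smul, kosAug_apply, counit_vac, smul_eq_mul, mul_one]⟩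

lemma kosDiff_act (n : ℕ) {i : ZMod 2} {x : g.carrier} (hx : x ∈ g.part i)
    (k : g.kosDeg (n + 1)) :
    g.kosDiff n ((g.kosRep (n + 1)).act x k) = ssgn 1 i • (g.kosRep n).act x (g.kosDiff n k) :=
  Subtype.ext (g.kos.opD_opI _ hx)

lemma kosDiff_σ (n : ℕ) (k : g.kosDeg (n + 1)) :
    g.kosDiff n ((g.kosRep (n + 1)).σ k) = - (g.kosRep n).σ (g.kosDiff n k) :=
  Subtype.ext (neg_eq_iff_eq_neg.1 (g.kos.σ_opD _).symm)

lemma kosDiff_sg (n : ℕ) (i : ZMod 2) (k : g.kosDeg (n + 1)) :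
    g.kosDiff n ((g.kosRep (n + 1)).sg i k) = ssgn 1 i • (g.kosRep n).sg i (g.kosDiff n k) := by
  rcases zmodTwo_cases i with rfl | rfl
  · simp
  · simp [kosDiff_σ]

lemma kosDiff_rTensor_isHom {M : Type*} [AddCommGroup M] [Module ℂ M] (R : SRep g.bracketData M)
    (n : ℕ) : IsHom ((g.kosRep (n + 1)).tensor R) ((g.kosRep n).tensor R)
      ((g.kosDiff n).rTensor M) := by
  have hσ : ∀ t, (g.kosDiff n).rTensor M (((g.kosRep (n + 1)).tensor R).σ t) =
      - ((g.kosRep n).tensor R).σ ((g.kosDiff n).rTensor M t) := by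
    intro t
    induction t using TensorProduct.induction_on with
    | zero => simp
    | add s t hs ht => simp only [map_add, hs, ht, neg_add]
    | tmul a b =>
      rw [tensor_σ, rTensor_tmul, rTensor_tmul, tensor_σ, kosDiff_σ, TensorProduct.neg_tmul]
  have hact : ∀ i, ∀ x ∈ g.part i, ∀ t,
      (g.kosDiff n).rTensor M (((g.kosRep (n + 1)).tensor R).act x t) =
        ssgn 1 i • ((g.kosRep n).tensor R).act x ((g.kosDiff n).rTensor M t) := by
    intro i x hx t
    induction t using TensorProduct.induction_on with
    | zero => simp
    | add s t hs ht => simp only [map_add, hs, ht, smul_add]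
    | tmul a b =>
      rw [tensor_act _ _ hx, map_add, rTensor_tmul, rTensor_tmul, rTensor_tmul, tensor_act _ _ hx,
        kosDiff_act n hx, kosDiff_sg, smul_add, TensorProduct.smul_tmul', TensorProduct.smul_tmul']
  intro i x hx t
  rw [hact i x hx]
  rcases zmodTwo_cases i with rfl | rfl
  · simp
  · rw [sg_one, sg_one, hσ, map_neg, σσ, ssgn_one_one]
    exact (neg_one_smul ℂ _).trans (map_neg (((g.kosRep n).tensor R).act x) _).symm

variable (g) in
/-- The augmentation of the Koszul complex with coefficients. -/
def kosAugTensor (M : Type*) [AddCommGroup M] [Module ℂ M] : g.kosDeg 0 ⊗[ℂ] M →ₗ[ℂ] M :=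
  (TensorProduct.lid ℂ M).toLinearMap ∘ₗ g.kosAug.rTensor M

lemma kosAugTensor_tmul {M : Type*} [AddCommGroup M] [Module ℂ M] (k : g.kosDeg 0) (m : M) :
    g.kosAugTensor M (k ⊗ₜ m) = g.counit k • m := rfl

lemma kosAugTensor_isHom {M : Type*} [AddCommGroup M] [Module ℂ M] (R : SRep g.bracketData M) :
    IsHom ((g.kosRep 0).tensor R) R (g.kosAugTensor M) := by
  have hσ : ∀ t, g.kosAugTensor M (((g.kosRep 0).tensor R).σ t) = R.σ (g.kosAugTensor M t) := by
    intro t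
    induction t using TensorProduct.induction_on with
    | zero => simp
    | add s t hs ht => simp only [map_add, hs, ht]
    | tmul a b =>
      rw [tensor_σ, kosAugTensor_tmul, kosAugTensor_tmul, kosRep_σ, counit_σ, map_smul]
  have hact : ∀ i, ∀ x ∈ g.part i, ∀ t,
      g.kosAugTensor M (((g.kosRep 0).tensor R).act x t) = R.act x (g.kosAugTensor M t) := by
    intro i x hx t
    induction t using TensorProduct.induction_on with
    | zero => simp
    | add s t hs ht => simp only [map_add, hs, ht]
    | tmul a b =>
      have ha : g.counit ((g.kosRep 0).sg i a : g.kosDeg 0) = g.counit a := by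
        rcases zmodTwo_cases i with rfl | rfl
        · simp
        · rw [sg_one, kosRep_σ, counit_σ]
      rw [tensor_act _ _ hx, map_add, kosAugTensor_tmul, kosAugTensor_tmul, kosAugTensor_tmul,
        kosRep_act, counit_opI, zero_smul, zero_add, ha, map_smul]
  intro i x hx t
  rw [hact i x hx]
  rcases zmodTwo_cases i with rfl | rfl
  · simp
  · rw [sg_one, sg_one, hσ, R.σσ]

/-- The Koszul resolution of an object of `F`. -/
def kosRes (hg : g.IsClassical) {M : g.SuperModule} (hM : M.MemF) : g.ProjResF M where
  P n := ((g.kosRep n).tensor M.toSRep).toSuperModule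
  d n := homOfIsHom₂ ((g.kosDiff n).rTensor M.carrier) (kosDiff_rTensor_isHom M.toSRep n)
  aug := homOfIsHom (g.kosAugTensor M.carrier) (kosAugTensor_isHom M.toSRep)
  projective n := isProjectiveInF_kosRep_tensor hg hM n
  aug_surjective := (TensorProduct.lid ℂ M.carrier).surjective.comp
    (LinearMap.rTensor_surjective M.carrier kosAug_surjective)
  exact_at_zero := by
    have h := (Module.Flat.rTensor_exact M.carrier (exact_kosDiff_kosAug hg)).linearMap_ker_eq
    exact h.symm.trans (LinearEquiv.ker_comp (TensorProduct.lid ℂ M.carrier) _).symm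
  exact n := (Module.Flat.rTensor_exact M.carrier (exact_kosDiff hg n)).linearMap_ker_eq.symm

end LieSuperAlgebra

/-! ### Rate of growth -/

lemma Nat.multichoose_succ_le (d n : ℕ) (hn : 1 ≤ n) :
    Nat.multichoose (d + 1) n ≤ (d + 1) ^ d * n ^ d := by
  rw [Nat.multichoose_eq, show d + 1 + n - 1 = n + d by omega, Nat.choose_symm_add, ← mul_pow]
  exact (Nat.choose_le_pow _ _).trans (Nat.pow_le_pow_left (by nlinarith) d)

lemma hasGrowthRateLE_of_le {f : ℕ → ℕ} {c d : ℕ} (h : ∀ n, f n ≤ c * Nat.multichoose d n) :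
    HasGrowthRateLE f d := by
  rcases d with _ | d
  · refine ⟨1, one_pos, fun t ht => ?_⟩
    obtain ⟨t, rfl⟩ := Nat.exists_eq_add_of_le' ht
    have h0 := h (t + 1)
    rw [Nat.multichoose_zero_succ, mul_zero, Nat.le_zero] at h0
    rw [h0, Nat.cast_zero]
    positivity
  · refine ⟨(c + 1) * (d + 1) ^ d, by positivity, fun t ht => ?_⟩
    have h1 : f t ≤ (c + 1) * ((d + 1) ^ d * t ^ d) :=
      (h t).trans (Nat.mul_le_mul (Nat.le_succ c) (Nat.multichoose_succ_le d t ht))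
    rw [Nat.cast_add_one, add_sub_cancel_right, Real.rpow_natCast, mul_assoc]
    exact_mod_cast h1

lemma HasGrowthRateLE.growthRate_le {f : ℕ → ℕ} {c : ℕ} (h : HasGrowthRateLE f c) :
    growthRate f ≤ c :=
  sInf_le ⟨c, rfl, h⟩

namespace LieSuperAlgebra

variable {g : LieSuperAlgebra}

lemma kosRes_dims_le (hg : g.IsClassical) {M : g.SuperModule} (hM : M.MemF) (n : ℕ) :
    (kosRes hg hM).dims n ≤ finrank ℂ M.carrier * 2 ^ finrank ℂ (g.part 1) *
      Nat.multichoose (finrank ℂ (g.part 1)) n := by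
  have := hg.finiteDimensional
  have h : (kosRes hg hM).dims n = finrank ℂ (g.kosDeg n) * finrank ℂ M.carrier :=
    Module.finrank_tensorProduct
  rw [h, mul_comm, mul_assoc]
  exact Nat.mul_le_mul_left _ (g.kosDeg_finrank n).2

end LieSuperAlgebra

/-!
STATEMENT 4: For a classical Lie superalgebra `g` and `M` in `F = F(g, g₀̄)`, the
complexity of `M` (the rate of growth of a minimal projective resolution) is at most
`dim_ℂ g₁̄`; in particular `M` admits a projective resolution in `F` whose rate of
growth is at most `dim_ℂ g₁̄`.
-/

open LieSuperAlgebra in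
theorem complexity_le_dim_odd_part
    (g : LieSuperAlgebra) (hg : g.IsClassical)
    (M : g.SuperModule) (hM : M.MemF) :
    (∀ R : g.ProjResF M, R.IsMinimal →
        growthRate R.dims ≤ (Module.finrank ℂ (g.part 1) : ℕ∞)) ∧
    (∃ R : g.ProjResF M,
        growthRate R.dims ≤ (Module.finrank ℂ (g.part 1) : ℕ∞)) := by
  refine ⟨fun R hR => ?_, kosRes hg hM, ?_⟩
  · exact (hasGrowthRateLE_of_le fun n =>
      (hR (kosRes hg hM) n).trans (kosRes_dims_le hg hM n)).growthRate_le
  · exact (hasGrowthRateLE_of_le (kosRes_dims_le hg hM)).growthRate_le
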